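/- arXiv:1612.00242 — 6 statements merged into one kernel-verified Lean document; each statement's English description precedes it below -/
import Mathlib

section
/- Let G = ⟨x,y | x² = y³ = ((xy)⁴(xy²)³(xy)²(xy²)²xyxy²)² = 1⟩. There exists an integer N₀ such that for every integer N ≥ N₀, the elements A = (xy)^N and B = (xy²)^N of G freely generate a free subgroup of G; that is, the homomorphism from the free group of rank 2 to G sending the two free generators to A and B is injective. -/
/-- The free product `ℤ/2 * ℤ/3` is realised as a quotient of the free group on two
generators; here we work with the free group `F` on generators `x, y` and impose the
relations `x² = y³ = W² = 1` all at once via `PresentedGroup`. -/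
abbrev F : Type := FreeGroup (Fin 2)

/-- The generator `x` (of order 2 in the quotient). -/
def x : F := FreeGroup.of 0

/-- The generator `y` (of order 3 in the quotient). -/
def y : F := FreeGroup.of 1

/-- The relators of the generalised triangle group of type (2,3,2) with word `W`. -/
def rels (W : F) : Set F := {x ^ 2, y ^ 3, W ^ 2}

/-- The generalised triangle group `⟨x, y | x² = y³ = W² = 1⟩`. -/
abbrev GT (W : F) : Type := PresentedGroup (rels W)

/-- The canonical projection from the free group to the generalised triangle group. -/
def mk (W : F) : F →* GT W := PresentedGroup.mk (rels W)

/-- The word `(xy)⁴(xy²)³(xy)²(xy²)²xyxy²`. -/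
def W13 : F := (x*y)^4 * (x*y^2)^3 * (x*y)^2 * (x*y^2)^2 * (x*y) * (x*y^2)

namespace GenTriangle

/-! ### Words, holonomy and van Kampen diagrams -/

section Words

variable {D E H : Type} [Group H]

/-- The sequence of letters spelled by a list of darts and powers of `y`. -/
def shape (l : List (D ⊕ Bool)) : List (Unit ⊕ Bool) := l.map (Sum.map (fun _ => ()) id)

/-- The value of a letter, when darts are evaluated by `θ` and `y` by `η`. -/
def letterVal (η : H) (θ : D → H) : D ⊕ Bool → H :=
  Sum.elim θ (fun b => cond b η η⁻¹)

/-- The value of a word. -/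
def ev (η : H) (θ : D → H) (l : List (D ⊕ Bool)) : H := (l.map (letterVal η θ)).prod

/-- The values `v` on the darts of a word are those obtained by developing the word from `c`. -/
def Coh (η : H) (θ v : D → H) : H → List (D ⊕ Bool) → Prop
  | _, [] => True
  | c, Sum.inl d :: l => v d = c ∧ Coh η θ v (c * θ d) l
  | c, Sum.inr b :: l => Coh η θ v (c * cond b η η⁻¹) l

/-- The formal inverse of a word (darts keep their names). -/
def invWord (l : List (D ⊕ Bool)) : List (D ⊕ Bool) := (l.map (Sum.map id not)).reverse

/-- The darts of a word. -/
def darts (l : List (D ⊕ Bool)) : List D := l.filterMap Sum.getLeft?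

@[simp] lemma darts_nil : darts ([] : List (D ⊕ Bool)) = [] := rfl

@[simp] lemma darts_cons_inl (d : D) (l : List (D ⊕ Bool)) :
    darts (Sum.inl d :: l) = d :: darts l := rfl

@[simp] lemma darts_cons_inr (b : Bool) (l : List (D ⊕ Bool)) :
    darts (Sum.inr b :: l) = darts l := rfl

variable {η : H} {θ v : D → H}

@[simp] lemma ev_nil : ev η θ [] = 1 := rfl

@[simp] lemma ev_cons (a : D ⊕ Bool) (l : List (D ⊕ Bool)) :
    ev η θ (a :: l) = letterVal η θ a * ev η θ l := by simp [ev]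

@[simp] lemma ev_append (l m : List (D ⊕ Bool)) : ev η θ (l ++ m) = ev η θ l * ev η θ m := by
  simp [ev]

lemma coh_append (c : H) (l m : List (D ⊕ Bool)) :
    Coh η θ v c (l ++ m) ↔ Coh η θ v c l ∧ Coh η θ v (c * ev η θ l) m := by
  induction l generalizing c with
  | nil => simp [Coh]
  | cons a l ih =>
    rcases a with d | b <;> simp [Coh, ih, letterVal, mul_assoc, and_assoc]

lemma ev_map (f : E → D) (l : List (E ⊕ Bool)) :
    ev η θ (l.map (Sum.map f id)) = ev η (θ ∘ f) l := by
  induction l with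
  | nil => rfl
  | cons a l ih => rcases a with d | b <;> simp [ih, letterVal]

lemma coh_map (f : E → D) (c : H) (l : List (E ⊕ Bool)) :
    Coh η θ v c (l.map (Sum.map f id)) ↔ Coh η (θ ∘ f) (v ∘ f) c l := by
  induction l generalizing c with
  | nil => simp [Coh]
  | cons a l ih => rcases a with d | b <;> simp [Coh, ih]

lemma coh_congr {v' : D → H} (c : H) (l : List (D ⊕ Bool)) (h : ∀ d ∈ darts l, v d = v' d)
    (hc : Coh η θ v c l) : Coh η θ v' c l := by
  induction l generalizing c with
  | nil => trivial
  | cons a l ih =>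
    rcases a with d | b
    · simp only [darts_cons_inl, List.mem_cons] at h
      exact ⟨(h d (Or.inl rfl)) ▸ hc.1, ih _ (fun e he => h e (Or.inr he)) hc.2⟩
    · exact ih _ (fun e he => h e (by simpa using he)) hc

lemma exists_coh (η : H) (θ : D → H) (c : H) (l : List (D ⊕ Bool)) (h : (darts l).Nodup) :
    ∃ v, Coh η θ v c l := by
  classical
  induction l generalizing c with
  | nil => exact ⟨fun _ => 1, trivial⟩
  | cons a l ih =>
    rcases a with d | b
    · have h' : d ∉ darts l ∧ (darts l).Nodup := by simpa using h
      obtain ⟨v, hv⟩ := ih (c * θ d) h'.2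
      refine ⟨Function.update v d c, by simp, coh_congr _ _ (fun e he => ?_) hv⟩
      rw [Function.update_of_ne]
      rintro rfl
      exact h'.1 he
    · exact ih _ (by simpa using h)

lemma ev_invWord (l : List (D ⊕ Bool)) (θ' : D → H) (hθ : ∀ d, θ' d = (θ d)⁻¹) :
    ev η θ' (invWord l) = (ev η θ l)⁻¹ := by
  induction l with
  | nil => simp [invWord]
  | cons a l ih =>
    have : invWord (a :: l) = invWord l ++ [Sum.map id not a] := by simp [invWord]
    rw [this, ev_append, ih]
    rcases a with d | b
    · simp [letterVal, hθ]
    · cases b <;> simp [letterVal]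

lemma coh_invWord (l : List (D ⊕ Bool)) (θ' v' : D → H) (hθ : ∀ d, θ' d = (θ d)⁻¹)
    (hv : ∀ d, v' d = v d * θ d) (c : H) (hc : Coh η θ v c l) :
    Coh η θ' v' (c * ev η θ l) (invWord l) := by
  induction l generalizing c with
  | nil => simp [invWord, Coh]
  | cons a l ih =>
    have : invWord (a :: l) = invWord l ++ [Sum.map id not a] := by simp [invWord]
    rw [this, coh_append, ev_invWord l θ' hθ]
    rcases a with d | b
    · have := ih _ hc.2
      simp only [ev_cons, letterVal, Sum.elim_inl, Sum.map_inl, id, Coh, and_true]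
      refine ⟨by simpa [mul_assoc] using this, ?_⟩
      rw [hv, hc.1]; group
    · have := ih _ hc
      simp only [ev_cons, letterVal, Sum.elim_inr, Sum.map_inr, Coh, and_true]
      simpa [mul_assoc] using this

@[simp] lemma shape_append (l m : List (D ⊕ Bool)) : shape (l ++ m) = shape l ++ shape m := by
  simp [shape]

lemma shape_map (f : E → D) (l : List (E ⊕ Bool)) :
    shape (l.map (Sum.map f id)) = shape l := by
  simp only [shape, List.map_map]
  congr 1
  funext a
  rcases a with d | b <;> rfl

lemma shape_invWord (l : List (D ⊕ Bool)) : shape (invWord l) = invWord (shape l) := by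
  simp only [shape, invWord, List.map_reverse, List.map_map]
  congr 2
  funext a
  rcases a with d | b <;> rfl

@[simp] lemma darts_append (l m : List (D ⊕ Bool)) : darts (l ++ m) = darts l ++ darts m := by
  simp [darts]

lemma darts_map (f : E → D) (l : List (E ⊕ Bool)) :
    darts (l.map (Sum.map f id)) = (darts l).map f := by
  induction l with
  | nil => rfl
  | cons a l ih => rcases a with d | b <;> simp [ih]

lemma darts_invWord (l : List (D ⊕ Bool)) : darts (invWord l) = (darts l).reverse := by
  simp only [darts, invWord, List.filterMap_reverse, List.filterMap_map]
  congr 2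
  funext a
  rcases a with d | b <;> rfl

end Words

/-- A van Kampen diagram over `⟨x, y | x², y³, R⟩` with boundary word `l`, all `y`-edges being
contracted.  Planarity is encoded by `exact`: closed cochains are coboundaries. -/
structure Diagram (R : Set (List (Unit ⊕ Bool))) (l : List (Unit ⊕ Bool)) where
  D : Type
  fin : Fintype D
  α : D → D
  invol : ∀ d, α (α d) = d
  outer : List (D ⊕ Bool)
  faces : List (List (D ⊕ Bool))
  shape_outer : shape outer = l
  shape_faces : ∀ f ∈ faces, shape f ∈ R
  nodup : (darts (outer ++ faces.flatten)).Nodup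
  cover : ∀ d, d ∈ darts (outer ++ faces.flatten)
  exact : ∀ (H : Type) [Group H] (η : H), η ^ 3 = 1 → ∀ θ : D → H,
    (∀ d, θ (α d) = (θ d)⁻¹) → ev η θ outer = 1 → (∀ f ∈ faces, ev η θ f = 1) →
    ∃ v : D → H, (∀ d, v (α d) = v d * θ d) ∧ (∃ c, Coh η θ v c outer) ∧
      ∀ f ∈ faces, ∃ c, Coh η θ v c f

namespace Diagram

variable {R : Set (List (Unit ⊕ Bool))} {l m r : List (Unit ⊕ Bool)}

/-- The empty diagram. -/
lemma nil : Nonempty (Diagram R []) :=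
  ⟨{ D := Empty, fin := inferInstance, α := id, invol := fun _ => rfl, outer := [], faces := []
     shape_outer := rfl, shape_faces := by simp, nodup := by simp [darts], cover := nofun
     exact := fun H _ η _ θ _ _ _ => ⟨nofun, nofun, ⟨1, trivial⟩, by simp⟩ }⟩

lemma rotate (h : Nonempty (Diagram R (l ++ m))) : Nonempty (Diagram R (m ++ l)) := by
  obtain ⟨G⟩ := h
  obtain ⟨A, B, hAB, hA, hB⟩ := List.map_eq_append_iff.1 G.shape_outer
  have hp : (darts (G.outer ++ G.faces.flatten)).Perm (darts ((B ++ A) ++ G.faces.flatten)) := by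
    apply List.Perm.filterMap
    rw [hAB]
    exact (List.perm_append_comm).append_right _
  refine ⟨{ G with
    outer := B ++ A
    shape_outer := by rw [shape_append]; exact congrArg₂ _ hB hA
    nodup := hp.nodup_iff.1 G.nodup
    cover := fun d => hp.mem_iff.1 (G.cover d)
    exact := fun H _ η hη θ hθ ho hf => ?_ }⟩
  rw [ev_append] at ho
  obtain ⟨v, hv, ⟨c, hc⟩, hF⟩ := G.exact H η hη θ hθ
    (by rw [hAB, ev_append]; exact mul_eq_one_comm.1 ho) hf
  refine ⟨v, hv, ⟨c * ev η θ A, ?_⟩, hF⟩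
  rw [hAB, coh_append] at hc
  rw [coh_append, mul_assoc, mul_eq_one_comm.1 ho, mul_one]
  exact hc.symm

lemma cut (hr : r ∈ R) (h : Nonempty (Diagram R (r ++ m))) : Nonempty (Diagram R m) := by
  obtain ⟨G⟩ := h
  obtain ⟨A, B, hAB, hA, hB⟩ := List.map_eq_append_iff.1 G.shape_outer
  have hp : (darts (G.outer ++ G.faces.flatten)).Perm
      (darts (B ++ (A :: G.faces).flatten)) := by
    apply List.Perm.filterMap
    rw [hAB, List.flatten_cons, ← List.append_assoc]
    exact (List.perm_append_comm).append_right _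
  refine ⟨{ G with
    outer := B
    faces := A :: G.faces
    shape_outer := hB
    shape_faces := by
      rintro f (_ | ⟨_, hf⟩)
      · have : shape A = r := hA
        rw [this]; exact hr
      · exact G.shape_faces f hf
    nodup := hp.nodup_iff.1 G.nodup
    cover := fun d => hp.mem_iff.1 (G.cover d)
    exact := fun H _ η hη θ hθ ho hf => ?_ }⟩
  have hA1 : ev η θ A = 1 := hf A (by simp)
  obtain ⟨v, hv, ⟨c, hc⟩, hF⟩ := G.exact H η hη θ hθ
    (by rw [hAB, ev_append, hA1, ho, one_mul]) (fun f hf' => hf f (by simp [hf']))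
  rw [hAB, coh_append, hA1, mul_one] at hc
  refine ⟨v, hv, ⟨c, hc.2⟩, ?_⟩
  rintro f (_ | ⟨_, hf⟩)
  · exact ⟨c, hc.1⟩
  · exact hF f hf

lemma insert {E : Type} [Fintype E] (r₀ : List (E ⊕ Bool)) (hnd : (darts r₀).Nodup)
    (hcov : ∀ e, e ∈ darts r₀) (hr : invWord (shape r₀) ∈ R) (h : Nonempty (Diagram R m)) :
    Nonempty (Diagram R (shape r₀ ++ m)) := by
  obtain ⟨G⟩ := h
  let := G.fin
  let i₀ : G.D → G.D ⊕ E × Bool := Sum.inl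
  let i₁ : E → G.D ⊕ E × Bool := fun e => Sum.inr (e, true)
  let i₂ : E → G.D ⊕ E × Bool := fun e => Sum.inr (e, false)
  let B := r₀.map (Sum.map i₁ id)
  let B' := (invWord r₀).map (Sum.map i₂ id)
  let C := G.outer.map (Sum.map i₀ id)
  let Fs := G.faces.map (List.map (Sum.map i₀ id))
  have hflat : Fs.flatten = G.faces.flatten.map (Sum.map i₀ id) := (List.map_flatten).symm
  have hd : (darts ((B ++ C) ++ (B' :: Fs).flatten)).Perm
      (((darts r₀).map i₁ ++ (darts r₀).reverse.map i₂) ++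
        (darts (G.outer ++ G.faces.flatten)).map i₀) := by
    rw [List.flatten_cons, hflat]
    simp only [darts_append, B, C, B', darts_map, darts_invWord, List.map_append]
    rw [List.append_assoc, List.append_assoc]
    refine List.Perm.append_left _ ?_
    rw [← List.append_assoc, ← List.append_assoc]
    exact (List.perm_append_comm).append_right _
  refine ⟨{
    D := G.D ⊕ E × Bool
    fin := inferInstance
    α := Sum.map G.α (Prod.map id not)
    invol := by rintro (d | ⟨e, b⟩) <;> simp [G.invol]
    outer := B ++ C
    faces := B' :: Fs
    shape_outer := by
      rw [shape_append, shape_map, shape_map, G.shape_outer]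
    shape_faces := ?_
    nodup := ?_
    cover := ?_
    exact := fun H _ η hη θ hθ ho hf => ?_ }⟩
  · rintro f (_ | ⟨_, hf⟩)
    · rw [shape_map, shape_invWord]; exact hr
    · obtain ⟨f', hf', rfl⟩ := List.mem_map.1 hf
      rw [shape_map]; exact G.shape_faces f' hf'
  · rw [hd.nodup_iff]
    refine List.Nodup.append (List.Nodup.append (hnd.map ?_) ((List.nodup_reverse.2 hnd).map ?_)
      ?_) (G.nodup.map Sum.inl_injective) ?_
    · intro a b hab; simpa [i₁] using hab
    · intro a b hab; simpa [i₂] using hab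
    · intro a ha hb
      obtain ⟨e, -, rfl⟩ := List.mem_map.1 ha
      obtain ⟨e', -, he⟩ := List.mem_map.1 hb
      simp [i₁, i₂] at he
    · intro a ha hb
      obtain ⟨e, -, rfl⟩ := List.mem_map.1 hb
      simp [i₀, i₁, i₂] at ha
  · intro d
    rw [hd.mem_iff]
    rcases d with d | ⟨e, b⟩
    · exact List.mem_append_right _ (List.mem_map_of_mem (G.cover d))
    · refine List.mem_append_left _ ?_
      cases b
      · exact List.mem_append_right _ (List.mem_map_of_mem (List.mem_reverse.2 (hcov e)))
      · exact List.mem_append_left _ (List.mem_map_of_mem (hcov e))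
  · have hθ₂ : ∀ e, (θ ∘ i₂) e = ((θ ∘ i₁) e)⁻¹ := fun e => hθ (i₁ e)
    have hB : ev η (θ ∘ i₁) r₀ = 1 := by
      have := hf B' (by simp)
      rw [ev_map, ev_invWord (θ := θ ∘ i₁) _ _ hθ₂] at this
      exact inv_eq_one.1 this
    have hC : ev η (θ ∘ i₀) G.outer = 1 := by
      rwa [ev_append, ev_map, ev_map, hB, one_mul] at ho
    obtain ⟨v, hv, ⟨c, hc⟩, hF⟩ := G.exact H η hη (θ ∘ i₀) (fun d => hθ (i₀ d)) hC (by
      intro f hf'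
      rw [← ev_map]
      exact hf _ (by simp only [List.mem_cons, Fs]; exact Or.inr (List.mem_map_of_mem hf')))
    obtain ⟨v₁, hv₁⟩ := exists_coh η (θ ∘ i₁) c r₀ hnd
    refine ⟨Sum.elim v (fun p => cond p.2 (v₁ p.1) (v₁ p.1 * θ (i₁ p.1))), ?_, ⟨c, ?_⟩, ?_⟩
    · rintro (d | ⟨e, b⟩)
      · exact hv d
      · cases b
        · have h1 : θ (Sum.inr (e, false)) = (θ (i₁ e))⁻¹ := hθ₂ e
          simp [h1]
        · simp [i₁]
    · rw [coh_append, coh_map, coh_map, ev_map, hB, mul_one]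
      exact ⟨hv₁, hc⟩
    · rintro f (_ | ⟨_, hf⟩)
      · refine ⟨c, ?_⟩
        rw [coh_map]
        have := coh_invWord r₀ (θ ∘ i₂) (fun e => v₁ e * θ (i₁ e)) hθ₂ (fun _ => rfl) c hv₁
        rwa [hB, mul_one] at this
      · obtain ⟨f', hf', rfl⟩ := List.mem_map.1 hf
        obtain ⟨c', hc'⟩ := hF f' hf'
        exact ⟨c', by rw [coh_map]; exact hc'⟩

/-- Words in `y` which are trivial modulo `y³` may be inserted. -/
lemma insert_y (Y : List Bool)
    (hY : ∀ (H : Type) [Group H] (η : H), η ^ 3 = 1 → (Y.map (fun b => cond b η η⁻¹)).prod = 1)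
    (h : Nonempty (Diagram R m)) : Nonempty (Diagram R (Y.map Sum.inr ++ m)) := by
  obtain ⟨G⟩ := h
  have hev : ∀ (H : Type) [Group H] (η : H) (θ : G.D → H), η ^ 3 = 1 →
      ev η θ (Y.map Sum.inr) = 1 := fun H _ η θ hη => by
    have := hY H η hη
    rw [← this, ev, List.map_map]; rfl
  have hcoh : ∀ (H : Type) [Group H] (η c : H) (θ v : G.D → H),
      Coh η θ v c (Y.map Sum.inr) := by
    intro H _ η c θ v
    clear hY hev
    induction Y generalizing c with
    | nil => trivial
    | cons b Y ih => exact ih _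
  have hd : darts (Y.map Sum.inr ++ G.outer ++ G.faces.flatten)
      = darts (G.outer ++ G.faces.flatten) := by
    simp [darts, List.filterMap_map, Function.comp_def]
  refine ⟨{ G with
    outer := Y.map Sum.inr ++ G.outer
    shape_outer := by
      rw [shape_append, G.shape_outer]; simp [shape]
    nodup := hd ▸ G.nodup
    cover := fun d => hd ▸ G.cover d
    exact := fun H _ η hη θ hθ ho hf => ?_ }⟩
  rw [ev_append, hev H η θ hη, one_mul] at ho
  obtain ⟨v, hv, ⟨c, hc⟩, hF⟩ := G.exact H η hη θ hθ ho hf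
  exact ⟨v, hv, ⟨c, by rw [coh_append, hev H η θ hη, mul_one]; exact ⟨hcoh _ _ _ _ _, hc⟩⟩, hF⟩

/-- Words in `y` which are trivial modulo `y³` may be deleted. -/
lemma delete_y (Y : List Bool)
    (hY : ∀ (H : Type) [Group H] (η : H), η ^ 3 = 1 → (Y.map (fun b => cond b η η⁻¹)).prod = 1)
    (h : Nonempty (Diagram R (Y.map Sum.inr ++ m))) : Nonempty (Diagram R m) := by
  obtain ⟨G⟩ := h
  obtain ⟨A, B, hAB, hA, hB⟩ := List.map_eq_append_iff.1 G.shape_outer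
  have hAY : A = Y.map Sum.inr := by
    have key : ∀ (A : List (G.D ⊕ Bool)) (Y : List Bool),
        A.map (Sum.map (fun _ => ()) id) = Y.map Sum.inr → A = Y.map Sum.inr := by
      intro A
      induction A with
      | nil => rintro (_ | ⟨b, Y⟩) hA <;> simp_all
      | cons a A ih =>
        rintro (_ | ⟨b, Y⟩) hA
        · simp at hA
        · simp only [List.map_cons, List.cons.injEq] at hA ⊢
          refine ⟨?_, ih Y hA.2⟩
          rcases a with d | b
          · simp at hA
          · simpa using hA.1
    exact key A Y hA
  have hev : ∀ (H : Type) [Group H] (η : H) (θ : G.D → H), η ^ 3 = 1 → ev η θ A = 1 :=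
    fun H _ η θ hη => by
      have := hY H η hη
      rw [← this, ev, hAY, List.map_map]; rfl
  have hd : darts (G.outer ++ G.faces.flatten) = darts (B ++ G.faces.flatten) := by
    rw [hAB, hAY]
    simp [darts, List.filterMap_map, Function.comp_def]
  refine ⟨{ G with
    outer := B
    shape_outer := hB
    nodup := hd ▸ G.nodup
    cover := fun d => hd ▸ G.cover d
    exact := fun H _ η hη θ hθ ho hf => ?_ }⟩
  obtain ⟨v, hv, ⟨c, hc⟩, hF⟩ := G.exact H η hη θ hθ
    (by rw [hAB, ev_append, hev H η θ hη, one_mul, ho]) hf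
  rw [hAB, coh_append, hev H η θ hη, mul_one] at hc
  exact ⟨v, hv, ⟨c, hc.2⟩, hF⟩

end Diagram

/-! ### Existence of diagrams -/

section Existence

variable {D E H : Type} [Group H]

/-- The word `x y^(u 0) x y^(u 1) ⋯`, of length `n`, on the darts `δ 0, δ 1, …`. -/
def word (n : ℕ) (δ : ℕ → D) (u : ℕ → List Bool) : List (D ⊕ Bool) :=
  (List.range n).flatMap fun i => Sum.inl (δ i) :: (u i).map Sum.inr

/-- The exponents of `y` in the root of the relator. -/
def expo (c : ZMod 13) : Bool :=
  [true, true, true, true, false, false, false, true, true, false, false, true, false].getD c.val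
    true

/-- The relator `W²`, with darts named by `ZMod 26`. -/
def relDarts : List (ZMod 26 ⊕ Bool) := word 26 (fun i => (i : ZMod 26)) fun i => [expo i]

/-- The relator `W²`. -/
def relWord : List (Unit ⊕ Bool) := word 26 (fun _ => ()) fun i => [expo i]

/-- The words allowed as faces. -/
def faceWords : Set (List (Unit ⊕ Bool)) :=
  {relWord, invWord relWord, [Sum.inl (), Sum.inl ()]}

/-- Words of the free group seen as boundary words of diagrams. -/
def conv (l : List (Fin 2 × Bool)) : List (Unit ⊕ Bool) :=
  l.map fun p => if p.1 = 0 then Sum.inl () else Sum.inr p.2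

/-- A word which can be inserted in or deleted from the boundary of diagrams. -/
def Neutral (w : List (Unit ⊕ Bool)) : Prop :=
  ∀ m, Nonempty (Diagram faceWords (w ++ m)) ↔ Nonempty (Diagram faceWords m)

lemma rotate_iff (l m : List (Unit ⊕ Bool)) :
    Nonempty (Diagram faceWords (l ++ m)) ↔ Nonempty (Diagram faceWords (m ++ l)) :=
  ⟨Diagram.rotate, Diagram.rotate⟩

lemma Neutral.middle {w : List (Unit ⊕ Bool)} (hw : Neutral w) (l m : List (Unit ⊕ Bool)) :
    Nonempty (Diagram faceWords (l ++ (w ++ m))) ↔ Nonempty (Diagram faceWords (l ++ m)) := by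
  rw [rotate_iff, List.append_assoc, hw, rotate_iff]

lemma neutral_xx : Neutral [Sum.inl (), Sum.inl ()] := fun m =>
  ⟨Diagram.cut (by simp [faceWords]), fun h => Diagram.insert (E := Fin 2)
    [Sum.inl 0, Sum.inl 1] (by simp [darts]) (by simp [darts, Fin.forall_fin_two])
    (by simp [faceWords, shape, invWord]) h⟩

lemma neutral_y (Y : List Bool)
    (hY : ∀ (H : Type) [Group H] (η : H), η ^ 3 = 1 → (Y.map (fun b => cond b η η⁻¹)).prod = 1) :
    Neutral (Y.map Sum.inr) := fun _ => ⟨Diagram.delete_y Y hY, Diagram.insert_y Y hY⟩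

lemma neutral_relWord : Neutral relWord := fun m =>
  ⟨Diagram.cut (by simp [faceWords]), fun h => Diagram.insert (E := ZMod 26) relDarts
    (by decide) (by decide) (by
      have : shape relDarts = relWord := by decide
      rw [this]; simp [faceWords]) h⟩

lemma step_iff {l m : List (Fin 2 × Bool)} (h : FreeGroup.Red.Step l m) :
    Nonempty (Diagram faceWords (conv l)) ↔ Nonempty (Diagram faceWords (conv m)) := by
  obtain @⟨l₁, l₂, a, b⟩ := h
  have key : Neutral (conv [(a, b), (a, !b)]) := by
    by_cases ha : a = 0
    · simpa [conv, ha] using neutral_xx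
    · have := neutral_y [b, !b] (fun H _ η _ => by cases b <;> simp)
      simpa [conv, ha] using this
  have := key.middle (conv l₁) (conv l₂)
  simpa [conv] using this

/-- There is a diagram whose boundary is a given element. -/
def Fills (z : F) : Prop := Nonempty (Diagram faceWords (conv z.toWord))

lemma fills_mk (l : List (Fin 2 × Bool)) :
    Fills (FreeGroup.mk l) ↔ Nonempty (Diagram faceWords (conv l)) := by
  have key : ∀ m, FreeGroup.Red l m →
      (Nonempty (Diagram faceWords (conv l)) ↔ Nonempty (Diagram faceWords (conv m))) := by
    intro m hm
    induction hm with
    | refl => rfl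
    | tail _ hs ih => exact ih.trans (step_iff hs)
  rw [Fills, FreeGroup.toWord_mk]
  exact (key _ FreeGroup.reduce.red).symm

lemma conv_append (l m : List (Fin 2 × Bool)) : conv (l ++ m) = conv l ++ conv m := by
  simp [conv]

lemma fills_mul_comm (z w : F) : Fills (z * w) ↔ Fills (w * z) := by
  rw [← FreeGroup.mk_toWord (x := z), ← FreeGroup.mk_toWord (x := w), FreeGroup.mul_mk,
    FreeGroup.mul_mk, fills_mk, fills_mk, conv_append, conv_append]
  exact rotate_iff _ _

/-- The subgroup of elements which do not affect `Fills`. -/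
def neutralSubgroup : Subgroup F where
  carrier := {z | ∀ w, Fills (z * w) ↔ Fills w}
  one_mem' := fun w => by rw [one_mul]
  mul_mem' := fun {a b} ha hb w => by rw [mul_assoc, ha, hb]
  inv_mem' := fun {a} ha w => by rw [← ha, mul_inv_cancel_left]

instance : neutralSubgroup.Normal := ⟨fun z hz g w => by
  rw [mul_assoc, mul_assoc, fills_mul_comm, mul_assoc, mul_assoc, hz, fills_mul_comm,
    mul_assoc, mul_inv_cancel, mul_one]⟩

lemma mk_mem_neutralSubgroup {l : List (Fin 2 × Bool)} (h : Neutral (conv l)) :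
    FreeGroup.mk l ∈ neutralSubgroup := fun w => by
  rw [← FreeGroup.mk_toWord (x := w), FreeGroup.mul_mk, fills_mk, fills_mk, conv_append, h]

/-- The relator `W²`, with `y²` replaced by `y⁻¹`. -/
def relElement : F :=
  ((x*y)^4 * (x*y⁻¹)^3 * (x*y)^2 * (x*y⁻¹)^2 * (x*y) * (x*y⁻¹)) ^ 2

lemma x_sq_mem : x ^ 2 ∈ neutralSubgroup := by
  have : x ^ 2 = FreeGroup.mk [(0, true), (0, true)] := by decide
  rw [this]
  exact mk_mem_neutralSubgroup (by simpa [conv] using neutral_xx)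

lemma y_cube_mem : y ^ 3 ∈ neutralSubgroup := by
  have : y ^ 3 = FreeGroup.mk [(1, true), (1, true), (1, true)] := by decide
  rw [this]
  refine mk_mem_neutralSubgroup ?_
  have := neutral_y [true, true, true] (fun H _ η h => by simpa [pow_succ, mul_assoc] using h)
  simpa [conv] using this

/-- The relator `W²`, as a list of letters. -/
def relList : List (Fin 2 × Bool) := (List.range 26).flatMap fun i => [(0, true), (1, expo i)]

lemma mk_relList : relElement = FreeGroup.mk relList := by decide

lemma conv_relList : conv relList = relWord := by decide

lemma relElement_mem : relElement ∈ neutralSubgroup := by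
  rw [mk_relList]
  refine mk_mem_neutralSubgroup ?_
  rw [conv_relList]
  exact neutral_relWord

lemma rels_subset : rels W13 ⊆ neutralSubgroup := by
  have hy : (QuotientGroup.mk' neutralSubgroup y) ^ 2 =
      (QuotientGroup.mk' neutralSubgroup y)⁻¹ := by
    rw [eq_inv_iff_mul_eq_one, ← pow_succ, ← map_pow]
    exact (QuotientGroup.eq_one_iff _).2 y_cube_mem
  rintro z (rfl | rfl | rfl)
  · exact x_sq_mem
  · exact y_cube_mem
  · rw [SetLike.mem_coe, ← QuotientGroup.eq_one_iff]
    have h := (QuotientGroup.eq_one_iff _).2 relElement_mem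
    change QuotientGroup.mk' neutralSubgroup _ = 1 at h
    change QuotientGroup.mk' neutralSubgroup _ = 1
    rw [← h]
    simp only [W13, relElement, map_mul, map_pow, map_inv, hy]

theorem exists_diagram {l : List (Fin 2 × Bool)} (h : mk W13 (FreeGroup.mk l) = 1) :
    Nonempty (Diagram faceWords (conv l)) := by
  rw [← fills_mk]
  have hz : FreeGroup.mk l ∈ neutralSubgroup :=
    Subgroup.normalClosure_le_normal rels_subset ((QuotientGroup.eq_one_iff _).1 h)
  rw [← mul_one (FreeGroup.mk l), hz 1, Fills, FreeGroup.toWord_one]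
  exact Diagram.nil

end Existence

/-! ### Corner systems -/

/-- The edges of the faces of a diagram: an outer face of length `n`, faces `i : I` labelled by the
relator, and digons `j : J`. -/
inductive Dart (n : ℕ) (I J : Type) : Type
  | out (i : ZMod n) : Dart n I J
  | rel (i : I) (p : ZMod 26) : Dart n I J
  | dig (j : J) (b : Bool) : Dart n I J

namespace Dart

variable {n : ℕ} {I J : Type}

/-- Darts as a sum type. -/
def equivSum : Dart n I J ≃ ZMod n ⊕ (I × ZMod 26) ⊕ (J × Bool) where
  toFun
    | out i => Sum.inl i
    | rel i p => Sum.inr (Sum.inl (i, p))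
    | dig j b => Sum.inr (Sum.inr (j, b))
  invFun
    | Sum.inl i => out i
    | Sum.inr (Sum.inl (i, p)) => rel i p
    | Sum.inr (Sum.inr (j, b)) => dig j b
  left_inv := by rintro (_ | _ | _) <;> rfl
  right_inv := by rintro (_ | _ | _) <;> rfl

noncomputable instance [NeZero n] [Fintype I] [Fintype J] : Fintype (Dart n I J) :=
  Fintype.ofEquiv _ equivSum.symm

/-- The next dart around the same face. -/
def nxt : Dart n I J ≃ Dart n I J where
  toFun
    | out i => out (i + 1)
    | rel i p => rel i (p + 1)
    | dig j b => dig j !b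
  invFun
    | out i => out (i - 1)
    | rel i p => rel i (p - 1)
    | dig j b => dig j !b
  left_inv := by rintro (_ | _ | _) <;> simp
  right_inv := by rintro (_ | _ | _) <;> simp

@[simp] lemma nxt_out (i : ZMod n) : nxt (out i : Dart n I J) = out (i + 1) := rfl
@[simp] lemma nxt_rel (i : I) (p : ZMod 26) : nxt (rel i p : Dart n I J) = rel i (p + 1) := rfl
@[simp] lemma nxt_dig (j : J) (b : Bool) : nxt (dig j b : Dart n I J) = dig j !b := rfl
@[simp] lemma nxt_symm_out (i : ZMod n) : nxt.symm (out i : Dart n I J) = out (i - 1) := rfl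
@[simp] lemma nxt_symm_rel (i : I) (p : ZMod 26) :
    nxt.symm (rel i p : Dart n I J) = rel i (p - 1) := rfl

end Dart

open Dart

/-- A sign, as an exponent modulo `3`. -/
def sgn (b : Bool) : ZMod 3 := if b then 1 else -1

/-- The labels of the faces: `lab false` reads the relator and `lab true` its inverse. -/
def lab (s : Bool) (c : ZMod 13) : ZMod 3 := if s then -sgn (expo (-c)) else sgn (expo c)

/-- Reduction of positions along the relator modulo its root. -/
def red : ZMod 26 →+* ZMod 13 := ZMod.castHom (by decide) (ZMod 13)

/-- The total exponent of a word in `y`. -/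
def expSum (Y : List Bool) : ZMod 3 := (Y.map sgn).sum

/-- Powers of an element of order `3`. -/
def zpow3 {G : Type} [Group G] (Y : G) (a : ZMod 3) : G := Y ^ a.val

section zpow3

variable {G : Type} [Group G] {Y : G}

@[simp] lemma zpow3_zero : zpow3 Y 0 = 1 := by simp [zpow3]

lemma zpow3_add (hY : Y ^ 3 = 1) (a b : ZMod 3) : zpow3 Y (a + b) = zpow3 Y a * zpow3 Y b := by
  rw [zpow3, zpow3, zpow3, ← pow_add, ZMod.val_add, ← pow_eq_pow_mod _ hY]

lemma zpow3_neg (hY : Y ^ 3 = 1) (a : ZMod 3) : zpow3 Y (-a) = (zpow3 Y a)⁻¹ := by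
  rw [eq_inv_iff_mul_eq_one, ← zpow3_add hY, neg_add_cancel, zpow3_zero]

lemma zpow3_sgn (hY : Y ^ 3 = 1) (b : Bool) : zpow3 Y (sgn b) = cond b Y Y⁻¹ := by
  have h1 : zpow3 Y 1 = Y := by simp [zpow3, ZMod.val_one]
  cases b
  · simp [sgn, zpow3_neg hY, h1]
  · simp [sgn, h1]

lemma zpow3_expSum (hY : Y ^ 3 = 1) (l : List Bool) :
    zpow3 Y (expSum l) = (l.map fun b => cond b Y Y⁻¹).prod := by
  induction l with
  | nil => simp [expSum]
  | cons b l ih =>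
    have : expSum (b :: l) = sgn b + expSum l := by simp [expSum]
    rw [this, zpow3_add hY, ih, zpow3_sgn hY]; simp

end zpow3

/-- The label of the corner at the end of a dart. -/
def cornerLabel {n : ℕ} {I J : Type} (w : ZMod n → ZMod 3) (s : I → Bool) : Dart n I J → ZMod 3
  | out i => w i
  | rel i p => lab (s i) (red p)
  | dig _ _ => 0

/-- A diagram over `G = ⟨X, Y | X², Y³, W²⟩` with outer word `X Y^(w 0) X Y^(w 1) ⋯`, given by the
gluing `α` of the darts; `h` is the developing map. -/
structure Surf {G : Type} [Group G] (X Y : G) {n : ℕ} [NeZero n] (w : ZMod n → ZMod 3)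
    {I : Type} (J : Type) (s : I → Bool) where
  α : Dart n I J → Dart n I J
  invol : ∀ d, α (α d) = d
  h : Dart n I J → G
  h_α : ∀ d, h (α d) = h d * X
  h_nxt : ∀ d, h (nxt d) = h d * X * zpow3 Y (cornerLabel w s d)
  exact : ∀ θ : Dart n I J → ℚ, (∀ d, θ (α d) = -θ d) → ∑ i, θ (out i) = 0 →
    (∀ i, ∑ p, θ (rel i p) = 0) → (∀ j, θ (dig j true) + θ (dig j false) = 0) →
    ∃ v : Dart n I J → ℚ, (∀ d, v (α d) = v d + θ d) ∧ ∀ d, v (nxt d) = v d + θ d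

section Conversion

variable {D H : Type} [Group H] {η : H} {θ v : D → H}

lemma word_succ (n : ℕ) (δ : ℕ → D) (u : ℕ → List Bool) :
    word (n + 1) δ u = word n δ u ++ (Sum.inl (δ n) :: (u n).map Sum.inr) := by
  simp [word, List.range_succ]

lemma ev_map_inr (l : List Bool) : ev η θ (l.map Sum.inr) = (l.map fun b => cond b η η⁻¹).prod := by
  rw [ev, List.map_map]; rfl

lemma darts_map_inr (l : List Bool) : darts (l.map Sum.inr : List (D ⊕ Bool)) = [] := by
  simp [darts, List.filterMap_map, Function.comp_def]

lemma darts_word (n : ℕ) (δ : ℕ → D) (u : ℕ → List Bool) :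
    darts (word n δ u) = (List.range n).map δ := by
  induction n with
  | zero => rfl
  | succ n ih => simp [word_succ, ih, List.range_succ, darts_map_inr]

lemma ev_word_succ (n : ℕ) (δ : ℕ → D) (u : ℕ → List Bool) (hη : η ^ 3 = 1) :
    ev η θ (word (n + 1) δ u) = ev η θ (word n δ u) * θ (δ n) * zpow3 η (expSum (u n)) := by
  rw [word_succ, ev_append, ev_cons, ev_map_inr, zpow3_expSum hη, mul_assoc]; rfl

lemma coh_word (n : ℕ) (δ : ℕ → D) (u : ℕ → List Bool) (c : H)
    (hc : Coh η θ v c (word n δ u)) (i : ℕ) (hi : i < n) :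
    v (δ i) = c * ev η θ (word i δ u) := by
  induction n with
  | zero => omega
  | succ n ih =>
    rw [word_succ, coh_append] at hc
    rcases Nat.lt_succ_iff_lt_or_eq.1 hi with h | rfl
    · exact ih hc.1 h
    · exact hc.2.1

lemma coh_word_cyclic (n : ℕ) [NeZero n] (δ : ℕ → D) (u : ℕ → List Bool) (c : H) (hη : η ^ 3 = 1)
    (hc : Coh η θ v c (word n δ u)) (h1 : ev η θ (word n δ u) = 1) (i : ZMod n) :
    v (δ (i + 1).val) = v (δ i.val) * θ (δ i.val) * zpow3 η (expSum (u i.val)) := by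
  have hi := ZMod.val_lt i
  rw [coh_word n δ u c hc _ hi, mul_assoc, mul_assoc, ← mul_assoc (ev _ _ _),
    ← ev_word_succ _ _ _ hη]
  rw [coh_word n δ u c hc _ (ZMod.val_lt _)]
  rcases Nat.lt_or_ge (i.val + 1) n with h | h
  · rcases Nat.lt_or_ge 1 n with hn | hn
    · have : (1 : ZMod n).val = 1 := by
        have : Fact (1 < n) := ⟨hn⟩
        exact ZMod.val_one n
      rw [ZMod.val_add_of_lt (by omega), this]
    · omega
  · have h' : i.val + 1 = n := by omega
    have : i + 1 = 0 := by
      have : ((i.val + 1 : ℕ) : ZMod n) = 0 := by rw [h']; simp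
      simpa using this
    rw [this, h', h1, ZMod.val_zero]
    simp [word]

lemma eq_map_inr (l : List Bool) (f : List (D ⊕ Bool)) (h : shape f = l.map Sum.inr) :
    f = l.map Sum.inr := by
  induction f generalizing l with
  | nil => cases l <;> simp_all [shape]
  | cons a f ih =>
    rcases l with _ | ⟨b, l⟩
    · simp [shape] at h
    · simp only [shape, List.map_cons, List.cons.injEq] at h ⊢
      refine ⟨?_, ih l h.2⟩
      rcases a with d | b'
      · simp at h
      · simpa using h.1

lemma exists_word [Nonempty D] (n : ℕ) (u : ℕ → List Bool) (f : List (D ⊕ Bool))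
    (h : shape f = word n (fun _ => ()) u) : ∃ δ, f = word n δ u := by
  classical
  induction n generalizing f with
  | zero =>
    refine ⟨fun _ => Classical.arbitrary D, ?_⟩
    simpa [shape, word] using h
  | succ n ih =>
    rw [word_succ] at h
    obtain ⟨A, B, rfl, hA, hB⟩ := List.map_eq_append_iff.1 h
    obtain ⟨δ, rfl⟩ := ih A hA
    rcases B with _ | ⟨b, B⟩
    · simp at hB
    · simp only [List.map_cons, List.cons.injEq] at hB
      rcases b with d | b
      · refine ⟨Function.update δ n d, ?_⟩
        rw [word_succ, Function.update_self, ← eq_map_inr _ _ hB.2]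
        congr 1
        rw [word, word]
        refine List.flatMap_congr fun i hi => ?_
        rw [Function.update_of_ne (List.mem_range.1 hi).ne]
      · simp at hB

@[simp] lemma invWord_invWord (l : List (D ⊕ Bool)) : invWord (invWord l) = l := by
  simp only [invWord, List.map_reverse, List.map_map, List.reverse_reverse]
  have : (Sum.map id not ∘ Sum.map id not : D ⊕ Bool → D ⊕ Bool) = id := by
    funext a
    rcases a with d | b <;> simp
  rw [this, List.map_id]

end Conversion

lemma map_relElement {Q : Type} [Group Q] {φ : F →* Q} (hy : φ y ^ 2 = (φ y)⁻¹) :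
    φ relElement = φ (W13 ^ 2) := by
  simp only [W13, relElement, map_mul, map_pow, map_inv, hy]

lemma mk_relElement : mk W13 relElement = 1 := by
  have hy : (mk W13 y) ^ 2 = (mk W13 y)⁻¹ := by
    rw [eq_inv_iff_mul_eq_one, ← pow_succ, ← map_pow]
    exact (QuotientGroup.eq_one_iff _).2 (Subgroup.subset_normalClosure (by simp [rels]))
  have h : mk W13 (W13 ^ 2) = 1 :=
    (QuotientGroup.eq_one_iff _).2 (Subgroup.subset_normalClosure (by simp [rels]))
  rw [← h]
  exact map_relElement hy

lemma mk_x_sq : mk W13 x ^ 2 = 1 := by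
  rw [← map_pow]
  exact (QuotientGroup.eq_one_iff _).2 (Subgroup.subset_normalClosure (by simp [rels]))

lemma mk_y_cube : mk W13 y ^ 3 = 1 := by
  rw [← map_pow]
  exact (QuotientGroup.eq_one_iff _).2 (Subgroup.subset_normalClosure (by simp [rels]))

lemma mk_eq_ev (l : List (Fin 2 × Bool)) :
    mk W13 (FreeGroup.mk l) = ev (mk W13 y) (fun _ => mk W13 x) (conv l) := by
  have hX : mk W13 x = (mk W13 x)⁻¹ := by
    rw [eq_inv_iff_mul_eq_one, ← pow_two, mk_x_sq]
  induction l with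
  | nil => exact map_one _
  | cons a l ih =>
    have : FreeGroup.mk (a :: l) = FreeGroup.mk [a] * FreeGroup.mk l := by
      rw [FreeGroup.mul_mk]; rfl
    have hc : conv (a :: l) = (if a.1 = 0 then Sum.inl () else Sum.inr a.2) :: conv l := rfl
    rw [this, map_mul, ih, hc, ev_cons]
    refine congrArg (· * _) ?_
    obtain ⟨a, b⟩ := a
    have hx : FreeGroup.mk [((0 : Fin 2), false)] = x⁻¹ := rfl
    have hy : FreeGroup.mk [((1 : Fin 2), false)] = y⁻¹ := rfl
    fin_cases a <;> cases b
    · simpa [letterVal, hx] using hX.symm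
    · rfl
    · simp [letterVal, hy]
    · rfl

/-- The pair of lists of positions along faces is covered exactly once by the darts. -/
lemma darts_faces {D : Type} {outer : List (D ⊕ Bool)} {faces : List (List (D ⊕ Bool))}
    (nodup : (darts (outer ++ faces.flatten)).Nodup)
    (cover : ∀ d, d ∈ darts (outer ++ faces.flatten)) :
    (darts outer).Nodup ∧ (∀ k : Fin faces.length, (darts faces[k]).Nodup) ∧
    (∀ d, ∀ k : Fin faces.length, d ∈ darts outer → d ∉ darts faces[k]) ∧
    (∀ d, ∀ k l : Fin faces.length, d ∈ darts faces[k] → d ∈ darts faces[l] → k = l) ∧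
    ∀ d, d ∈ darts outer ∨ ∃ k : Fin faces.length, d ∈ darts faces[k] := by
  have hf : ∀ fs : List (List (D ⊕ Bool)), darts fs.flatten = (fs.map darts).flatten := by
    intro fs
    induction fs with
    | nil => rfl
    | cons f fs ih => simp [ih]
  rw [darts_append, hf] at nodup
  obtain ⟨h1, h2, h3⟩ := List.nodup_append'.1 nodup
  rw [List.nodup_flatten] at h2
  refine ⟨h1, fun k => h2.1 _ (List.mem_map_of_mem (List.getElem_mem _)), ?_, ?_, ?_⟩
  · intro d k hd hk
    exact h3 hd (List.mem_flatten.2 ⟨_, List.mem_map_of_mem (List.getElem_mem k.2), hk⟩)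
  · intro d k l hk hl
    have hp := List.pairwise_iff_getElem.1 h2.2
    by_contra hne
    rcases lt_or_gt_of_ne hne with h | h
    · have := hp k l (by simp) (by simp) h
      simp only [List.getElem_map] at this
      exact this hk hl
    · have := hp l k (by simp) (by simp) h
      simp only [List.getElem_map] at this
      exact this hl hk
  · intro d
    have := cover d
    rw [darts_append, hf, List.mem_append, List.mem_flatten] at this
    rcases this with h | ⟨f, hf, hd⟩
    · exact Or.inl h
    · obtain ⟨g, hg, rfl⟩ := List.mem_map.1 hf
      obtain ⟨k, hk, rfl⟩ := List.getElem_of_mem hg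
      exact Or.inr ⟨⟨k, hk⟩, hd⟩

lemma ev_const {D H : Type} [Group H] (η a : H) (l : List (D ⊕ Bool)) :
    ev η (fun _ => a) l = ev η (fun _ => a) (shape l) := by
  rw [shape, ev_map]; rfl

lemma sum_zmod_eq (n : ℕ) [NeZero n] (f : ℕ → ℚ) :
    ∑ i : ZMod n, f i.val = ∑ i ∈ Finset.range n, f i := by
  rcases n with _ | n
  · exact absurd rfl (NeZero.ne 0)
  · exact Fin.sum_univ_eq_sum_range f (n + 1)

lemma ev_word_rat {D : Type} (n : ℕ) (δ : ℕ → D) (u : ℕ → List Bool) (θ : D → ℚ) :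
    ev (1 : Multiplicative ℚ) (fun d => Multiplicative.ofAdd (θ d)) (word n δ u) =
      Multiplicative.ofAdd (∑ i ∈ Finset.range n, θ (δ i)) := by
  induction n with
  | zero => simp [word]
  | succ n ih =>
    rw [ev_word_succ _ _ _ (one_pow 3), ih, Finset.sum_range_succ]
    simp [zpow3]

theorem exists_surf (n : ℕ) [NeZero n] (u : ℕ → List Bool)
    (Dg : Diagram faceWords (word n (fun _ => ()) u)) (hu : ev (mk W13 y) (fun _ => mk W13 x)
      (word n (fun _ => ()) u) = 1) :
    ∃ (I : Type) (_ : Fintype I) (J : Type) (_ : Fintype J) (s : I → Bool),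
      Nonempty (Surf (mk W13 x) (mk W13 y) (fun i : ZMod n => expSum (u i.val)) J s) := by
  classical
  obtain ⟨D, fin, α, invol, outer, faces, shape_outer, shape_faces, nodup, cover, exact⟩ := Dg
  obtain ⟨ho, hk, hok, hkl, hc⟩ := darts_faces nodup cover
  have : Nonempty D := by
    have h : Sum.inl () ∈ shape outer := by
      rw [shape_outer]
      exact List.mem_flatMap.2 ⟨0, List.mem_range.2 (Nat.pos_of_ne_zero (NeZero.ne n)), by simp⟩
    obtain ⟨d | b, -, hd⟩ := List.mem_map.1 h
    · exact ⟨d⟩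
    · simp at hd
  let I : Type := {k : Fin faces.length // shape faces[k] = relWord ∨
    shape faces[k] = invWord relWord}
  let J : Type := {k : Fin faces.length // ¬ (shape faces[k] = relWord ∨
    shape faces[k] = invWord relWord)}
  let s : I → Bool := fun i => decide (shape faces[i.1] ≠ relWord)
  obtain ⟨δ₀, hδ₀⟩ := exists_word n u outer shape_outer
  have hδ : ∀ i : I, ∃ δ, faces[i.1] = if s i then invWord (word 26 δ fun i => [expo i]) else
      word 26 δ fun i => [expo i] := by
    intro i
    by_cases h : shape faces[i.1] = relWord
    · obtain ⟨δ, hδ⟩ := exists_word 26 _ _ h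
      have hs : s i = false := by simp only [s, h]; simp
      exact ⟨δ, by rw [hs]; exact hδ⟩
    · have h2 : shape (invWord faces[i.1]) = relWord := by
        rw [shape_invWord, i.2.resolve_left h, invWord_invWord]
      obtain ⟨δ, hδ⟩ := exists_word 26 _ _ h2
      have hs : s i = true := by simp only [s]; simpa using h
      exact ⟨δ, by rw [if_pos hs, ← hδ, invWord_invWord]⟩
  choose δ hδ using hδ
  have hε : ∀ j : J, ∃ a b, faces[j.1] = [Sum.inl a, Sum.inl b] := by
    intro j
    have := shape_faces _ (List.getElem_mem j.1.2)
    have h : shape faces[j.1] = [Sum.inl (), Sum.inl ()] := by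
      rcases this with h | h | h
      · exact absurd (Or.inl h) j.2
      · exact absurd (Or.inr h) j.2
      · exact h
    generalize faces[j.1] = f at h
    rcases f with _ | ⟨a | a, _ | ⟨b | b, _ | _⟩⟩ <;> simp [shape] at h ⊢
  choose a b hε using hε
  let Φ : Dart n I J → D
    | out i => δ₀ i.val
    | rel i p => if s i then δ i (1 - p).val else δ i p.val
    | dig j c => cond c (a j) (b j)
  have dword : ∀ i, darts faces[i.1] = if s i then ((List.range 26).map (δ i)).reverse else
      (List.range 26).map (δ i) := by
    intro i
    rw [hδ i]
    split_ifs
    · rw [darts_invWord, darts_word]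
    · rw [darts_word]
  have m₁ : ∀ i, Φ (out i) ∈ darts outer := fun i => by
    rw [hδ₀, darts_word]
    exact List.mem_map_of_mem (List.mem_range.2 (ZMod.val_lt i))
  have m₂ : ∀ i p, Φ (rel i p) ∈ darts faces[i.1] := fun i p => by
    rw [dword]
    simp only [Φ]
    split_ifs
    · exact List.mem_reverse.2 (List.mem_map_of_mem (List.mem_range.2 (ZMod.val_lt _)))
    · exact List.mem_map_of_mem (List.mem_range.2 (ZMod.val_lt _))
  have m₃ : ∀ j c, Φ (dig j c) ∈ darts faces[j.1] := fun j c => by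
    rw [hε]
    cases c <;> simp [Φ]
  have inj : Function.Injective Φ := by
    have i₁ : ∀ i i', Φ (out i) = Φ (out i') → i = i' := fun i i' h => by
      rw [hδ₀, darts_word, List.nodup_map_iff_inj_on List.nodup_range] at ho
      exact ZMod.val_injective n
        (ho _ (List.mem_range.2 (ZMod.val_lt i)) _ (List.mem_range.2 (ZMod.val_lt i')) h)
    have i₂ : ∀ i p p', Φ (rel i p) = Φ (rel i p') → p = p' := fun i p p' h => by
      have h1 := hk i.1
      have h2 : ((List.range 26).map (δ i)).Nodup := by
        rw [dword] at h1
        split_ifs at h1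
        · exact List.nodup_reverse.1 h1
        · exact h1
      rw [List.nodup_map_iff_inj_on List.nodup_range] at h2
      simp only [Φ] at h
      split_ifs at h
      · have := ZMod.val_injective 26 (h2 _ (List.mem_range.2 (ZMod.val_lt _)) _
          (List.mem_range.2 (ZMod.val_lt _)) h)
        exact sub_right_injective this
      · exact ZMod.val_injective 26 (h2 _ (List.mem_range.2 (ZMod.val_lt _)) _
          (List.mem_range.2 (ZMod.val_lt _)) h)
    have i₃ : ∀ j c c', Φ (dig j c) = Φ (dig j c') → c = c' := fun j c c' h => by
      have h1 := hk j.1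
      rw [hε] at h1
      cases c <;> cases c' <;> simp [Φ] at h h1 ⊢
      · exact h1 h.symm
      · exact h1 h
    rintro (i | ⟨i, p⟩ | ⟨j, c⟩) (i' | ⟨i', p'⟩ | ⟨j', c'⟩) h
    · rw [i₁ _ _ h]
    · exact absurd (h ▸ m₂ i' p') (hok _ _ (m₁ i))
    · exact absurd (h ▸ m₃ j' c') (hok _ _ (m₁ i))
    · exact absurd (h ▸ m₂ i p) (hok _ _ (m₁ i'))
    · obtain rfl : i = i' := Subtype.ext (hkl _ _ _ (m₂ i p) (h ▸ m₂ i' p'))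
      rw [i₂ _ _ _ h]
    · have := hkl _ _ _ (m₂ i p) (h ▸ m₃ j' c')
      exact absurd (this ▸ i.2) j'.2
    · exact absurd (h ▸ m₃ j c) (hok _ _ (m₁ i'))
    · have := hkl _ _ _ (m₃ j c) (h ▸ m₂ i' p')
      exact absurd (this ▸ i'.2) j.2
    · obtain rfl : j = j' := Subtype.ext (hkl _ _ _ (m₃ j c) (h ▸ m₃ j' c'))
      rw [i₃ _ _ _ h]
  have surj : Function.Surjective Φ := by
    intro d
    rcases hc d with h | ⟨k, h⟩
    · rw [hδ₀, darts_word] at h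
      obtain ⟨i, hi, rfl⟩ := List.mem_map.1 h
      exact ⟨out i, by simp only [Φ]; rw [ZMod.val_cast_of_lt (List.mem_range.1 hi)]⟩
    · by_cases hk : shape faces[k] = relWord ∨ shape faces[k] = invWord relWord
      · have h' : d ∈ (List.range 26).map (δ ⟨k, hk⟩) := by
          have := dword ⟨k, hk⟩
          simp only at this
          rw [this] at h
          split_ifs at h
          · exact List.mem_reverse.1 h
          · exact h
        obtain ⟨i, hi, rfl⟩ := List.mem_map.1 h'
        by_cases hs : s ⟨k, hk⟩
        · refine ⟨rel ⟨k, hk⟩ (1 - (i : ZMod 26)), ?_⟩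
          simp only [Φ, hs, if_true, sub_sub_cancel]
          rw [ZMod.val_cast_of_lt (List.mem_range.1 hi)]
        · refine ⟨rel ⟨k, hk⟩ (i : ZMod 26), ?_⟩
          simp only [Φ, hs]
          rw [ZMod.val_cast_of_lt (List.mem_range.1 hi)]
          rfl
      · have := hε ⟨k, hk⟩
        simp only at this
        rw [this] at h
        simp only [darts_cons_inl, darts_nil, List.mem_cons, List.not_mem_nil, or_false] at h
        rcases h with rfl | rfl
        · exact ⟨dig ⟨k, hk⟩ true, rfl⟩
        · exact ⟨dig ⟨k, hk⟩ false, rfl⟩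
  let e := Equiv.ofBijective Φ ⟨inj, surj⟩
  have he : ∀ t, e t = Φ t := fun _ => rfl
  have key : ∀ (H : Type) [Group H] (η : H), η ^ 3 = 1 → ∀ θ : D → H,
      (∀ d, θ (α d) = (θ d)⁻¹) → ev η θ outer = 1 → (∀ f ∈ faces, ev η θ f = 1) →
      ∃ v : D → H, (∀ d, v (α d) = v d * θ d) ∧ ∀ t, v (Φ (nxt t)) =
        v (Φ t) * θ (Φ t) * zpow3 η (cornerLabel (fun i : ZMod n => expSum (u i.val)) s t) := by
    intro H _ η hη θ hθ h₁ h₂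
    obtain ⟨v, hv, ⟨c, hc⟩, hf⟩ := exact H η hη θ hθ h₁ h₂
    refine ⟨v, hv, ?_⟩
    rintro (i | ⟨i, p⟩ | ⟨j, c⟩)
    · rw [hδ₀] at hc h₁
      exact coh_word_cyclic n δ₀ u c hη hc h₁ i
    · obtain ⟨c, hc⟩ := hf _ (List.getElem_mem i.1.2)
      have h1 := h₂ _ (List.getElem_mem i.1.2)
      have hfi := hδ i
      simp only [Fin.getElem_fin] at hfi
      rw [hfi] at hc h1
      by_cases hs : s i
      · simp only [hs, if_true] at hc h1
        have hc' := coh_invWord _ (fun d => (θ d)⁻¹) (fun d => v d * θ d) (fun _ => rfl)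
          (fun _ => rfl) c hc
        have h1' := ev_invWord (η := η) (invWord (word 26 (δ i) fun i => [expo i]))
          (fun d => (θ d)⁻¹) (fun d => rfl)
        rw [h1, inv_one, invWord_invWord] at h1'
        rw [h1, mul_one, invWord_invWord] at hc'
        have := coh_word_cyclic 26 (δ i) _ c hη hc' h1' (-p)
        simp only [nxt_rel, Φ, hs, if_true, cornerLabel, lab]
        rw [mul_inv_cancel_right] at this
        rw [show -p + 1 = 1 - p by ring] at this
        rw [show 1 - (p + 1) = -p by ring, this, zpow3_neg hη, eq_comm, mul_inv_eq_iff_eq_mul]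
        congr 2
        have : ∀ p : ZMod 26, sgn (expo (-(red p))) = expSum [expo ((-p).val : ℕ)] := by decide
        exact (this p).symm
      · simp only [hs] at hc h1
        have := coh_word_cyclic 26 (δ i) _ c hη hc h1 p
        simp only [nxt_rel, Φ, hs, cornerLabel, lab]
        refine this.trans ?_
        have : ∀ p : ZMod 26, sgn (expo (red p)) = expSum [expo (p.val : ℕ)] := by decide
        rw [← this p]
        rfl
    · obtain ⟨c', hc⟩ := hf _ (List.getElem_mem j.1.2)
      have h1 := h₂ _ (List.getElem_mem j.1.2)
      have hfi := hε j
      simp only [Fin.getElem_fin] at hfi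
      rw [hfi] at hc h1
      obtain ⟨hc1, hc2, -⟩ := hc
      simp only [ev_cons, ev_nil, mul_one, letterVal, Sum.elim_inl] at h1
      cases c
      · simp [Φ, cornerLabel, hc1, hc2, mul_assoc, h1]
      · simp [Φ, cornerLabel, hc1, hc2]
  have hX : mk W13 x = (mk W13 x)⁻¹ := by
    rw [eq_inv_iff_mul_eq_one, ← pow_two, mk_x_sq]
  have hrel : ev (mk W13 y) (fun _ => mk W13 x) relWord = 1 := by
    rw [← conv_relList, ← mk_eq_ev, ← mk_relList, mk_relElement]
  obtain ⟨v, hv, hv'⟩ := key _ (mk W13 y) mk_y_cube (fun _ => mk W13 x) (fun _ => hX)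
    (by rw [ev_const, shape_outer, hu]) (fun f hf => by
      rw [ev_const]
      rcases shape_faces f hf with h | h | h
      · rw [h, hrel]
      · rw [h, ev_invWord (θ := fun _ => mk W13 x) _ _ (fun _ => hX), hrel, inv_one]
      · rw [h]
        simpa [letterVal, ← pow_two] using mk_x_sq)
  refine ⟨I, inferInstance, J, inferInstance, s, ⟨{
    α := fun t => e.symm (α (e t))
    invol := fun t => by simp [invol]
    h := v ∘ Φ
    h_α := fun t => by
      have : Φ (e.symm (α (e t))) = α (Φ t) := e.apply_symm_apply _
      simp [this, hv]
    h_nxt := hv'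
    exact := ?_ }⟩⟩
  intro θ hθ t₁ t₂ t₃
  let θ' : D → ℚ := fun d => θ (e.symm d)
  have hθ' : ∀ t, θ' (Φ t) = θ t := fun t => by
    simp only [θ', ← he, Equiv.symm_apply_apply]
  obtain ⟨v, hv, hv'⟩ := key (Multiplicative ℚ) 1 (one_pow 3)
    (fun d => Multiplicative.ofAdd (θ' d)) (fun d => by
      have := hθ (e.symm d)
      rw [e.apply_symm_apply] at this
      simp only [θ', this]; rfl) (by
      rw [hδ₀, ev_word_rat, ← sum_zmod_eq n (fun i => θ' (δ₀ i))]
      have : ∀ i : ZMod n, θ' (δ₀ i.val) = θ (out i) := fun i => hθ' (out i)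
      simp only [this, t₁]; rfl) (fun f hf => by
      obtain ⟨k, hk, rfl⟩ := List.getElem_of_mem hf
      by_cases hr : shape faces[k] = relWord ∨ shape faces[k] = invWord relWord
      · let i : I := ⟨⟨k, hk⟩, hr⟩
        have hfi := hδ i
        simp only [Fin.getElem_fin, i] at hfi
        rw [hfi]
        by_cases hs : s i
        · simp only [i] at hs
          rw [if_pos hs, ev_invWord (θ := fun d => Multiplicative.ofAdd (-θ' d)), ev_word_rat,
            ← sum_zmod_eq 26 (fun j => - θ' (δ i j))]
          · have : ∀ p : ZMod 26, θ' (δ i p.val) = θ (rel i (1 - p)) := fun p => by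
              rw [← hθ']; simp [Φ, i, hs]
            simp only [this, Finset.sum_neg_distrib]
            have h2 : ∑ p : ZMod 26, θ (rel i (1 - p)) = ∑ p : ZMod 26, θ (rel i p) :=
              Equiv.sum_comp (Equiv.subLeft (1 : ZMod 26)) (fun p => θ (rel i p))
            rw [h2, t₂]; rfl
          · intro d; simp
        · simp only [i] at hs
          rw [if_neg hs, ev_word_rat, ← sum_zmod_eq 26 (fun j => θ' (δ i j))]
          have : ∀ p : ZMod 26, θ' (δ i p.val) = θ (rel i p) := fun p => by
            rw [← hθ']; simp [Φ, i, hs]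
          simp only [this, t₂]; rfl
      · have hfi := hε ⟨⟨k, hk⟩, hr⟩
        simp only [Fin.getElem_fin] at hfi
        rw [hfi]
        have := t₃ ⟨⟨k, hk⟩, hr⟩
        rw [← hθ', ← hθ'] at this
        simp only [ev_cons, ev_nil, mul_one, letterVal, Sum.elim_inl, ← ofAdd_add]
        rw [← ofAdd_zero]
        exact congrArg _ this)
  refine ⟨fun t => Multiplicative.toAdd (v (Φ t)), fun t => ?_, fun t => ?_⟩
  · have : Φ (e.symm (α (e t))) = α (Φ t) := e.apply_symm_apply _
    simp only [this, hv, toAdd_mul, toAdd_ofAdd, hθ']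
  · simp only [hv', toAdd_mul, toAdd_ofAdd, hθ']
    simp [zpow3]

/-! ### Reduced corner systems -/

section Reduction

variable {G : Type} [Group G] {X Y : G} {n : ℕ} [NeZero n] {w : ZMod n → ZMod 3} {I J : Type}
  {s : I → Bool}

lemma Surf.α_ne (S : Surf X Y w J s) (hX : X ≠ 1) (d : Dart n I J) : S.α d ≠ d := fun h => by
  have := S.h_α d
  rw [h, left_eq_mul] at this
  exact hX this

/-- Removing a digon. -/
lemma Surf.remove_digon (S : Surf X Y w J s) (hX : X ≠ 1) (hX2 : X ^ 2 = 1) (j₀ : J) :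
    Nonempty (Surf X Y w {j // j ≠ j₀} s) := by
  classical
  let ι : Dart n I {j // j ≠ j₀} → Dart n I J
    | out i => out i
    | rel i p => rel i p
    | dig j b => dig j.1 b
  have ι_inj : Function.Injective ι := by
    rintro (i | ⟨i, p⟩ | ⟨j, c⟩) (i' | ⟨i', p'⟩ | ⟨j', c'⟩) h <;> simp [ι] at h ⊢
    · exact h
    · exact h
    · exact ⟨Subtype.ext h.1, h.2⟩
  have ι_nxt : ∀ d, ι (nxt d) = nxt (ι d) := by rintro (i | ⟨i, p⟩ | ⟨j, c⟩) <;> rfl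
  have ι_lab : ∀ d, cornerLabel w s (ι d) = cornerLabel w s d := by
    rintro (i | ⟨i, p⟩ | ⟨j, c⟩) <;> rfl
  have ι_ne : ∀ d b, ι d ≠ dig j₀ b := by
    rintro (i | ⟨i, p⟩ | ⟨j, c⟩) b h <;> simp [ι] at h
    exact j.2 h.1
  have ι_surj : ∀ d, (∀ b, d ≠ dig j₀ b) → ∃ c, ι c = d := by
    rintro (i | ⟨i, p⟩ | ⟨j, c⟩) h
    · exact ⟨out i, rfl⟩
    · exact ⟨rel i p, rfl⟩
    · refine ⟨dig ⟨j, ?_⟩ c, rfl⟩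
      rintro rfl
      exact h c rfl
  have dig_ne : ∀ b, (dig j₀ (!b) : Dart n I J) ≠ dig j₀ b := fun b h => by
    cases b <;> simp at h
  have alt : ∀ d : Dart n I {j // j ≠ j₀}, (∃ b, S.α (ι d) = dig j₀ b ∧
      ∀ b', S.α (dig j₀ (!b)) ≠ dig j₀ b') ∨ ∀ b, S.α (ι d) ≠ dig j₀ b := fun d => by
    by_cases h : ∃ b, S.α (ι d) = dig j₀ b
    · obtain ⟨b, hb⟩ := h
      refine Or.inl ⟨b, hb, fun b' hb' => ?_⟩
      rcases Bool.eq_or_eq_not b' b with rfl | rfl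
      · have := congrArg S.α (hb'.trans hb.symm)
        rw [S.invol, S.invol] at this
        exact ι_ne _ _ this.symm
      · exact S.α_ne hX _ hb'
    · exact Or.inr (not_exists.1 h)
  have hβ : ∀ d, ∃ c, (∃ b, S.α (ι d) = dig j₀ b ∧ ι c = S.α (dig j₀ (!b))) ∨
      ((∀ b, S.α (ι d) ≠ dig j₀ b) ∧ ι c = S.α (ι d)) := fun d => by
    rcases alt d with ⟨b, h, h'⟩ | h
    · obtain ⟨c, hc⟩ := ι_surj _ h'
      exact ⟨c, Or.inl ⟨b, h, hc⟩⟩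
    · obtain ⟨c, hc⟩ := ι_surj _ h
      exact ⟨c, Or.inr ⟨h, hc⟩⟩
  choose β hβ using hβ
  have h_dig : ∀ b, S.h (dig j₀ (!b)) = S.h (dig j₀ b) * X := fun b => by
    have := S.h_nxt (dig j₀ b)
    simpa [cornerLabel] using this
  refine ⟨{
    α := β
    invol := fun d => ?_
    h := S.h ∘ ι
    h_α := fun d => ?_
    h_nxt := fun d => by simp only [Function.comp, ι_nxt, S.h_nxt, ι_lab]
    exact := fun θ hθ h₁ h₂ h₃ => ?_ }⟩
  · apply ι_inj
    rcases hβ d with ⟨b, h, hc⟩ | ⟨h, hc⟩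
    · have hb : S.α (ι (β d)) = dig j₀ !b := by rw [hc, S.invol]
      rcases hβ (β d) with ⟨b', h', hc'⟩ | ⟨h', hc'⟩
      · obtain rfl : b' = !b := by simpa [hb, eq_comm] using h'
        rw [hc', Bool.not_not, ← h, S.invol]
      · exact absurd hb (h' _)
    · have hb : S.α (ι (β d)) = ι d := by rw [hc, S.invol]
      rcases hβ (β d) with ⟨b', h', hc'⟩ | ⟨h', hc'⟩
      · exact absurd (hb.symm.trans h') (ι_ne _ _)
      · rw [hc', hb]
  · simp only [Function.comp]
    rcases hβ d with ⟨b, h, hc⟩ | ⟨h, hc⟩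
    · rw [hc, S.h_α, h_dig, ← h, S.h_α, mul_assoc _ X X, ← pow_two, hX2, mul_one]
    · rw [hc, S.h_α]
  · let f : Dart n I J → ℚ := Function.extend ι θ 0
    have hf : ∀ d, f (ι d) = θ d := fun d => ι_inj.extend_apply _ _ _
    have hf0 : ∀ b, f (dig j₀ b) = 0 := fun b =>
      Function.extend_apply' _ _ _ (by rintro ⟨a, ha⟩; exact ι_ne _ _ ha)
    let θ' : Dart n I J → ℚ := fun d => if ∃ b, d = dig j₀ b then -f (S.α d) else f d
    have hθ'ι : ∀ d, θ' (ι d) = θ d := fun d => by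
      simp only [θ', ι_ne, exists_false, if_false, hf]
    have hθ'd : ∀ b, θ' (dig j₀ b) = -f (S.α (dig j₀ b)) := fun b => by simp [θ']
    have hsum : ∀ b, f (S.α (dig j₀ b)) + f (S.α (dig j₀ !b)) = 0 := fun b => by
      by_cases hb : ∃ b', S.α (dig j₀ b) = dig j₀ b'
      · obtain ⟨b', hb'⟩ := hb
        obtain rfl : b' = !b := by
          rcases Bool.eq_or_eq_not b' b with rfl | h
          · exact absurd hb' (S.α_ne hX _)
          · exact h
        rw [hb', ← hb', S.invol, hb', hf0, hf0, add_zero]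
      · obtain ⟨c, hc⟩ := ι_surj _ (not_exists.1 hb)
        have h1 : S.α (ι c) = dig j₀ b := by rw [hc, S.invol]
        rcases hβ c with ⟨b', h, hc'⟩ | ⟨h, hc'⟩
        · obtain rfl : b = b' := by simpa [h1] using h
          rw [← hc, ← hc', hf, hf, hθ, add_neg_cancel]
        · exact absurd h1 (h _)
    obtain ⟨v, hv, hv'⟩ := S.exact θ' (fun d => by
        by_cases hd : ∃ b, d = dig j₀ b
        · obtain ⟨b, rfl⟩ := hd
          rw [hθ'd, neg_neg]
          by_cases hb : ∃ b', S.α (dig j₀ b) = dig j₀ b'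
          · obtain ⟨b', hb'⟩ := hb
            rw [hb', hθ'd, ← hb', S.invol, hb', hf0, hf0, neg_zero]
          · simp only [θ', hb, if_false]
        · obtain ⟨c, rfl⟩ := ι_surj _ (not_exists.1 hd)
          rw [hθ'ι]
          rcases hβ c with ⟨b', h, hc'⟩ | ⟨h, hc'⟩
          · rw [h, hθ'd, ← h, S.invol, hf]
          · rw [← hc', hθ'ι, hθ]) (by rw [← h₁]; exact Finset.sum_congr rfl fun i _ => hθ'ι (out i))
      (fun i => by rw [← h₂ i]; exact Finset.sum_congr rfl fun p _ => hθ'ι (rel i p))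
      (fun j => by
        by_cases hj : j = j₀
        · subst hj
          have := hsum true
          rw [Bool.not_true] at this
          rw [hθ'd, hθ'd]
          linarith
        · have := h₃ ⟨j, hj⟩
          rwa [← hθ'ι, ← hθ'ι] at this)
    refine ⟨v ∘ ι, fun d => ?_, fun d => ?_⟩
    · simp only [Function.comp]
      rcases hβ d with ⟨b, h, hc⟩ | ⟨h, hc⟩
      · have e1 := hv (ι d)
        have e2 := hv' (dig j₀ b)
        have e3 := hv (dig j₀ !b)
        rw [nxt_dig] at e2
        rw [h, hθ'ι] at e1
        rw [hθ'd] at e2 e3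
        have := hsum b
        rw [hc]
        linarith
      · rw [hc, hv, hθ'ι]
    · simp only [Function.comp, ι_nxt, hv', hθ'ι]

lemma Surf.remove_digons [Fintype J] (S : Surf X Y w J s) (hX : X ≠ 1) (hX2 : X ^ 2 = 1) :
    ∃ (J' : Type) (_ : IsEmpty J'), Nonempty (Surf X Y w J' s) := by
  classical
  have key : ∀ (m : ℕ) (J : Type) [Fintype J], Fintype.card J = m → Surf X Y w J s →
      ∃ (J' : Type) (_ : IsEmpty J'), Nonempty (Surf X Y w J' s) := by
    intro m
    induction m with
    | zero => exact fun J _ hJ S => ⟨J, Fintype.card_eq_zero_iff.1 hJ, ⟨S⟩⟩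
    | succ m ih =>
      intro J _ hJ S
      obtain ⟨j₀⟩ : Nonempty J := Fintype.card_pos_iff.1 (by omega)
      obtain ⟨S'⟩ := S.remove_digon hX hX2 j₀
      refine ih {j // j ≠ j₀} ?_ S'
      rw [Fintype.card_subtype_compl, hJ]
      simp
  exact key _ J rfl S

lemma zmod26_induction {P : ZMod 26 → Prop} (c : ZMod 26) (h0 : P c) (h1 : ∀ p, P p → P (p + 1))
    (p : ZMod 26) : P p := by
  have : ∀ m : ℕ, P (c + m) := by
    intro m
    induction m with
    | zero => simpa using h0
    | succ m ih => rw [Nat.cast_succ, ← add_assoc]; exact h1 _ ih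
  simpa using this (p - c).val

lemma lab_neg {a b : Bool} (h : a ≠ b) (c : ZMod 13) : lab b (-c) = -lab a c := by
  cases a <;> cases b <;> simp [lab] at h ⊢

/-- Two faces which are mirror images across a common edge may be replaced by digons. -/
lemma Surf.remove_mirror [IsEmpty J] (S : Surf X Y w J s) (hX2 : X ^ 2 = 1)
    (hY : Y ^ 3 = 1) {i₁ i₂ : I}
    (hs : s i₁ ≠ s i₂) {c b : ZMod 26} (hα : S.α (rel i₁ c) = rel i₂ b) (hcb : red c + red b = 1) :
    Nonempty (Surf X Y w (ZMod 26) fun i : {i // i ≠ i₁ ∧ i ≠ i₂} => s i) := by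
  classical
  have hi : i₁ ≠ i₂ := fun h => hs (h ▸ rfl)
  obtain ⟨k, rfl⟩ : ∃ k, b = k - c := ⟨b + c, by ring⟩
  have hk : red k = 1 := by rw [← hcb, ← map_add]; congr 1; ring
  let e : Dart n {i // i ≠ i₁ ∧ i ≠ i₂} (ZMod 26) ≃ Dart n I J := {
    toFun := fun d => match d with
      | out i => out i
      | rel i p => rel i.1 p
      | dig p true => rel i₁ p
      | dig p false => rel i₂ (k - p)
    invFun := fun d => match d with
      | out i => out i
      | rel i p => if h₁ : i = i₁ then dig p true else
          if h₂ : i = i₂ then dig (k - p) false else rel ⟨i, h₁, h₂⟩ p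
      | dig j _ => isEmptyElim j
    left_inv := by
      rintro (i | ⟨i, p⟩ | ⟨j, _ | _⟩) <;> simp [hi.symm]
      simp [i.2.1, i.2.2]
    right_inv := by
      rintro (i | ⟨i, p⟩ | ⟨j, c⟩)
      · rfl
      · by_cases h₁ : i = i₁
        · simp [h₁]
        · by_cases h₂ : i = i₂
          · simp [h₂, hi.symm]
          · simp [h₁, h₂]
      · exact isEmptyElim j }
  have e_t : ∀ p, e (dig p true) = rel i₁ p := fun _ => rfl
  have e_f : ∀ p, e (dig p false) = rel i₂ (k - p) := fun _ => rfl
  have hh : ∀ p, S.h (rel i₂ (k - p)) = S.h (rel i₁ p) * X := by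
    refine zmod26_induction c (by rw [← hα, S.h_α]) fun p hp => ?_
    have h1 := S.h_nxt (rel i₁ p)
    have h2 := S.h_nxt (rel i₂ (k - (p + 1)))
    have hl : red (k - (p + 1)) = -red p := by rw [map_sub, map_add, hk, map_one]; ring
    rw [nxt_rel, show k - (p + 1) + 1 = k - p by ring, hp, cornerLabel, hl, lab_neg hs,
      zpow3_neg hY, eq_mul_inv_iff_mul_eq] at h2
    rw [nxt_rel, cornerLabel, h2] at h1
    rw [h1, mul_assoc _ X X, ← pow_two, hX2, mul_one]
  refine ⟨{
    α := fun d => e.symm (S.α (e d))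
    invol := fun d => by simp [S.invol]
    h := S.h ∘ e
    h_α := fun d => by simp [S.h_α]
    h_nxt := ?_
    exact := fun θ hθ h₁ h₂ h₃ => ?_ }⟩
  · rintro (i | ⟨i, p⟩ | ⟨p, _ | _⟩)
    · exact S.h_nxt (out i)
    · exact S.h_nxt (rel i p)
    · simp only [Function.comp, nxt_dig, Bool.not_false, e_t, e_f, cornerLabel, hh, zpow3_zero,
        mul_one]
      rw [mul_assoc, ← pow_two, hX2, mul_one]
    · simp only [Function.comp, nxt_dig, Bool.not_true, e_t, e_f, cornerLabel, hh, zpow3_zero,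
        mul_one]
  · let ϑ : Dart n I J → ℚ := θ ∘ e.symm
    have hϑ : ∀ d, ϑ (e d) = θ d := fun d => by simp [ϑ]
    have hϑα : ∀ d, ϑ (S.α d) = -ϑ d := fun d => by
      have := hθ (e.symm d)
      rwa [e.apply_symm_apply] at this
    have hϑ₃ : ∀ p, ϑ (rel i₂ (k - p)) = -ϑ (rel i₁ p) := fun p => by
      have := h₃ p
      rw [← hϑ, ← hϑ, e_t, e_f] at this
      linarith
    set T := ∑ p, ϑ (rel i₁ p) with hT
    let ρ : Dart n I J → ℚ := fun d =>
      ϑ d + if d = rel i₁ c then -T else if d = rel i₂ (k - c) then T else 0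
    have hρ₁ : ∀ p, ρ (rel i₁ p) = ϑ (rel i₁ p) + if p = c then -T else 0 := fun p => by
      simp [ρ, hi]
    have hρ₂ : ∀ p, ρ (rel i₂ (k - p)) = -ρ (rel i₁ p) := fun p => by
      rw [hρ₁]
      simp only [ρ, rel.injEq, hi.symm, false_and, if_false, true_and, hϑ₃, sub_right_inj]
      split_ifs <;> ring
    have hne : (rel i₂ (k - c) : Dart n I J) ≠ rel i₁ c := by simp [hi.symm]
    have hρ₀ : ∀ d, d ≠ rel i₁ c → d ≠ rel i₂ (k - c) → ρ d = ϑ d := fun d h h' => by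
      simp [ρ, h, h']
    have hα' : S.α (rel i₂ (k - c)) = rel i₁ c := by rw [← hα, S.invol]
    have T₁ : ∑ p, ρ (rel i₁ p) = 0 := by
      simp only [hρ₁, Finset.sum_add_distrib, Finset.sum_ite_eq', Finset.mem_univ, if_true]
      rw [← hT, add_neg_cancel]
    obtain ⟨v, hv, hv'⟩ := S.exact ρ (fun d => by
        by_cases hd : d = rel i₁ c
        · rw [hd, hα, hρ₂]
        · by_cases hd' : d = rel i₂ (k - c)
          · rw [hd', hα', hρ₂, neg_neg]
          · rw [hρ₀ d hd hd', hρ₀, hϑα]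
            · intro h; exact hd' (by rw [← hα, ← h, S.invol])
            · intro h; exact hd (by rw [← hα', ← h, S.invol]))
      (by rw [← h₁]; exact Finset.sum_congr rfl fun i _ => by
            rw [hρ₀ _ (by simp) (by simp)]; exact hϑ (out i))
      (fun i => by
        by_cases hi₁ : i = i₁
        · rw [hi₁, T₁]
        · by_cases hi₂ : i = i₂
          · rw [hi₂, ← Equiv.sum_comp (Equiv.subLeft k)]
            simp only [Equiv.subLeft_apply, hρ₂, Finset.sum_neg_distrib, T₁, neg_zero]
          · rw [← h₂ ⟨i, hi₁, hi₂⟩]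
            exact Finset.sum_congr rfl fun p _ => by
              rw [hρ₀ _ (by simp [hi₁]) (by simp [hi₂])]; exact hϑ (rel ⟨i, hi₁, hi₂⟩ p))
      isEmptyElim
    have hvv : ∀ p, v (rel i₂ (k - p)) = v (rel i₁ p) + ρ (rel i₁ p) := by
      refine zmod26_induction c (by rw [← hα, hv]) fun p hp => ?_
      have e1 := hv' (rel i₁ p)
      have e2 := hv' (rel i₂ (k - (p + 1)))
      rw [nxt_rel, show k - (p + 1) + 1 = k - p by ring, hρ₂] at e2
      rw [nxt_rel] at e1
      linarith
    let v' : Dart n I J → ℚ := Function.update v (rel i₂ (k - c)) (v (rel i₁ c) + ϑ (rel i₁ c))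
    have hv'₀ : v' (rel i₂ (k - c)) = v (rel i₁ c) + ϑ (rel i₁ c) := Function.update_self ..
    have hv'₁ : ∀ d, d ≠ rel i₂ (k - c) → v' d = v d := fun d hd => Function.update_of_ne hd ..
    have hv'₂ : ∀ p, v' (rel i₂ (k - p)) = v (rel i₁ p) + ϑ (rel i₁ p) := fun p => by
      by_cases hp : p = c
      · rw [hp, hv'₀]
      · rw [hv'₁ _ (by simpa using hp), hvv, hρ₁, if_neg hp, add_zero]
    refine ⟨v' ∘ e, fun d => ?_, ?_⟩
    · simp only [Function.comp, e.apply_symm_apply]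
      rw [← hϑ]
      generalize e d = d
      by_cases hd : d = rel i₁ c
      · rw [hd, hα, hv'₀, hv'₁ _ hne.symm]
      · by_cases hd' : d = rel i₂ (k - c)
        · rw [hd', hα', hv'₀, hϑ₃, hv'₁ _ hne.symm]
          ring
        · rw [hv'₁ _ hd', hv'₁, hv, hρ₀ _ hd hd']
          intro h; exact hd (by rw [← hα', ← h, S.invol])
    · rintro (i | ⟨i, p⟩ | ⟨p, _ | _⟩)
      · have := hv' (out i)
        rw [← hϑ]
        refine (hv'₁ _ (by simp [e])).trans (this.trans ?_)
        rw [hρ₀ _ (by simp) (by simp)]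
        exact congrArg (· + _) (hv'₁ _ (by simp)).symm
      · have := hv' (rel i.1 p)
        rw [← hϑ]
        refine (hv'₁ _ (by simp [e, i.2.2])).trans (this.trans ?_)
        rw [hρ₀ _ (by simp [i.2.1]) (by simp [i.2.2])]
        exact congrArg (· + _) (hv'₁ _ (by simp [i.2.2])).symm
      · simp only [Function.comp, nxt_dig, Bool.not_false, e_t]
        rw [← hϑ, e_f, hv'₂, hϑ₃, hv'₁ _ (by simp [hi])]
        ring
      · simp only [Function.comp, nxt_dig, Bool.not_true, e_f]
        rw [← hϑ, e_t, hv'₂, hv'₁ _ (by simp [hi])]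

/-- No two faces are mirror images of each other across a common edge. -/
def Surf.NoMirror (S : Surf X Y w J s) : Prop := ∀ i₁ i₂ c b, S.α (rel i₁ c) = rel i₂ b →
  s i₁ ≠ s i₂ → red c + red b ≠ 1

theorem exists_noMirror (hX : X ≠ 1) (hX2 : X ^ 2 = 1) (hY : Y ^ 3 = 1) [Fintype I] [Fintype J]
    (S : Surf X Y w J s) : ∃ (I : Type) (_ : Fintype I) (s : I → Bool) (J : Type) (_ : IsEmpty J)
      (S : Surf X Y w J s), S.NoMirror := by
  classical
  have key : ∀ (m : ℕ) (I : Type) [Fintype I] (s : I → Bool) (J : Type) [IsEmpty J],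
      Fintype.card I = m → Surf X Y w J s →
      ∃ (I : Type) (_ : Fintype I) (s : I → Bool) (J : Type) (_ : IsEmpty J)
        (S : Surf X Y w J s), S.NoMirror := by
    intro m
    induction m using Nat.strong_induction_on with
    | _ m ih =>
      intro I _ s J _ hI S
      by_cases hS : S.NoMirror
      · exact ⟨I, inferInstance, s, J, inferInstance, S, hS⟩
      · simp only [Surf.NoMirror, not_forall, not_not] at hS
        obtain ⟨i₁, i₂, c, b, hα, hs, hcb⟩ := hS
        obtain ⟨S'⟩ := S.remove_mirror hX2 hY hs hα hcb
        obtain ⟨J', hJ', ⟨S''⟩⟩ := S'.remove_digons hX hX2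
        refine ih _ ?_ _ _ _ rfl S''
        rw [← hI]
        exact Fintype.card_subtype_lt (x := i₁) (by simp)
  obtain ⟨J', hJ', ⟨S'⟩⟩ := S.remove_digons hX hX2
  exact key _ I s J' rfl S'

end Reduction

/-! ### Euler characteristic -/

section Euler

variable {G : Type} [Group G] {X Y : G} {n : ℕ} [NeZero n] {w : ZMod n → ZMod 3} {I J : Type}
  {s : I → Bool}

/-- The gluing, as a permutation. -/
def Surf.glue (S : Surf X Y w J s) : Equiv.Perm (Dart n I J) := ⟨S.α, S.α, S.invol, S.invol⟩

/-- The rotation about vertices. -/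
def Surf.rot (S : Surf X Y w J s) : Equiv.Perm (Dart n I J) := S.glue.trans nxt

lemma Surf.rot_apply (S : Surf X Y w J s) (d : Dart n I J) : S.rot d = nxt (S.α d) := rfl

/-- The vertices. -/
abbrev Surf.Vertex (S : Surf X Y w J s) : Type := Quotient (Equiv.Perm.SameCycle.setoid S.rot)

noncomputable instance [Fintype I] [Fintype J] (S : Surf X Y w J s) : Fintype S.Vertex :=
  Fintype.ofFinite _

lemma sum_dart [Fintype I] [Fintype J] [IsEmpty J] {M : Type} [AddCommMonoid M]
    (f : Dart n I J → M) : ∑ d, f d = ∑ i, f (out i) + ∑ i, ∑ p, f (rel i p) := by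
  rw [← Equiv.sum_comp equivSum.symm, Fintype.sum_sum_type, Fintype.sum_sum_type,
    Fintype.sum_prod_type]
  simp [equivSum]

lemma card_dart [Fintype I] [Fintype J] [IsEmpty J] :
    Fintype.card (Dart n I J) = n + 26 * Fintype.card I := by
  have := sum_dart (n := n) (I := I) (J := J) (fun _ => 1)
  simp only [Finset.sum_const, smul_eq_mul, mul_one] at this
  rw [Fintype.card, this, Finset.card_univ, Finset.card_univ, Finset.card_univ, ZMod.card,
    ZMod.card]
  ring

theorem Surf.euler [Fintype I] [Fintype J] [IsEmpty J] (S : Surf X Y w J s) (hX : X ≠ 1) :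
    n + 26 * Fintype.card I + 2 ≤ 2 * Fintype.card S.Vertex + 2 * Fintype.card I := by
  classical
  let idx := Fintype.equivFin (Dart n I J)
  have idx_ne : ∀ d, idx (S.α d) ≠ idx d := fun d h => S.α_ne hX d (idx.injective h)
  let O : Finset (Dart n I J) := {d | idx d < idx (S.α d)}
  have hO : ∀ d, d ∈ O ↔ idx d < idx (S.α d) := fun d => by simp [O]
  have hO' : ∀ d, S.α d ∈ O ↔ d ∉ O := fun d => by
    rw [hO, hO, S.invol, not_lt, le_iff_lt_or_eq, or_iff_left (idx_ne d)]
  have cardO : n + 26 * Fintype.card I = 2 * O.card := by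
    rw [← card_dart (n := n) (I := I) (J := J), ← Finset.card_add_card_compl O, two_mul]
    congr 1
    refine Finset.card_nbij' S.α S.α ?_ ?_ (fun _ _ => S.invol _) (fun _ _ => S.invol _)
    · intro d hd
      simpa [hO'] using hd
    · intro d hd
      simpa [hO'] using hd
  let ext : (O → ℚ) →ₗ[ℚ] (Dart n I J → ℚ) :=
    { toFun := fun θ d => if h : d ∈ O then θ ⟨d, h⟩ else
        -(if h : S.α d ∈ O then θ ⟨S.α d, h⟩ else 0)
      map_add' := fun θ θ' => by
        funext d
        simp only [Pi.add_apply]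
        split_ifs <;> ring
      map_smul' := fun a θ => by
        funext d
        simp only [Pi.smul_apply, smul_eq_mul, RingHom.id_apply]
        split_ifs <;> ring }
  have ext_mem : ∀ θ (d : O), ext θ d = θ d := fun θ d => by
    simp [ext]
  have ext_α : ∀ θ d, ext θ (S.α d) = -ext θ d := fun θ d => by
    by_cases h : d ∈ O
    · have h' : S.α d ∉ O := fun h' => (hO' d).1 h' h
      simp [ext, h, h', S.invol]
    · have h' : S.α d ∈ O := (hO' d).2 h
      simp [ext, h, h']
  let T : (O → ℚ) →ₗ[ℚ] (I → ℚ) :=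
    { toFun := fun θ i => ∑ p, ext θ (rel i p)
      map_add' := fun θ θ' => by
        funext i; simp [Finset.sum_add_distrib]
      map_smul' := fun a θ => by
        funext i; simp [Finset.mul_sum] }
  let Δ : (S.Vertex → ℚ) →ₗ[ℚ] (O → ℚ) :=
    { toFun := fun v d => v (Quotient.mk _ (S.α d)) - v (Quotient.mk _ d.1)
      map_add' := fun θ θ' => by
        funext i; simp; ring
      map_smul' := fun a θ => by
        funext i; simp; ring }
  have hker : LinearMap.ker T ≤ LinearMap.range Δ := by
    intro θ hθ
    have h0 : ∑ d, ext θ d = 0 := by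
      have h1 : ∑ d, ext θ (S.α d) = ∑ d, ext θ d := Equiv.sum_comp S.glue (ext θ)
      simp only [ext_α, Finset.sum_neg_distrib] at h1
      linarith
    have h2 : ∀ i, ∑ p, ext θ (rel i p) = 0 := fun i => congrFun hθ i
    rw [sum_dart] at h0
    simp only [h2, Finset.sum_const_zero, add_zero] at h0
    obtain ⟨v, hv, hv'⟩ := S.exact (ext θ) (ext_α θ) h0 h2 isEmptyElim
    have hrot : ∀ d, v (S.rot d) = v d := fun d => by
      rw [S.rot_apply, hv', ext_α, hv, add_neg_cancel_right]
    have hcyc : ∀ a b, S.rot.SameCycle a b → v a = v b := by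
      rintro a b ⟨k, rfl⟩
      have : ∀ (k : ℕ) (a), v ((S.rot ^ k) a) = v a := by
        intro k
        induction k with
        | zero => simp
        | succ k ih => intro a; rw [pow_succ, Equiv.Perm.mul_apply, ih, hrot]
      rcases k with k | k
      · simpa using (this k a).symm
      · have := this (k + 1) ((S.rot ^ (Int.negSucc k)) a)
        rw [zpow_negSucc, ← Equiv.Perm.mul_apply, mul_inv_cancel, Equiv.Perm.one_apply] at this
        rw [zpow_negSucc, this]
    refine ⟨Quotient.lift v hcyc, ?_⟩
    funext d
    change v (S.α d) - v d = θ d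
    rw [hv, ext_mem, add_sub_cancel_left]
  have r1 := LinearMap.finrank_range_add_finrank_ker T
  have r2 := LinearMap.finrank_range_add_finrank_ker Δ
  have r3 : Module.finrank ℚ (LinearMap.range T) ≤ Fintype.card I := by
    simpa using Submodule.finrank_le (LinearMap.range T)
  have r4 := Submodule.finrank_mono hker
  have r5 : 1 ≤ Module.finrank ℚ (LinearMap.ker Δ) := by
    rw [Nat.one_le_iff_ne_zero, Ne, Submodule.finrank_eq_zero, Submodule.eq_bot_iff]
    intro h
    have := h (fun _ => 1) (by
      rw [LinearMap.mem_ker]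
      funext d
      exact sub_self _)
    have := congrFun this (Quotient.mk _ (out 0))
    simp at this
  rw [Module.finrank_fintype_fun_eq_card] at r1 r2
  rw [Fintype.card_coe] at r1
  omega

end Euler

/-! ### Tables -/

/-- The signs of the labels of the faces. -/
def labSign (s : Bool) (c : ZMod 13) : Bool := if s then !expo (-c) else expo c

lemma lab_eq_sgn (s : Bool) (c : ZMod 13) : lab s c = sgn (labSign s c) := by
  revert s c; decide

lemma sgn_ne_zero (b : Bool) : sgn b ≠ 0 := by revert b; decide

lemma sgn_inj {a b : Bool} : sgn a = sgn b ↔ a = b := by revert a b; decide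

lemma sgn_not (b : Bool) : sgn (!b) = -sgn b := by revert b; decide

/-- The factors that do not occur in reduced words in the `N`-th powers of `x y` and `x y⁻¹`. -/
def forbidden : List (List Bool) :=
  [true, false].flatMap fun a => [[a, !a, !a, a], [a, !a, !a, !a, a], [a, !a, !a, !a, !a, a],
    [a, !a, a, !a]]

/-- A sequence of signs without forbidden factors. -/
def Sparse (u : List Bool) : Prop := ∀ f ∈ forbidden, ¬ f <:+: u

instance : DecidablePred Sparse := fun _ => inferInstanceAs (Decidable (∀ f ∈ _, _))

lemma Sparse.mono {u v : List Bool} (h : Sparse u) (hv : v <:+: u) : Sparse v :=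
  fun f hf h' => h f hf (h'.trans hv)

/-- The labels read along `k` consecutive corners, as seen from the other side. -/
def mirrorRun (s : Bool) (c : ZMod 13) (k : ℕ) : List Bool :=
  ((List.range k).map fun j : ℕ => !labSign s (c + j)).reverse

/-- The potential of a corner, depending on whether the degree of its vertex exceeds `3`. -/
def potential (s : Bool) (c : ZMod 13) (a : Bool) : ℤ :=
  (cond s
    (cond a [23, 29, 22, 28, 21, 27, 33, 26, 32, 25, 18, 24, 30]
      [36, 16, 22, 28, 34, 14, 20, 0, 19, 38, 18, 24, 4])
    (cond a [29, 22, 28, 21, 14, 20, 26, 19, 25, 18, 24, 30, 23]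
      [16, 22, 2, 34, 14, 20, 0, 19, 38, 18, 24, 4, 10])).getD c.val 0

/-- The charge sent across a side of length `L`. -/
def transfer (s : Bool) (c : ZMod 13) (L : ℕ) (a b : Bool) : ℤ :=
  match (cond s (-(c - 1 + L)) (c - 1)).val, L, cond s b a, cond s a b with
  | 0, 6, false, true => -1
  | 0, 7, false, true => -1
  | 1, 5, false, false => 1
  | 2, 3, false, false => -2
  | 5, 7, false, true => 1
  | 7, 3, false, false => -2
  | 8, 7, false, true => -1
  | _, _, _, _ => 0

/-- The weight of a corner at a vertex of degree at least `3`. -/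
def cost (a : Bool) : ℤ := cond a 3 2

lemma mirror_of_long_run : ∀ (s s' : Bool) (c b : ZMod 13),
    (∀ j : ℕ, j < 8 → labSign s' (b - j - 1) = !labSign s (c + j)) → s ≠ s' ∧ c + b = 1 := by
  decide +kernel

lemma not_sparse_mirrorRun : ∀ (s : Bool) (c : ZMod 13), ¬ Sparse (mirrorRun s c 8) := by
  decide +kernel

set_option synthInstance.maxHeartbeats 400000 in
set_option synthInstance.maxSize 2000 in
lemma potential_inner : ∀ (k : ℕ), k < 8 → ∀ (s s' : Bool) (c b : ZMod 13),
    (∀ j : ℕ, j < k → labSign s' (b - j - 1) = !labSign s (c + j)) → ∀ e₀ e₁ : Bool,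
    (e₀ = false → labSign s' b = labSign s (c - 1)) →
    (e₁ = false → labSign s' (b - k - 1) = labSign s (c + k)) →
    ¬ (s ≠ s' ∧ c + b = 1) →
    6 * (k + 1) - 13 * cost e₀ + 13 * (transfer s c (k + 1) e₀ e₁ -
      transfer s' (b - k) (k + 1) e₁ e₀) ≤ potential s (c + k + 1) e₁ - potential s c e₀ := by
  decide +kernel

lemma potential_outer : ∀ (k : ℕ), k < 8 → ∀ (s : Bool) (c : ZMod 13),
    Sparse (mirrorRun s c k) → ∀ e₀ e₁ : Bool,
    6 * (k + 1) - 13 * cost e₀ - 26 ≤ potential s (c + k + 1) e₁ - potential s c e₀ := by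
  decide +kernel

/-! ### Local structure of reduced corner systems -/

section Local

variable {G : Type} [Group G] {X Y : G} {n : ℕ} [NeZero n] {w : ZMod n → ZMod 3} {I J : Type}
  {s : I → Bool}

lemma zpow3_eq_one {Y : G} (hY : Y ^ 3 = 1) (hY1 : Y ≠ 1) {a : ZMod 3} (h : zpow3 Y a = 1) :
    a = 0 := by
  have h2 : zpow3 Y (a + a) = 1 := by rw [zpow3_add hY, h, one_mul]
  have h1 : zpow3 Y 1 ≠ 1 := by simpa [zpow3, ZMod.val_one] using hY1
  by_contra ha
  have : a = 1 ∨ a + a = 1 := by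
    clear h h2
    revert a; decide
  rcases this with rfl | h3
  · exact h1 h
  · exact h1 (h3 ▸ h2)

/-- A reduced corner system whose outer word `X Y^±1 X Y^±1 ⋯ X Y^a` visits pairwise distinct
cosets of `⟨Y⟩` and has no forbidden factors. -/
structure Surf.Reduced (S : Surf X Y w J s) (u : List Bool) : Prop where
  X_ne : X ≠ 1
  X_sq : X ^ 2 = 1
  Y_cube : Y ^ 3 = 1
  Y_ne : Y ≠ 1
  length : u.length + 1 = n
  label : ∀ (i : ZMod n) (hi : i.val < u.length), w i = sgn u[i.val]
  sparse : Sparse u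
  inj : ∀ i j a, S.h (out i) = S.h (out j) * zpow3 Y a → i = j
  noMirror : S.NoMirror

/-- The vertex where the outer word starts. -/
def Surf.Base (S : Surf X Y w J s) (t : Dart n I J) : Prop := S.rot.SameCycle t (out 0)

/-- The start of `t` is an inner vertex of degree `2`. -/
def Surf.Flat (S : Surf X Y w J s) (t : Dart n I J) : Prop := ¬ S.Base t ∧ S.rot (S.rot t) = t

/-- The start of `t` is an inner vertex of degree `3`. -/
def Surf.Deg3 (S : Surf X Y w J s) (t : Dart n I J) : Prop :=
  ¬ S.Base t ∧ S.rot (S.rot (S.rot t)) = t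

/-- The label of the corner at the start of `t`. -/
def Surf.turn (_ : Surf X Y w J s) (t : Dart n I J) : ZMod 3 := cornerLabel w s (nxt.symm t)

variable {S : Surf X Y w J s} {u : List Bool}

lemma Surf.turn_nxt (d : Dart n I J) : S.turn (nxt d) = cornerLabel w s d := by
  rw [Surf.turn, Equiv.symm_apply_apply]

lemma Surf.turn_rot (t : Dart n I J) : S.turn (S.rot t) = cornerLabel w s (S.α t) :=
  S.turn_nxt _

lemma Surf.base_rot {t : Dart n I J} : S.Base (S.rot t) ↔ S.Base t :=
  Equiv.Perm.sameCycle_apply_left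

lemma Surf.flat_rot {t : Dart n I J} : S.Flat (S.rot t) ↔ S.Flat t := by
  rw [Surf.Flat, Surf.Flat, Surf.base_rot, S.rot.injective.eq_iff]

lemma Surf.deg3_rot {t : Dart n I J} : S.Deg3 (S.rot t) ↔ S.Deg3 t := by
  rw [Surf.Deg3, Surf.Deg3, Surf.base_rot, S.rot.injective.eq_iff]

lemma Surf.Flat.α_eq {t : Dart n I J} (h : S.Flat t) : S.α t = nxt.symm (S.α (nxt.symm t)) := by
  have := h.2
  rw [S.rot_apply, ← Equiv.eq_symm_apply] at this
  rw [Equiv.eq_symm_apply, ← this, S.invol, S.rot_apply]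

namespace Surf.Reduced

lemma h_rot (H : S.Reduced u) (t : Dart n I J) :
    S.h (S.rot t) = S.h t * zpow3 Y (S.turn (S.rot t)) := by
  rw [S.turn_rot, S.rot_apply, S.h_nxt, S.h_α, mul_assoc (S.h t), ← pow_two, H.X_sq, mul_one]

lemma label_ne_zero (H : S.Reduced u) {i : ZMod n} (hi : i + 1 ≠ 0) : w i ≠ 0 := by
  have h1 := ZMod.val_lt i
  have h2 : i.val < u.length := by
    by_contra h
    have h3 : i.val + 1 = n := by have := H.length; omega
    apply hi
    have : ((i.val + 1 : ℕ) : ZMod n) = 0 := by rw [h3]; simp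
    simpa using this
  rw [H.label i h2]
  exact sgn_ne_zero _

lemma α_out_ne (H : S.Reduced u) (i j : ZMod n) : S.α (out i) ≠ out j := by
  have key : ∀ i j : ZMod n, S.α (out i) = out j → j + 1 = i ∧ j + 1 = 0 := by
    intro i j h
    have h1 := H.h_rot (out i)
    rw [S.turn_rot, S.rot_apply, h, nxt_out] at h1
    have h2 := H.inj _ _ _ h1
    refine ⟨h2, ?_⟩
    rw [h2, left_eq_mul] at h1
    by_contra h3
    exact H.label_ne_zero h3 (zpow3_eq_one H.Y_cube H.Y_ne h1)
  intro h
  obtain ⟨h1, h2⟩ := key i j h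
  obtain ⟨h3, h4⟩ := key j i (by rw [← h, S.invol])
  apply S.α_ne H.X_ne (out i)
  rw [h, ← add_right_cancel (h2.trans h4.symm)]

lemma cornerLabel_eq_zero (H : S.Reduced u) [IsEmpty J] {d : Dart n I J}
    (h : cornerLabel w s d = 0) :
    nxt d = out 0 := by
  rcases d with i | ⟨i, p⟩ | ⟨j, b⟩
  · by_contra h1
    exact H.label_ne_zero (fun h2 => h1 (by rw [nxt_out, h2])) h
  · rw [cornerLabel, lab_eq_sgn] at h
    exact absurd h (sgn_ne_zero _)
  · exact isEmptyElim j

lemma turn_ne_zero (H : S.Reduced u) [IsEmpty J] {t : Dart n I J} (h : ¬ S.Base t) :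
    S.turn t ≠ 0 := by
  intro h1
  apply h
  have := H.cornerLabel_eq_zero h1
  rw [Equiv.apply_symm_apply] at this
  rw [this]
  exact Equiv.Perm.SameCycle.refl _ _

lemma rot_ne (H : S.Reduced u) [IsEmpty J] (t : Dart n I J) : S.rot t ≠ t := by
  intro h
  have h1 := H.h_rot t
  rw [h, left_eq_mul] at h1
  have h2 := zpow3_eq_one H.Y_cube H.Y_ne h1
  have h3 := H.cornerLabel_eq_zero h2
  rw [Equiv.apply_symm_apply] at h3
  subst h3
  rw [S.rot_apply, ← Equiv.eq_symm_apply] at h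
  exact H.α_out_ne _ _ h

lemma turn_flat (H : S.Reduced u) {t : Dart n I J} (h : S.Flat t) :
    S.turn (S.rot t) = -S.turn t := by
  have h1 := H.h_rot (S.rot t)
  rw [h.2, H.h_rot t, mul_assoc, left_eq_mul, ← zpow3_add H.Y_cube] at h1
  exact eq_neg_of_add_eq_zero_left (zpow3_eq_one H.Y_cube H.Y_ne h1)

lemma turn_deg3 (H : S.Reduced u) [IsEmpty J] {t : Dart n I J} (h : S.Deg3 t) :
    S.turn (S.rot t) = S.turn t := by
  have h1 := H.h_rot (S.rot (S.rot t))
  rw [h.2, H.h_rot (S.rot t), H.h_rot t, mul_assoc, mul_assoc, left_eq_mul,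
    ← zpow3_add H.Y_cube, ← zpow3_add H.Y_cube] at h1
  have h2 := zpow3_eq_one H.Y_cube H.Y_ne h1
  have h3 := H.turn_ne_zero h.1
  have h4 := H.turn_ne_zero (Surf.base_rot.not.2 h.1)
  have h5 := H.turn_ne_zero (Surf.base_rot.not.2 (Surf.base_rot.not.2 h.1))
  clear h1
  generalize S.turn (S.rot (S.rot t)) = a at *
  generalize S.turn (S.rot t) = b at *
  generalize S.turn t = c at *
  revert a b c
  decide

end Surf.Reduced

end Local

section Weight

variable {G : Type} [Group G] {X Y : G} {n : ℕ} [NeZero n] {w : ZMod n → ZMod 3} {I J : Type}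
  {s : I → Bool}

open Classical in
/-- Whether the start of `t` is not an inner vertex of degree `3`. -/
noncomputable def Surf.high (S : Surf X Y w J s) (t : Dart n I J) : Bool := !decide (S.Deg3 t)

open Classical in
/-- The weight of the corner at the start of `t`. -/
noncomputable def Surf.weight (S : Surf X Y w J s) (t : Dart n I J) : ℤ :=
  if S.Flat t then 0 else cost (S.high t)

variable {S : Surf X Y w J s} {u : List Bool}

lemma Surf.high_rot (t : Dart n I J) : S.high (S.rot t) = S.high t := by
  rw [Surf.high, Surf.high, decide_eq_decide.2 Surf.deg3_rot]

lemma Surf.deg3_of_high {t : Dart n I J} (h : S.high t = false) : S.Deg3 t := by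
  simpa [Surf.high] using h

lemma Surf.weight_rot (t : Dart n I J) : S.weight (S.rot t) = S.weight t := by
  classical
  rw [Surf.weight, Surf.weight, Surf.high_rot]
  simp only [Surf.flat_rot]

lemma cost_mem (a : Bool) : 2 ≤ cost a ∧ cost a ≤ 3 := by revert a; decide

lemma Surf.weight_nonneg (t : Dart n I J) : 0 ≤ S.weight t := by
  rw [Surf.weight]
  split_ifs
  · rfl
  · linarith [cost_mem (S.high t)]

lemma Surf.weight_le (t : Dart n I J) : S.weight t ≤ 3 := by
  rw [Surf.weight]
  split_ifs
  · norm_num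
  · linarith [cost_mem (S.high t)]

theorem Surf.Reduced.sum_weight [Fintype I] [Fintype J] [IsEmpty J] (H : S.Reduced u) :
    ∑ d, S.weight d + 6 ≤ 12 * (Fintype.card I : ℤ) := by
  classical
  let π : Dart n I J → S.Vertex := Quotient.mk _
  have π_rot : ∀ t, π (S.rot t) = π t := fun t =>
    Quotient.sound (Equiv.Perm.sameCycle_apply_left.2 (Equiv.Perm.SameCycle.refl _ _))
  have bound : ∀ (v : S.Vertex) (A : Finset (Dart n I J)) (m : ℤ), (∀ t ∈ A, π t = v) →
      (∀ t ∈ A, m ≤ 6 - S.weight t) → A.card * m ≤ ∑ t with π t = v, (6 - S.weight t) := by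
    intro v A m hA hm
    calc A.card * m = A.card • m := by simp
      _ ≤ ∑ t ∈ A, (6 - S.weight t) := Finset.card_nsmul_le_sum _ _ _ hm
      _ ≤ _ := Finset.sum_le_sum_of_subset_of_nonneg (fun t ht => by simp [hA t ht])
        (fun t _ _ => by linarith [S.weight_le t])
  have key : ∀ v : S.Vertex, 12 ≤ ∑ t with π t = v, (6 - S.weight t) +
      if v = π (out 0) then 6 else 0 := by
    intro v
    obtain ⟨t, rfl⟩ := Quotient.exists_rep v
    change 12 ≤ ∑ t' with π t' = π t, (6 - S.weight t') + if π t = π (out 0) then 6 else 0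
    have h1 := H.rot_ne t
    by_cases hb : S.Base t
    · rw [if_pos (Quotient.sound hb)]
      have := bound (π t) {t, S.rot t} 3 (by simp [π_rot])
        (fun t' _ => by linarith [S.weight_le t'])
      rw [Finset.card_pair h1.symm] at this
      push_cast at this
      linarith
    · have hif : (0 : ℤ) ≤ if π t = π (out 0) then 6 else 0 := by split_ifs <;> norm_num
      by_cases hf : S.Flat t
      · have hw : S.weight t = 0 := if_pos hf
        have := bound (π t) {t, S.rot t} 6 (by simp [π_rot]) (by simp [S.weight_rot, hw])
        rw [Finset.card_pair h1.symm] at this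
        push_cast at this
        linarith
      have h2 : S.rot (S.rot t) ≠ t := fun h => hf ⟨hb, h⟩
      have h1' : S.rot (S.rot t) ≠ S.rot t := fun h => h1 (S.rot.injective h)
      by_cases h3 : S.rot (S.rot (S.rot t)) = t
      · have hw : S.weight t = 2 := by
          rw [Surf.weight, if_neg hf, Surf.high, decide_eq_true ⟨hb, h3⟩]
          rfl
        have := bound (π t) {t, S.rot t, S.rot (S.rot t)} 4 (by simp [π_rot])
          (by simp [S.weight_rot, hw])
        rw [Finset.card_eq_three.2 ⟨_, _, _, h1.symm, h2.symm, h1'.symm, rfl⟩] at this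
        push_cast at this
        linarith
      · have h2' : S.rot (S.rot (S.rot t)) ≠ S.rot t := fun h => h2 (S.rot.injective h)
        have h1'' : S.rot (S.rot (S.rot t)) ≠ S.rot (S.rot t) := fun h => h1' (S.rot.injective h)
        have := bound (π t) {t, S.rot t, S.rot (S.rot t), S.rot (S.rot (S.rot t))} 3
          (by simp [π_rot]) (fun t' _ => by linarith [S.weight_le t'])
        rw [Finset.card_insert_of_notMem (by simp [h1.symm, h2.symm, Ne.symm h3]),
          Finset.card_eq_three.2 ⟨_, _, _, h1'.symm, h2'.symm, h1''.symm, rfl⟩] at this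
        push_cast at this
        linarith
  have total := Finset.sum_le_sum fun v (_ : v ∈ Finset.univ) => key v
  rw [Finset.sum_add_distrib, Finset.sum_fiberwise, Finset.sum_sub_distrib] at total
  simp only [Finset.sum_const, Finset.card_univ, Finset.sum_ite_eq', Finset.mem_univ, if_true,
    nsmul_eq_mul, card_dart] at total
  have euler := S.euler H.X_ne
  zify at euler
  push_cast at total
  linarith

end Weight

section Runs

variable {G : Type} [Group G] {X Y : G} {n : ℕ} [NeZero n] {w : ZMod n → ZMod 3} {I J : Type}
  {s : I → Bool} {S : Surf X Y w J s} {u : List Bool}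

lemma Surf.Flat.α_rel {i : I} {p : ZMod 26} (h : S.Flat (rel i (p + 1))) :
    S.α (rel i (p + 1)) = nxt.symm (S.α (rel i p)) := by
  rw [h.α_eq, nxt_symm_rel, add_sub_cancel_right]

lemma Surf.run_rel {i i' : I} {p b : ZMod 26} {m : ℕ} (h0 : S.α (rel i p) = rel i' b)
    (h : ∀ j : ℕ, j < m → S.Flat (rel i (p + j + 1))) (j : ℕ) (hj : j ≤ m) :
    S.α (rel i (p + j)) = rel i' (b - j) := by
  induction j with
  | zero => simpa using h0
  | succ j ih =>
    push_cast
    rw [← add_assoc, (h j hj).α_rel, ih (by omega), nxt_symm_rel, sub_sub]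

lemma Surf.run_out {i : I} {p : ZMod 26} {k : ZMod n} {m : ℕ} (h0 : S.α (rel i p) = out k)
    (h : ∀ j : ℕ, j < m → S.Flat (rel i (p + j + 1))) (j : ℕ) (hj : j ≤ m) :
    S.α (rel i (p + j)) = out (k - (j : ZMod n)) := by
  induction j with
  | zero => simpa using h0
  | succ j ih =>
    push_cast
    rw [← add_assoc, (h j hj).α_rel, ih (by omega), nxt_symm_out, sub_sub]

lemma Surf.turn_rel (i : I) (p : ZMod 26) : S.turn (rel i (p + 1)) = lab (s i) (red p) := by
  rw [← nxt_rel, S.turn_nxt, cornerLabel]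

lemma val_sub_one {n : ℕ} [NeZero n] {a : ZMod n} (ha : a ≠ 0) :
    1 ≤ a.val ∧ (a - 1).val = a.val - 1 := by
  have h1 : 1 ≤ a.val := Nat.one_le_iff_ne_zero.2 ((ZMod.val_ne_zero _).2 ha)
  have h2 := ZMod.val_lt a
  have : Fact (1 < n) := ⟨by omega⟩
  refine ⟨h1, ?_⟩
  rw [ZMod.val_sub (by rw [ZMod.val_one]; exact h1), ZMod.val_one]

namespace Surf.Reduced

lemma run_label_rel (H : S.Reduced u)
    {i i' : I} {p b : ZMod 26} {m : ℕ} (h0 : S.α (rel i p) = rel i' b)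
    (h : ∀ j : ℕ, j < m → S.Flat (rel i (p + j + 1))) (j : ℕ) (hj : j < m) :
    labSign (s i') (red b - j - 1) = !labSign (s i) (red p + j) := by
  have h1 := H.turn_flat (h j hj)
  have h2 := S.run_rel h0 h (j + 1) hj
  push_cast at h2
  rw [← add_assoc] at h2
  rw [S.turn_rot, h2, S.turn_rel, cornerLabel, lab_eq_sgn, lab_eq_sgn, ← sgn_not, sgn_inj] at h1
  simpa [sub_sub] using h1

lemma run_label_out (H : S.Reduced u)
    {i : I} {p : ZMod 26} {k : ZMod n} {m : ℕ} (h0 : S.α (rel i p) = out k)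
    (h : ∀ j : ℕ, j < m → S.Flat (rel i (p + j + 1))) (j : ℕ) (hj : j < m) :
    k - j ≠ 0 ∧ w (k - j - 1) = sgn (!labSign (s i) (red p + j)) := by
  have h1 := H.turn_flat (h j hj)
  have h2 := S.run_out h0 h (j + 1) hj
  push_cast at h2
  rw [← add_assoc] at h2
  constructor
  · intro h3
    apply (Surf.flat_rot.2 (h j hj)).1
    rw [S.rot_apply, h2, nxt_out, show k - ((j : ZMod n) + 1) + 1 = k - j by ring, h3]
    exact Equiv.Perm.SameCycle.refl _ _
  · rw [S.turn_rot, h2, S.turn_rel, cornerLabel, lab_eq_sgn, ← sgn_not] at h1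
    simpa [sub_sub] using h1

lemma sparse_run (H : S.Reduced u)
    {i : I} {p : ZMod 26} {k : ZMod n} {m : ℕ} (h0 : S.α (rel i p) = out k)
    (h : ∀ j : ℕ, j < m → S.Flat (rel i (p + j + 1))) : Sparse (mirrorRun (s i) (red p) m) := by
  have hk : ∀ j : ℕ, j ≤ m → j ≤ k.val ∧ (k - j).val = k.val - j := by
    intro j
    induction j with
    | zero => simp
    | succ j ih =>
      intro hj
      obtain ⟨h1, h2⟩ := ih (by omega)
      obtain ⟨h3, h4⟩ := val_sub_one (H.run_label_out h0 h j hj).1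
      push_cast
      rw [← sub_sub, h4]
      omega
  have hlen := H.length
  have hkn := ZMod.val_lt k
  have hm := (hk m le_rfl).1
  have : mirrorRun (s i) (red p) m = (u.drop (k.val - m)).take m := by
    apply List.ext_getElem
    · simp [mirrorRun]
      omega
    · intro a h1 h2
      simp only [mirrorRun, List.length_reverse, List.length_map, List.length_range] at h1
      have h3 := H.run_label_out h0 h (m - 1 - a) (by omega)
      have h4 := hk (m - 1 - a + 1) (by omega)
      have h5 : (k - (m - 1 - a : ℕ) - 1).val = k.val - m + a := by
        have : k - (m - 1 - a : ℕ) - 1 = k - (m - 1 - a + 1 : ℕ) := by push_cast; ring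
        rw [this, h4.2]
        omega
      rw [H.label _ (by omega), sgn_inj] at h3
      simp only [mirrorRun, List.getElem_reverse, List.getElem_map, List.getElem_range,
        List.length_map, List.length_range, List.getElem_take, List.getElem_drop]
      rw [← h3.2]
      simp only [h5]
  rw [this]
  exact H.sparse.mono ((List.take_prefix _ _).isInfix.trans (List.drop_suffix _ _).isInfix)

lemma exists_not_flat (H : S.Reduced u) [IsEmpty J] (i : I) (p : ZMod 26) :
    ∃ j : ℕ, j < 8 ∧ ¬ S.Flat (rel i (p + j + 1)) := by
  by_contra! h
  rcases h0 : S.α (rel i p) with k | ⟨i', b⟩ | ⟨j, b⟩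
  · exact not_sparse_mirrorRun _ _ (H.sparse_run h0 h)
  · have := mirror_of_long_run _ _ _ _ (H.run_label_rel h0 h)
    exact H.noMirror _ _ _ _ h0 this.1 this.2
  · exact isEmptyElim j

end Surf.Reduced

end Runs

section Discharge

variable {G : Type} [Group G] {X Y : G} {n : ℕ} [NeZero n] {w : ZMod n → ZMod 3} {I J : Type}
  {s : I → Bool}

/-- The number of flat vertices following the dart `rel i p`. -/
noncomputable def Surf.gap (S : Surf X Y w J s) (i : I) (p : ZMod 26) : ℕ :=
  sInf {k : ℕ | ¬ S.Flat (rel i (p + k + 1))}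

/-- The potential of the next vertex that is not flat, corrected by the distance to it. -/
noncomputable def Surf.level (S : Surf X Y w J s) (i : I) (p : ZMod 26) : ℤ :=
  potential (s i) (red p + S.gap i p + 1) (S.high (rel i (p + S.gap i p + 1))) - 6 * S.gap i p

/-- The side starting with `d`, seen from the other face. -/
noncomputable def Surf.opp (S : Surf X Y w J s) : Dart n I J → Dart n I J
  | rel i p => S.α (rel i (p + S.gap i p))
  | d => d

/-- The charge sent across the side starting with a dart. -/
noncomputable def Surf.charge (S : Surf X Y w J s) : Dart n I J → ℤ
  | rel i p => transfer (s i) (red p) (S.gap i p + 1) (S.high (rel i p))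
      (S.high (rel i (p + S.gap i p + 1)))
  | _ => 0

/-- A side between two relator faces starts with `d`. -/
def Surf.InnerSide (S : Surf X Y w J s) (d : Dart n I J) : Prop :=
  (∃ i p, d = rel i p) ∧ (∃ i p, S.α d = rel i p) ∧ ¬ S.Flat d

/-- A side between a relator face and the outer face starts with `d`. -/
def Surf.OuterSide (S : Surf X Y w J s) (d : Dart n I J) : Prop :=
  (∃ i p, d = rel i p) ∧ (∃ k, S.α d = out k) ∧ ¬ S.Flat d

variable {S : Surf X Y w J s} {u : List Bool}

lemma Surf.flat_of_lt_gap {i : I} {p : ZMod 26} {j : ℕ} (h : j < S.gap i p) :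
    S.Flat (rel i (p + j + 1)) := not_not.1 (Nat.notMem_of_lt_sInf h)

lemma Surf.gap_eq {i : I} {p : ZMod 26} {k : ℕ} (h : ∀ j : ℕ, j < k → S.Flat (rel i (p + j + 1)))
    (hk : ¬ S.Flat (rel i (p + k + 1))) : S.gap i p = k := by
  refine le_antisymm (Nat.sInf_le hk) ?_
  by_contra! h1
  exact Nat.sInf_mem (s := {k : ℕ | ¬ S.Flat (rel i (p + k + 1))}) ⟨k, hk⟩ (h _ h1)

namespace Surf.Reduced

lemma gap_spec (H : S.Reduced u) [IsEmpty J] (i : I) (p : ZMod 26) :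
    S.gap i p < 8 ∧ ¬ S.Flat (rel i (p + S.gap i p + 1)) := by
  obtain ⟨j, hj, hf⟩ := H.exists_not_flat i p
  exact ⟨(Nat.sInf_le hf).trans_lt hj,
    Nat.sInf_mem (s := {k : ℕ | ¬ S.Flat (rel i (p + k + 1))}) ⟨j, hf⟩⟩

lemma level_of_flat (H : S.Reduced u) [IsEmpty J] {i : I} {p : ZMod 26} (h : S.Flat (rel i p)) :
    S.level i p - S.level i (p - 1) = 6 := by
  have h1 : S.gap i (p - 1) = S.gap i p + 1 := by
    apply Surf.gap_eq
    · intro j hj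
      rcases j with _ | j
      · simpa using h
      · have := S.flat_of_lt_gap (i := i) (p := p) (j := j) (by omega)
        push_cast
        rwa [show p - 1 + ((j : ZMod 26) + 1) + 1 = p + j + 1 by ring]
    · push_cast
      rw [show p - 1 + ((S.gap i p : ZMod 26) + 1) + 1 = p + S.gap i p + 1 by ring]
      exact (H.gap_spec i p).2
  rw [Surf.level, Surf.level, h1, map_sub, map_one]
  push_cast
  rw [show p - 1 + ((S.gap i p : ZMod 26) + 1) + 1 = p + S.gap i p + 1 by ring,
    show red p - 1 + ((S.gap i p : ZMod 13) + 1) + 1 = red p + S.gap i p + 1 by ring]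
  ring

lemma level_of_not_flat {i : I} {p : ZMod 26} (h : ¬ S.Flat (rel i p)) :
    S.level i (p - 1) = potential (s i) (red p) (S.high (rel i p)) := by
  have h1 : S.gap i (p - 1) = 0 := Surf.gap_eq (by simp) (by simpa using h)
  simp [Surf.level, h1]

lemma opp_spec (H : S.Reduced u) [IsEmpty J] {i i' : I} {p b : ZMod 26}
    (h0 : S.α (rel i p) = rel i' b)
    (hf : ¬ S.Flat (rel i p)) :
    S.opp (rel i p) = rel i' (b - S.gap i p) ∧
    S.α (rel i' (b - S.gap i p)) = rel i (p + S.gap i p) ∧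
    ¬ S.Flat (rel i' (b - S.gap i p)) ∧
    S.gap i' (b - S.gap i p) = S.gap i p ∧
    S.opp (rel i' (b - S.gap i p)) = rel i p ∧
    S.high (rel i' (b - S.gap i p)) = S.high (rel i (p + S.gap i p + 1)) ∧
    S.high (rel i' (b + 1)) = S.high (rel i p) := by
  have hg := H.gap_spec i p
  have hrun := S.run_rel h0 (m := S.gap i p) (fun j hj => S.flat_of_lt_gap hj)
  have hrot : ∀ j : ℕ, j ≤ S.gap i p → S.rot (rel i (p + j)) = rel i' (b - j + 1) :=
    fun j hj => by rw [S.rot_apply, hrun j hj, nxt_rel]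
  have hα : S.α (rel i' (b - S.gap i p)) = rel i (p + S.gap i p) := by
    rw [← hrun _ le_rfl, S.invol]
  have hend : S.rot (rel i' (b - S.gap i p)) = rel i (p + S.gap i p + 1) := by
    rw [S.rot_apply, hα, nxt_rel]
  have hgap : S.gap i' (b - S.gap i p) = S.gap i p := by
    apply Surf.gap_eq
    · intro j hj
      have h1 := hrot (S.gap i p - j) (by omega)
      have h2 := S.flat_of_lt_gap (i := i) (p := p) (j := S.gap i p - j - 1) (by omega)
      have h3 : p + ((S.gap i p - j - 1 : ℕ) : ZMod 26) + 1 = p + (S.gap i p - j : ℕ) := by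
        rw [add_assoc, ← Nat.cast_succ]
        congr 3
        omega
      rw [h3, ← Surf.flat_rot, h1] at h2
      rwa [show b - (S.gap i p : ZMod 26) + j + 1 = b - (S.gap i p - j : ℕ) + 1 by
        rw [Nat.cast_sub (by omega)]; ring]
    · rw [sub_add_cancel]
      have h1 := hrot 0 (Nat.zero_le _)
      rw [Nat.cast_zero, add_zero, sub_zero] at h1
      rwa [← h1, Surf.flat_rot]
  refine ⟨hrun _ le_rfl, hα, ?_, hgap, ?_, ?_, ?_⟩
  · rw [← Surf.flat_rot, hend]
    exact hg.2
  · rw [Surf.opp, hgap, sub_add_cancel, ← h0, S.invol]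
  · rw [← hend, Surf.high_rot]
  · have h1 := hrot 0 (Nat.zero_le _)
    rw [Nat.cast_zero, add_zero, sub_zero] at h1
    rw [← h1, Surf.high_rot]

lemma innerSide_opp (H : S.Reduced u) [IsEmpty J] {d : Dart n I J} (h : S.InnerSide d) :
    S.InnerSide (S.opp d) ∧ S.opp (S.opp d) = d := by
  obtain ⟨⟨i, p, rfl⟩, ⟨i', b, h0⟩, hf⟩ := h
  obtain ⟨h1, h2, h3, -, h5, -⟩ := H.opp_spec h0 hf
  rw [h1]
  exact ⟨⟨⟨_, _, rfl⟩, ⟨_, _, h2⟩, h3⟩, h5⟩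

open Classical in
theorem level_le (H : S.Reduced u) [IsEmpty J] (i : I) (p : ZMod 26) :
    6 - 13 * S.weight (rel i p) +
      13 * (if S.InnerSide (rel i p) then S.charge (rel i p) - S.charge (S.opp (rel i p)) else 0) -
      26 * (if S.OuterSide (rel i p) then 1 else 0) ≤ S.level i p - S.level i (p - 1) := by
  by_cases hf : S.Flat (rel i p)
  · rw [if_neg fun h => h.2.2 hf, if_neg fun h => h.2.2 hf, H.level_of_flat hf, Surf.weight,
      if_pos hf]
    norm_num
  rw [level_of_not_flat hf, Surf.level, Surf.weight, if_neg hf]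
  have hg := H.gap_spec i p
  rcases h0 : S.α (rel i p) with k | ⟨i', b⟩ | ⟨j, b⟩
  · have h1 : ¬ S.InnerSide (rel i p) := fun h => by simp [Surf.InnerSide, h0] at h
    have h2 : S.OuterSide (rel i p) := ⟨⟨_, _, rfl⟩, ⟨_, h0⟩, hf⟩
    rw [if_neg h1, if_pos h2]
    have := potential_outer _ hg.1 (s i) (red p)
      (H.sparse_run h0 fun j hj => S.flat_of_lt_gap hj) (S.high (rel i p))
      (S.high (rel i (p + S.gap i p + 1)))
    linarith
  · have h2 : ¬ S.OuterSide (rel i p) := fun h => by simp [Surf.OuterSide, h0] at h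
    have h3 : S.InnerSide (rel i p) := ⟨⟨_, _, rfl⟩, ⟨_, _, h0⟩, hf⟩
    rw [if_neg h2, if_pos h3]
    obtain ⟨h1, -, -, h4, -, h6, h7⟩ := H.opp_spec h0 hf
    have := potential_inner _ hg.1 (s i) (s i') (red p) (red b)
      (H.run_label_rel h0 fun j hj => S.flat_of_lt_gap hj) (S.high (rel i p))
      (S.high (rel i (p + S.gap i p + 1)))
      (fun he => by
        have := H.turn_deg3 (S.deg3_of_high he)
        rw [S.turn_rot, h0, cornerLabel, ← sub_add_cancel p 1, S.turn_rel, lab_eq_sgn, lab_eq_sgn,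
          sgn_inj] at this
        simpa using this)
      (fun he => by
        have h8 : S.rot (rel i' (b - S.gap i p)) = rel i (p + S.gap i p + 1) := by
          rw [S.rot_apply, (H.opp_spec h0 hf).2.1, nxt_rel]
        have := H.turn_deg3 (S.deg3_of_high (h6.trans he))
        rw [h8, S.turn_rel, ← sub_add_cancel (b - (S.gap i p : ZMod 26)) 1, S.turn_rel, lab_eq_sgn,
          lab_eq_sgn, sgn_inj] at this
        simpa using this.symm)
      (fun h => H.noMirror _ _ _ _ h0 h.1 h.2)
    rw [h1, Surf.charge, Surf.charge, h4, sub_add_cancel, h6, h7, map_sub, map_natCast]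
    linarith
  · exact isEmptyElim j

end Surf.Reduced

end Discharge

section Contradiction

variable {G : Type} [Group G] {X Y : G} {n : ℕ} [NeZero n] {w : ZMod n → ZMod 3} {I J : Type}
  {s : I → Bool} {S : Surf X Y w J s} {u : List Bool}

namespace Surf.Reduced

open Classical in
lemma sum_transfer (H : S.Reduced u) [Fintype I] [Fintype J] [IsEmpty J] :
    ∑ d, (if S.InnerSide d then S.charge d - S.charge (S.opp d) else 0) = 0 := by
  rw [← Finset.sum_filter, Finset.sum_sub_distrib, sub_eq_zero]
  refine Finset.sum_nbij' S.opp S.opp ?_ ?_ ?_ ?_ ?_ <;> intro d hd <;>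
    rw [Finset.mem_filter] at hd
  · exact Finset.mem_filter.2 ⟨Finset.mem_univ _, (H.innerSide_opp hd.2).1⟩
  · exact Finset.mem_filter.2 ⟨Finset.mem_univ _, (H.innerSide_opp hd.2).1⟩
  · exact (H.innerSide_opp hd.2).2
  · exact (H.innerSide_opp hd.2).2
  · rw [(H.innerSide_opp hd.2).2]

open Classical in
lemma sum_outerSide [Fintype I] [Fintype J] [IsEmpty J] :
    ∑ d, 2 * (if S.OuterSide d then (1 : ℤ) else 0) ≤ ∑ k, S.weight (out k) := by
  let f : Dart n I J → ℤ := fun d => if ∃ k, d = out k then S.weight d else 0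
  have h1 : ∑ k, S.weight (out k) = ∑ d, f d := by
    rw [sum_dart]
    simp [f]
  rw [h1, ← Equiv.sum_comp S.rot f]
  refine Finset.sum_le_sum fun d _ => ?_
  by_cases h : S.OuterSide d
  · obtain ⟨-, ⟨k, hk⟩, hf⟩ := h
    have h2 : f (S.rot d) = S.weight (S.rot d) := if_pos ⟨k + 1, by rw [S.rot_apply, hk, nxt_out]⟩
    rw [h2, S.weight_rot, Surf.weight, if_neg hf]
    split_ifs <;> linarith [cost_mem (S.high d)]
  · rw [if_neg h]
    simp only [f]
    split_ifs
    · simpa using S.weight_nonneg _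
    · simp

theorem contradiction (H : S.Reduced u) [Fintype I] [Fintype J] [IsEmpty J] : False := by
  classical
  have h1 := H.sum_weight
  have h2 := H.sum_transfer
  have h3 := sum_outerSide (S := S)
  have h4 := Finset.sum_le_sum fun i (_ : i ∈ Finset.univ) =>
    Finset.sum_le_sum fun p (_ : p ∈ Finset.univ) => H.level_le i p
  have h5 : ∀ i, ∑ p, S.level i (p - 1) = ∑ p, S.level i p := fun i =>
    Equiv.sum_comp (Equiv.subRight (1 : ZMod 26)) (S.level i)
  have h6 : ∀ i : ZMod n, ¬ S.InnerSide (out i) := fun i h => by simp [Surf.InnerSide] at h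
  have h7 : ∀ i : ZMod n, ¬ S.OuterSide (out i) := fun i h => by simp [Surf.OuterSide] at h
  rw [sum_dart] at h1 h2 h3
  simp only [h6, if_false, Finset.sum_const_zero, zero_add] at h2
  simp only [h7, if_false, mul_zero, Finset.sum_const_zero, zero_add] at h3
  simp only [Finset.sum_sub_distrib, Finset.sum_add_distrib, ← Finset.mul_sum, h5, sub_self,
    Finset.sum_const, Finset.card_univ, ZMod.card, nsmul_eq_mul, h2] at h1 h2 h3 h4
  push_cast at h4
  linarith

end Surf.Reduced

end Contradiction

/-! ### Sparse words -/

lemma exists_conv (l : List (Unit ⊕ Bool)) : ∃ m, conv m = l := by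
  refine ⟨l.map (Sum.elim (fun _ => (0, true)) fun b => (1, b)), ?_⟩
  rw [conv, List.map_map]
  refine (List.map_congr_left fun a _ => ?_).trans (List.map_id l)
  rcases a with _ | b <;> rfl

/-- A quotient of the group. -/
def toPerm : GT W13 →* Equiv.Perm (Fin 3) :=
  PresentedGroup.toGroup (f := fun i => if i = 0 then Equiv.swap 0 1 else finRotate 3) (by
    intro r hr
    simp only [rels, Set.mem_insert_iff, Set.mem_singleton_iff] at hr
    rcases hr with rfl | rfl | rfl <;>
      simp only [x, y, W13, map_mul, map_pow, FreeGroup.lift_apply_of] <;> decide +kernel)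

lemma toPerm_x : toPerm (mk W13 x) = Equiv.swap 0 1 := PresentedGroup.toGroup.of _

lemma toPerm_y : toPerm (mk W13 y) = finRotate 3 := PresentedGroup.toGroup.of _

lemma mk_x_ne : mk W13 x ≠ 1 := fun h => by
  have := toPerm_x
  rw [h, map_one] at this
  revert this
  decide

lemma mk_y_ne : mk W13 y ≠ 1 := fun h => by
  have := toPerm_y
  rw [h, map_one] at this
  revert this
  decide

/-- The element `X Y^±1 X Y^±1 ⋯` given by a sequence of signs. -/
def syl {G : Type} [Group G] (X Y : G) (u : List Bool) : G :=
  (u.map fun b => X * zpow3 Y (sgn b)).prod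

section Syl

variable {G : Type} [Group G] {X Y : G}

lemma syl_append (u v : List Bool) : syl X Y (u ++ v) = syl X Y u * syl X Y v := by
  simp [syl]

lemma syl_singleton (b : Bool) : syl X Y [b] = X * zpow3 Y (sgn b) := by
  simp [syl]

lemma syl_take_succ (u : List Bool) (m : ℕ) (h : m < u.length) :
    syl X Y (u.take (m + 1)) = syl X Y (u.take m) * X * zpow3 Y (sgn u[m]) := by
  rw [List.take_succ_eq_append_getElem h, syl_append, syl_singleton, mul_assoc]

end Syl

/-- The exponents of a word `X Y^±1 X Y^±1 ⋯` of length `n`, followed by `Y^b`. -/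
def closing (u : List Bool) (b : ZMod 3) (i : ℕ) : List Bool :=
  u.getD i true :: if i + 1 = u.length then List.replicate b.val true else []

lemma expSum_closing {u : List Bool} {b : ZMod 3} {i : ℕ} (h : i < u.length) :
    expSum (closing u b i) = sgn u[i] + if i + 1 = u.length then b else 0 := by
  rw [closing, expSum, List.map_cons, List.sum_cons, List.getD_eq_getElem _ _ h]
  congr 1
  split_ifs
  · simp [sgn]
  · rfl

lemma ev_closing {G : Type} [Group G] {X Y : G} (hY : Y ^ 3 = 1) (u : List Bool) (b : ZMod 3)
    (hu : u ≠ []) : ev Y (fun _ : Unit => X) (word u.length (fun _ => ()) (closing u b)) =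
      syl X Y u * zpow3 Y b := by
  have hlen := List.length_pos_of_ne_nil hu
  have key : ∀ m < u.length, ev Y (fun _ : Unit => X) (word m (fun _ => ()) (closing u b)) =
      syl X Y (u.take m) := by
    intro m
    induction m with
    | zero => intro _; simp [word, ev, syl]
    | succ m ih =>
      intro hm
      rw [ev_word_succ _ _ _ hY, ih (by omega), expSum_closing (by omega), if_neg hm.ne, add_zero,
        syl_take_succ _ _ (by omega)]
  obtain ⟨m, hm⟩ : ∃ m, u.length = m + 1 := ⟨u.length - 1, by omega⟩
  rw [hm, ev_word_succ _ _ _ hY, key m (by omega), expSum_closing (by omega), if_pos hm.symm,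
    zpow3_add hY, ← mul_assoc, ← syl_take_succ, ← hm, List.take_length]

theorem syl_ne_zpow3 (u : List Bool) (hu : Sparse u) (hne : u ≠ []) (a : ZMod 3) :
    syl (mk W13 x) (mk W13 y) u ≠ zpow3 (mk W13 y) a := by
  induction hn : u.length using Nat.strong_induction_on generalizing u a with
  | _ n ih =>
  subst hn
  intro h
  have hlen := List.length_pos_of_ne_nil hne
  have : NeZero u.length := ⟨hlen.ne'⟩
  have hev := ev_closing (X := mk W13 x) mk_y_cube u (-a) hne
  rw [h, zpow3_neg mk_y_cube, mul_inv_cancel] at hev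
  obtain ⟨l, hl⟩ := exists_conv (word u.length (fun _ => ()) (closing u (-a)))
  have hmk : mk W13 (FreeGroup.mk l) = 1 := by rw [mk_eq_ev, hl, hev]
  obtain ⟨Dg⟩ := exists_diagram hmk
  rw [hl] at Dg
  obtain ⟨I, _, J, _, s, ⟨S⟩⟩ := exists_surf _ _ Dg hev
  obtain ⟨I, _, s, J, _, S, hS⟩ := exists_noMirror mk_x_ne mk_x_sq mk_y_cube S
  have hlabel : ∀ (i : ZMod u.length) (hi : i.val < u.dropLast.length),
      expSum (closing u (-a) i.val) = sgn u.dropLast[i.val] := fun i hi => by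
    rw [List.length_dropLast] at hi
    rw [expSum_closing (by omega), if_neg (by omega), add_zero, List.getElem_dropLast]
  have hpos : ∀ m : ℕ, m < u.length →
      S.h (out (m : ZMod u.length)) = S.h (out 0) * syl (mk W13 x) (mk W13 y) (u.take m) := by
    intro m
    induction m with
    | zero => intro _; simp [syl]
    | succ m ihm =>
      intro hm
      have hv : (m : ZMod u.length).val = m := ZMod.val_cast_of_lt (by omega)
      rw [Nat.cast_succ, ← nxt_out, S.h_nxt, ihm (by omega), cornerLabel, hv,
        expSum_closing (by omega), if_neg (by omega), add_zero, syl_take_succ _ _ (by omega)]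
      simp only [mul_assoc]
  have hlt : ∀ i j : ZMod u.length, i.val < j.val → ∀ b,
      S.h (out j) ≠ S.h (out i) * zpow3 (mk W13 y) b := by
    intro i j hij b h1
    have hi := hpos _ (ZMod.val_lt i)
    have hj := hpos _ (ZMod.val_lt j)
    rw [ZMod.natCast_zmod_val] at hi hj
    have hjl := ZMod.val_lt j
    have hsplit : u.take j.val = u.take i.val ++ (u.take j.val).drop i.val := by
      conv_lhs => rw [← List.take_append_drop i.val (u.take j.val), List.take_take,
        min_eq_left hij.le]
    rw [hi, hj, hsplit, syl_append, ← mul_assoc, mul_right_inj] at h1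
    have hl : ((u.take j.val).drop i.val).length = j.val - i.val := by
      rw [List.length_drop, List.length_take]; omega
    refine ih _ (by omega) _ (hu.mono ((List.drop_suffix _ _).isInfix.trans
      (List.take_prefix _ _).isInfix)) ?_ b rfl h1
    rw [← List.length_pos_iff]
    omega
  have H : S.Reduced u.dropLast :=
    { X_ne := mk_x_ne
      X_sq := mk_x_sq
      Y_cube := mk_y_cube
      Y_ne := mk_y_ne
      length := by rw [List.length_dropLast]; omega
      label := hlabel
      sparse := hu.mono (List.dropLast_prefix _).isInfix
      inj := fun i j b hb => by
        rcases lt_trichotomy i.val j.val with h1 | h1 | h1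
        · refine absurd ?_ (hlt i j h1 (-b))
          rw [hb, zpow3_neg mk_y_cube, mul_inv_cancel_right]
        · exact ZMod.val_injective _ h1
        · exact absurd hb (hlt j i h1 b)
      noMirror := hS }
  have : Fintype J := Fintype.ofIsEmpty
  exact H.contradiction

/-! ### Powers of `x y` and `x y⁻¹` -/

lemma infix_append_cases {f A B C : List Bool} (hf : f.length ≤ B.length + 1)
    (h : f <:+: A ++ B ++ C) : f <:+: A ++ B ∨ f <:+: B ++ C := by
  obtain ⟨P, Q, h⟩ := h
  have hlen := congrArg List.length h
  simp only [List.length_append] at hlen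
  rcases Nat.lt_or_ge P.length A.length with h1 | h1
  · left
    have h2 : P ++ f <+: A ++ B := List.prefix_of_prefix_length_le (l₃ := A ++ B ++ C)
      (h ▸ List.prefix_append _ _) (List.prefix_append _ _)
      (by simp only [List.length_append]; omega)
    exact (List.suffix_append _ _).isInfix.trans h2.isInfix
  · right
    have h2 : f ++ Q <:+ B ++ C := List.suffix_of_suffix_length_le (l₃ := A ++ B ++ C)
      (by rw [← h, List.append_assoc]; exact List.suffix_append _ _)
      (by rw [List.append_assoc]; exact List.suffix_append _ _)
      (by simp only [List.length_append]; omega)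
    exact (List.prefix_append _ _).isInfix.trans h2.isInfix

lemma length_forbidden : ∀ f ∈ forbidden, f.length ≤ 6 := by decide

lemma Sparse.glue {A B C : List Bool} (hB : 5 ≤ B.length) (h1 : Sparse (A ++ B))
    (h2 : Sparse (B ++ C)) : Sparse (A ++ B ++ C) := fun f hf h =>
  (infix_append_cases ((length_forbidden f hf).trans (by omega)) h).elim (h1 f hf) (h2 f hf)

lemma Sparse.pump {b : Bool} {v : List Bool} (h : Sparse (List.replicate 5 b ++ v)) {k : ℕ}
    (hk : 5 ≤ k) : Sparse (List.replicate k b ++ v) := by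
  induction k, hk using Nat.le_induction with
  | base => exact h
  | succ k hk ih =>
    obtain ⟨m, rfl⟩ := Nat.exists_eq_add_of_le hk
    rw [← List.replicate_append_replicate, List.append_assoc] at ih
    rw [show 5 + m + 1 = 1 + 5 + m by omega, ← List.replicate_append_replicate,
      ← List.replicate_append_replicate, List.append_assoc (_ ++ _)]
    refine Sparse.glue (by simp) ?_ ih
    clear h ih
    revert b
    decide

variable {G : Type} [Group G] {X Y : G}

lemma syl_replicate (N : ℕ) (b : Bool) :
    syl X Y (List.replicate N b) = (X * zpow3 Y (sgn b)) ^ N := by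
  simp [syl]

/-- The sign of the syllables of a letter. -/
def letterSign (a : Fin 2 × Bool) : Bool := decide (a.1 = 0) == a.2

lemma letter_eq (hX : X ^ 2 = 1) (hY : Y ^ 3 = 1) (N : ℕ) (a : Fin 2 × Bool) :
    (cond a.2 (if a.1 = 0 then (X * Y) ^ N else (X * Y ^ 2) ^ N)
      (if a.1 = 0 then (X * Y) ^ N else (X * Y ^ 2) ^ N)⁻¹) =
      cond a.2 1 X * syl X Y (List.replicate N (letterSign a)) * cond a.2 1 X := by
  have hX' : X⁻¹ = X := by rw [inv_eq_iff_mul_eq_one, ← pow_two, hX]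
  have hY' : Y ^ 2 = Y⁻¹ := by rw [eq_inv_iff_mul_eq_one, ← pow_succ, hY]
  rw [syl_replicate, zpow3_sgn hY, hY']
  have key : ∀ Z : G, ((X * Z) ^ N)⁻¹ = X * (X * Z⁻¹) ^ N * X := fun Z => by
    have := conj_pow (i := N) (a := X) (b := X * Z⁻¹)
    rw [hX'] at this
    rw [← this, ← inv_pow, mul_inv_rev, hX', ← mul_assoc, ← pow_two, hX, one_mul]
  obtain ⟨i, b⟩ := a
  fin_cases i <;> cases b <;> simp [letterSign, key]

theorem exists_sparse (hX : X ^ 2 = 1) (hY : Y ^ 3 = 1) {N : ℕ} (hN : 10 ≤ N)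
    (L : List (Fin 2 × Bool)) (a : Fin 2 × Bool) (hL : FreeGroup.IsReduced (a :: L)) :
    ∃ (t : List Bool) (e : Bool), Sparse (List.replicate (N - 1) (letterSign a) ++ t) ∧
      ((a :: L).map fun a => cond a.2 (if a.1 = 0 then (X * Y) ^ N else (X * Y ^ 2) ^ N)
        (if a.1 = 0 then (X * Y) ^ N else (X * Y ^ 2) ^ N)⁻¹).prod =
      cond a.2 1 X * syl X Y (List.replicate (N - 1) (letterSign a) ++ t) * cond e 1 X := by
  have flag : ∀ b : Bool, (cond b 1 X : G) * cond b 1 X = 1 := fun b => by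
    cases b <;> simp [← pow_two, hX]
  induction L generalizing a with
  | nil =>
    refine ⟨[letterSign a], a.2, ?_, ?_⟩
    · refine Sparse.pump ?_ (by omega)
      generalize letterSign a = b
      revert b
      decide
    · rw [List.map_singleton, List.prod_singleton, letter_eq hX hY, ← List.replicate_succ',
        Nat.sub_add_cancel (by omega)]
  | cons b L ih =>
    obtain ⟨hab, hL⟩ := FreeGroup.isReduced_cons_cons.1 hL
    obtain ⟨t, e, ht, hprod⟩ := ih b hL
    rw [List.map_cons, List.prod_cons, hprod, letter_eq hX hY]
    by_cases hflag : a.2 = b.2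
    · refine ⟨letterSign a :: (List.replicate (N - 1) (letterSign b) ++ t), e, ?_, ?_⟩
      · obtain ⟨m, hm⟩ : ∃ m, N - 1 = 5 + m := ⟨N - 6, by omega⟩
        rw [← List.singleton_append, ← List.append_assoc, ← List.replicate_succ']
        refine Sparse.pump ?_ (by omega)
        rw [hm, ← List.replicate_append_replicate, List.append_assoc] at ht ⊢
        rw [← List.append_assoc]
        refine Sparse.glue (by simp) ?_ ht
        generalize letterSign a = c, letterSign b = d
        revert c d
        decide
      · rw [← List.singleton_append, ← List.append_assoc, ← List.replicate_succ',
          Nat.sub_add_cancel (by omega), syl_append _ (_ ++ t), ← hflag]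
        simp only [mul_assoc]
        rw [← mul_assoc (cond a.2 1 X) (cond a.2 1 X), flag, one_mul]
    · have hsign : letterSign b = letterSign a := by
        obtain ⟨i, c⟩ := a
        obtain ⟨j, d⟩ := b
        revert hab hflag
        clear * -
        revert i j c d
        decide
      rw [hsign] at ht ⊢
      generalize letterSign a = c at *
      obtain ⟨m, rfl⟩ : ∃ m, N = m + 7 := ⟨N - 7, by omega⟩
      refine ⟨(!c) :: (List.replicate (m + 5) c ++ t), e, ?_, ?_⟩
      · refine Sparse.pump ?_ (by omega)
        have ht' : Sparse (List.replicate 5 c ++ (List.replicate m c ++ t)) := by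
          refine ht.mono (List.IsSuffix.isInfix ⟨[c], ?_⟩)
          rw [← List.append_assoc (List.replicate 5 c), List.replicate_append_replicate,
            ← List.append_assoc, List.singleton_append, ← List.replicate_succ]
          congr 2
          omega
        have h : List.replicate 5 c ++ (!c) :: (List.replicate (m + 5) c ++ t) =
            List.replicate 5 c ++ [!c] ++ List.replicate 5 c ++ (List.replicate m c ++ t) := by
          rw [add_comm m, ← List.replicate_append_replicate]
          simp only [List.append_assoc, List.cons_append, List.nil_append]
        rw [h]
        refine Sparse.glue (by simp) ?_ ht'
        clear * -
        revert c
        decide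
      · have hmid : X * zpow3 Y (sgn c) * X * (X * zpow3 Y (sgn c)) = X * zpow3 Y (sgn !c) := by
          have : sgn (!c) = sgn c + sgn c := by clear * -; revert c; decide
          rw [this, zpow3_add hY, mul_assoc _ X, ← mul_assoc X X, ← pow_two, hX, one_mul, mul_assoc]
        have hflags : (cond a.2 1 X : G) * cond b.2 1 X = X := by
          rw [Bool.eq_not.2 hflag]
          cases b.2 <;> simp
        have h1 : List.replicate (m + 7) c = List.replicate (m + 6) c ++ [c] :=
          List.replicate_succ'
        have h2 : List.replicate (m + 7 - 1) c ++ t = [c] ++ (List.replicate (m + 5) c ++ t) := rfl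
        have h3 : List.replicate (m + 7 - 1) c ++ (!c) :: (List.replicate (m + 5) c ++ t) =
          List.replicate (m + 6) c ++ ([!c] ++ (List.replicate (m + 5) c ++ t)) := rfl
        rw [h3, h2, h1]
        simp only [syl_append (List.replicate (m + 6) c), syl_append [_], syl_singleton]
        generalize syl X Y (List.replicate (m + 6) c) = g, syl X Y (_ ++ t) = g'
        calc _ = cond a.2 1 X * g * (X * zpow3 Y (sgn c)) * (cond a.2 1 X * cond b.2 1 X) *
              (X * zpow3 Y (sgn c)) * g' * cond e 1 X := by simp only [mul_assoc]
          _ = _ := by rw [hflags, ← hmid]; simp only [mul_assoc]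

end GenTriangle

theorem stmt_6 :
    ∃ N₀ : ℕ, ∀ N : ℕ, N₀ ≤ N →
      Function.Injective
        (FreeGroup.lift (fun i : Fin 2 =>
          if i = 0 then mk W13 ((x*y)^N) else mk W13 ((x*y^2)^N)) :
          FreeGroup (Fin 2) →* GT W13) := by
  refine ⟨10, fun N hN => (injective_iff_map_eq_one _).2 fun g hg => ?_⟩
  by_contra hne
  obtain ⟨a, L, hL⟩ := List.exists_cons_of_ne_nil (mt FreeGroup.toWord_eq_nil_iff.1 hne)
  have hred : FreeGroup.IsReduced (a :: L) := hL ▸ FreeGroup.isReduced_toWord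
  obtain ⟨t, e, ht, hprod⟩ := GenTriangle.exists_sparse GenTriangle.mk_x_sq GenTriangle.mk_y_cube
    hN L a hred
  rw [← FreeGroup.mk_toWord (x := g), hL, FreeGroup.lift_mk] at hg
  simp only [map_pow, map_mul] at hg
  rw [hg] at hprod
  obtain ⟨m, hm⟩ : ∃ m, N - 1 = m + 2 := ⟨N - 3, by omega⟩
  have hX := GenTriangle.mk_x_sq
  have hX' : (mk W13 x)⁻¹ = mk W13 x := by rw [inv_eq_iff_mul_eq_one, ← pow_two, hX]
  rw [hm] at ht hprod
  generalize GenTriangle.letterSign a = c at *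
  have key : ∀ f : Bool, GenTriangle.syl (mk W13 x) (mk W13 y) (List.replicate (m + 2) c ++ t) ≠
      cond f 1 (mk W13 x) := by
    rintro (_ | _) h
    · rw [List.replicate_succ, List.cons_append, ← List.singleton_append, GenTriangle.syl_append,
        GenTriangle.syl_singleton, mul_assoc, cond_false, mul_eq_left, mul_eq_one_iff_inv_eq,
        ← GenTriangle.zpow3_neg GenTriangle.mk_y_cube] at h
      exact GenTriangle.syl_ne_zpow3 _ (ht.mono (List.IsSuffix.isInfix ⟨[c], rfl⟩)) (by simp) _
        h.symm
    · exact GenTriangle.syl_ne_zpow3 _ ht (by simp) 0 (by rw [h, GenTriangle.zpow3_zero, cond_true])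
  have h : GenTriangle.syl (mk W13 x) (mk W13 y) (List.replicate (m + 2) c ++ t) =
      (cond a.2 1 (mk W13 x))⁻¹ * (cond e 1 (mk W13 x))⁻¹ := by
    rw [eq_inv_mul_iff_mul_eq, eq_inv_iff_mul_eq_one]
    exact hprod.symm
  refine key (a.2 == e) (h.trans ?_)
  cases a.2 <;> cases e <;> simp [hX', ← pow_two, hX]
end

section
/- The group G₅ = ⟨x,y | x² = y³ = ((xy)³xy²xy(xy²)²)² = 1⟩ contains a subgroup isomorphic to the free group of rank 2. -/
/-- The word `(xy)³xy²xy(xy²)²` defining `G₅`. -/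
def W5 : F := (x*y)^3 * (x*y^2) * (x*y) * (x*y^2)^2

open Equiv in
/-- Sanov's ping-pong for two permutations that shear a pair of real coordinates. -/
theorem injective_lift_of_shears {α : Type} (g : Fin 2 → Perm α) (P : α → Prop) (p q : α → ℝ)
    {r : ℝ} (hr : 2 < r) (hP : ∀ i z, P (g i z) ↔ P z) (hne : ∀ z, P z → p z ≠ 0 ∨ q z ≠ 0)
    (hp : ∃ z, P z ∧ p z = 0) (hq : ∃ z, P z ∧ q z = 0)
    (hp₀ : ∀ z, P z → p (g 0 z) = p z) (hq₀ : ∀ z, P z → q (g 0 z) = q z + r * p z)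
    (hp₁ : ∀ z, P z → p (g 1 z) = p z + r * q z) (hq₁ : ∀ z, P z → q (g 1 z) = q z) :
    Function.Injective (FreeGroup.lift g) := by
  let e : Fin 2 → Perm {z // P z} := fun i => (g i).subtypePerm (hP i)
  have he : Function.Injective (FreeGroup.lift e) := by
    have key : ∀ s t : ℝ, (s ≠ 0 ∨ t ≠ 0) → 0 < (r - 2) * (s ^ 2 + t ^ 2) := fun s t h =>
      mul_pos (sub_pos.2 hr) <| by rcases h with h | h <;> positivity
    refine FreeGroup.injective_lift_of_ping_pong (α := {z // P z}) e
      ![{z | 0 ≤ p z * (2 * q z - r * p z)}, {z | 0 ≤ q z * (2 * p z - r * q z)}]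
      ![{z | p z * (2 * q z + r * p z) < 0}, {z | q z * (2 * p z + r * q z) < 0}] ?_ ?_ ?_ ?_ ?_ ?_
    · obtain ⟨z, hz, hz0⟩ := hp
      obtain ⟨w, hw, hw0⟩ := hq
      exact Fin.forall_fin_two.2 ⟨⟨⟨z, hz⟩, by simp [hz0]⟩, ⟨⟨w, hw⟩, by simp [hw0]⟩⟩
    · intro i j hij
      refine Set.disjoint_left.2 fun z hi hj => ?_
      have := key _ _ (hne z z.2)
      fin_cases i <;> fin_cases j <;> simp at hij hi hj <;>
        nlinarith [sq_nonneg (p z - q z)]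
    · intro i j hij
      refine Set.disjoint_left.2 fun z hi hj => ?_
      have := key _ _ (hne z z.2)
      fin_cases i <;> fin_cases j <;> simp at hij hi hj <;>
        nlinarith [sq_nonneg (p z + q z)]
    · intro i j
      refine Set.disjoint_left.2 fun z hi hj => ?_
      have h₁ : 0 ≤ r * p z ^ 2 := by positivity
      have h₂ : 0 ≤ r * q z ^ 2 := by positivity
      fin_cases i <;> fin_cases j <;> simp at hi hj <;> nlinarith
    · refine Fin.forall_fin_two.2 ⟨?_, ?_⟩ <;> rintro _ ⟨z, hz, rfl⟩
      · have h₁ := hp₀ z z.2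
        have h₂ := hq₀ z z.2
        simp [e, h₁, h₂] at hz ⊢
        linarith
      · have h₁ := hp₁ z z.2
        have h₂ := hq₁ z z.2
        simp [e, h₁, h₂] at hz ⊢
        linarith
    · refine Fin.forall_fin_two.2 ⟨?_, ?_⟩ <;> rintro _ ⟨z, hz, rfl⟩
      · obtain ⟨w, rfl⟩ := (e 0).surjective z
        have h₁ := hp₀ w w.2
        have h₂ := hq₀ w w.2
        simp [e, h₁, h₂] at hz ⊢
        linarith
      · obtain ⟨w, rfl⟩ := (e 1).surjective z
        have h₁ := hp₁ w w.2
        have h₂ := hq₁ w w.2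
        simp [e, h₁, h₂] at hz ⊢
        linarith
  have hcomm : ∀ w z, (FreeGroup.lift e w z : α) = FreeGroup.lift g w z := by
    intro w
    induction w using FreeGroup.induction_on with
    | C1 => simp
    | of i => simp [e]
    | inv_of i ih =>
      intro z
      rw [map_inv, map_inv, Perm.eq_inv_iff_eq, ← ih]
      simp
    | mul v w hv hw => intro z; simp [hv, hw]
  refine (injective_iff_map_eq_one _).2 fun w hw => (injective_iff_map_eq_one _).1 he w ?_
  ext z
  simp [hcomm, hw]

/-- Exchange of the two copies of `R` in `Bool × R`. -/
def swapCopies (R : Type*) : Equiv.Perm (Bool × R) where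
  toFun p := (!p.1, p.2)
  invFun p := (!p.1, p.2)
  left_inv p := by simp
  right_inv p := by simp

@[simp] theorem swapCopies_apply {R : Type*} (s : Bool) (m : R) : swapCopies R (s, m) = (!s, m) := rfl

theorem fst_swapCopies {R : Type*} (z : Bool × R) : (swapCopies R z).1 = !z.1 := rfl

/-- Left multiplication by `a` on the first and by `b` on the second copy of `R`. -/
def mulCopies {R : Type*} [Monoid R] (a b : R) (ha : a ^ 3 = 1) (hb : b ^ 3 = 1) :
    Equiv.Perm (Bool × R) where
  toFun p := (p.1, (bif p.1 then b else a) * p.2)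
  invFun p := (p.1, (bif p.1 then b else a) ^ 2 * p.2)
  left_inv := by
    rintro ⟨_ | _, m⟩ <;> simp [← mul_assoc, ← pow_succ, ha, hb]
  right_inv := by
    rintro ⟨_ | _, m⟩ <;> simp [← mul_assoc, ← pow_succ', ha, hb]

section

variable {R : Type*} [Monoid R] {a b : R} (ha : a ^ 3 = 1) (hb : b ^ 3 = 1)

@[simp] theorem mulCopies_false (m : R) : mulCopies a b ha hb (false, m) = (false, a * m) := rfl

@[simp] theorem mulCopies_true (m : R) : mulCopies a b ha hb (true, m) = (true, b * m) := rfl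

theorem fst_mulCopies (z : Bool × R) : (mulCopies a b ha hb z).1 = z.1 := rfl

/-- The representation of `GT W5` induced from its subgroup of index two. -/
theorem exists_hom_GT
    (h₁ : a * b * a * b ^ 2 * a * b ^ 2 * a ^ 2 * (b * a * b * a ^ 2 * b * a ^ 2 * b ^ 2) = 1)
    (h₂ : b * a * b * a ^ 2 * b * a ^ 2 * b ^ 2 * (a * b * a * b ^ 2 * a * b ^ 2 * a ^ 2) = 1) :
    ∃ f : GT W5 →* Equiv.Perm (Bool × R),
      f (mk W5 x) = swapCopies R ∧ f (mk W5 y) = mulCopies a b ha hb := by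
  have h : ∀ w ∈ rels W5, FreeGroup.lift ![swapCopies R, mulCopies a b ha hb] w = 1 := by
    rintro w (rfl | rfl | rfl) <;> ext1 ⟨s, m⟩
    · simp [x, pow_succ]
    · have ha : a * a * a = 1 := by simpa [pow_succ] using ha
      have hb : b * b * b = 1 := by simpa [pow_succ] using hb
      cases s <;> simp [y, pow_succ, ← mul_assoc, ha, hb]
    · have h₁ := congrArg (· * m) h₁
      have h₂ := congrArg (· * m) h₂
      simp only [pow_succ, pow_zero, mul_assoc, one_mul] at h₁ h₂
      cases s <;> simp [W5, x, y, pow_succ, mul_assoc, h₁, h₂]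
  exact ⟨PresentedGroup.toGroup h, PresentedGroup.toGroup.of h, PresentedGroup.toGroup.of h⟩

end

set_option maxHeartbeats 2000000 in
/-- Values of the words used in the representation, up to rescaling of the generators. -/
theorem shear_words {s : ℝ} (hs : s ^ 2 = 1 - s) {a b : Matrix (Fin 3) (Fin 3) ℝ}
    (ha : a = !![0, 0, 1; 1, 0, 0; 0, s, 0]) (hb : b = !![0, s, 1; 0, 1, -1; -1, 0, -1]) :
    a * a * a = s • 1 ∧ b * b * b = (1 + s) • 1 ∧
    a * b * (a * (b * b) * (a * (b * b)) * (a * a)) = !![0, -1, 1; -1, -1, 0; 0, -1, 0] ∧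
    b * a * (b * (a * a) * (b * (a * a)) * (b * b)) = !![0, -1, 1; 0, 0, -1; 1, 0, -1] ∧
    a * b * (a * b) = !![1, -s, 1 + s; 0, 1, 0; 0, 0, 1] ∧
    a * a * (b * b) * (a * (b * b)) * (a * b * (a * b)) * (b * (a * a) * (b * a)) =
      !![1, 0, 0; -1 - 2 * s, 2, 1; 1 + 2 * s, -1, 0] := by
  have haa : a * a = !![0, s, 0; 0, 0, 1; s, 0, 0] := by
    rw [ha]
    ext i j
    fin_cases i <;> fin_cases j <;> simp [Matrix.mul_apply, Fin.sum_univ_three]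
  have hbb : b * b = !![-1, s, -1 - s; 1, 1, 0; 1, -s, 0] := by
    rw [hb]
    ext i j
    fin_cases i <;> fin_cases j <;> simp [Matrix.mul_apply, Fin.sum_univ_three] <;>
      grind
  have hab : a * b = !![-1, 0, -1; 0, s, 1; 0, s, -s] := by
    rw [ha, hb]
    ext i j
    fin_cases i <;> fin_cases j <;> simp [Matrix.mul_apply, Fin.sum_univ_three]
  have hba : b * a = !![s, s, 0; 1, -s, 0; 0, -s, -1] := by
    rw [ha, hb]
    ext i j
    fin_cases i <;> fin_cases j <;> simp [Matrix.mul_apply, Fin.sum_univ_three]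
  have hc : a * (b * b) = !![1, -s, 0; -1, s, -1 - s; s, s, 0] := by
    rw [ha, hbb]
    ext i j
    fin_cases i <;> fin_cases j <;> simp [Matrix.mul_apply, Fin.sum_univ_three]
  have he : b * (a * a) = !![s, 0, s; -s, 0, 1; -s, -s, 0] := by
    rw [hb, haa]
    ext i j
    fin_cases i <;> fin_cases j <;> simp [Matrix.mul_apply, Fin.sum_univ_three]
  have hcc : a * (b * b) * (a * (b * b)) = !![1 + s, -1, 1; -2 - s, 0, -1; 0, 0, -1] := by
    rw [hc]
    ext i j
    fin_cases i <;> fin_cases j <;> simp [Matrix.mul_apply, Fin.sum_univ_three] <;>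
      grind
  have hee : b * (a * a) * (b * (a * a)) = !![0, -1 + s, 1 - s; -1, -s, -1 + s; 0, 0, -1] := by
    rw [he]
    ext i j
    fin_cases i <;> fin_cases j <;> simp [Matrix.mul_apply, Fin.sum_univ_three] <;>
      grind
  have hm : a * (b * b) * (a * (b * b)) * (a * a) = !![s, 1, -1; -s, -1 - s, 0; -s, 0, 0] := by
    rw [hcc, haa]
    ext i j
    fin_cases i <;> fin_cases j <;> simp [Matrix.mul_apply, Fin.sum_univ_three] <;>
      grind
  have hn : b * (a * a) * (b * (a * a)) * (b * b) = !![0, -s, 0; 0, -1, 1 + s; -1, s, 0] := by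
    rw [hee, hbb]
    ext i j
    fin_cases i <;> fin_cases j <;> simp [Matrix.mul_apply, Fin.sum_univ_three] <;>
      grind
  have hu : a * b * (a * b) = !![1, -s, 1 + s; 0, 1, 0; 0, 0, 1] := by
    rw [hab]
    ext i j
    fin_cases i <;> fin_cases j <;> simp [Matrix.mul_apply, Fin.sum_univ_three] <;>
      grind
  have hg : a * a * (b * b) = !![s, s, 0; 1, -s, 0; -s, 1 - s, -1] := by
    rw [haa, hbb]
    ext i j
    fin_cases i <;> fin_cases j <;> simp [Matrix.mul_apply, Fin.sum_univ_three] <;>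
      grind
  have hg2 : a * a * (b * b) * (a * (b * b)) = !![0, 0, -1; 1 + s, -1, 1; -1 - s, 0, -s] := by
    rw [hg, hc]
    ext i j
    fin_cases i <;> fin_cases j <;> simp [Matrix.mul_apply, Fin.sum_univ_three] <;>
      grind
  have hgi : b * (a * a) * (b * a) = !![1 - s, 0, -s; -1 + s, -1, -1; -1, 0, 0] := by
    rw [he, hba]
    ext i j
    fin_cases i <;> fin_cases j <;> simp [Matrix.mul_apply, Fin.sum_univ_three] <;>
      grind
  have hgu : a * a * (b * b) * (a * (b * b)) * (a * b * (a * b)) =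
      !![0, 0, -1; 1 + s, -2, 3 + s; -1 - s, 1, -2 - 2 * s] := by
    rw [hg2, hu]
    ext i j
    fin_cases i <;> fin_cases j <;> simp [Matrix.mul_apply, Fin.sum_univ_three] <;>
      grind
  refine ⟨?_, ?_, ?_, ?_, hu, ?_⟩
  · rw [haa, ha]
    ext i j
    fin_cases i <;> fin_cases j <;> simp [Matrix.mul_apply, Fin.sum_univ_three]
  · rw [hbb, hb]
    ext i j
    fin_cases i <;> fin_cases j <;> simp [Matrix.mul_apply, Fin.sum_univ_three] <;>
      grind
  · rw [hab, hm]
    ext i j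
    fin_cases i <;> fin_cases j <;> simp [Matrix.mul_apply, Fin.sum_univ_three] <;>
      grind
  · rw [hba, hn]
    ext i j
    fin_cases i <;> fin_cases j <;> simp [Matrix.mul_apply, Fin.sum_univ_three] <;>
      grind
  · rw [hgu, hgi]
    ext i j
    fin_cases i <;> fin_cases j <;> simp [Matrix.mul_apply, Fin.sum_univ_three] <;>
      grind

/-- Real matrices of order three whose words describe a representation of `GT W5`. -/
theorem exists_matrices : ∃ (s : ℝ) (a b : Matrix (Fin 3) (Fin 3) ℝ),
    0 < s ∧ s ^ 2 = 1 - s ∧ a * a * a = 1 ∧ b * b * b = 1 ∧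
    a * b * (a * (b * b) * (a * (b * b)) * (a * a)) = !![0, -1, 1; -1, -1, 0; 0, -1, 0] ∧
    b * a * (b * (a * a) * (b * (a * a)) * (b * b)) = !![0, -1, 1; 0, 0, -1; 1, 0, -1] ∧
    a * b * (a * b) = !![1, -s, 1 + s; 0, 1, 0; 0, 0, 1] ∧
    a * a * (b * b) * (a * (b * b)) * (a * b * (a * b)) * (b * (a * a) * (b * a)) =
      !![1, 0, 0; -1 - 2 * s, 2, 1; 1 + 2 * s, -1, 0] := by
  obtain ⟨s, hs₀, hs⟩ : ∃ s : ℝ, 0 < s ∧ s ^ 2 = 1 - s := by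
    have h := Real.sq_sqrt (show (0 : ℝ) ≤ 5 by norm_num)
    have h₁ : 1 < √5 := Real.lt_sqrt_of_sq_lt (by norm_num)
    exact ⟨(√5 - 1) / 2, by linarith, by linarith⟩
  obtain ⟨c, hc⟩ : ∃ c : ℝ, c ^ 3 = 1 + s :=
    ⟨(1 + s) ^ (3⁻¹ : ℝ), by
      exact_mod_cast Real.rpow_inv_natCast_pow (n := 3) (by linarith) (by simp)⟩
  have hc₀ : c ≠ 0 := by
    rintro rfl
    norm_num at hc
    linarith
  obtain ⟨d, hcd⟩ : ∃ d : ℝ, c * d = 1 := ⟨c⁻¹, mul_inv_cancel₀ hc₀⟩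
  have hd : d ^ 3 = s := by
    have h : (c * d) ^ 3 = 1 := by rw [hcd, one_pow]
    rw [mul_pow, hc] at h
    linear_combination s * h - d ^ 3 * hs
  obtain ⟨haaa, hbbb, hm, hn, hu, hv⟩ := shear_words hs rfl rfl
  refine ⟨s, c • !![0, 0, 1; 1, 0, 0; 0, s, 0], d • !![0, s, 1; 0, 1, -1; -1, 0, -1],
    hs₀, hs, ?_, ?_, ?_, ?_, ?_, ?_⟩
  · simp only [smul_mul_smul_comm, haaa, smul_smul]
    exact (congrArg (· • _) (by linear_combination s * hc + hs)).trans (one_smul ℝ _)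
  · simp only [smul_mul_smul_comm, hbbb, smul_smul]
    exact (congrArg (· • _) (by linear_combination (1 + s) * hd + hs)).trans (one_smul ℝ _)
  · simp only [smul_mul_smul_comm, hm]
    exact (congrArg (· • _) (by grind)).trans (one_smul ℝ _)
  · simp only [smul_mul_smul_comm, hn]
    exact (congrArg (· • _) (by grind)).trans (one_smul ℝ _)
  · simp only [smul_mul_smul_comm, hu]
    exact (congrArg (· • _) (by grind)).trans (one_smul ℝ _)
  · simp only [smul_mul_smul_comm, hv]
    exact (congrArg (· • _) (by grind)).trans (one_smul ℝ _)

theorem stmt_8 :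
    ∃ H : Subgroup (GT W5), Nonempty (H ≃* FreeGroup (Fin 2)) := by
  obtain ⟨s, a, b, hs₀, hs, ha, hb, hm, hn, hu, hv⟩ := exists_matrices
  have hmn : (!![0, -1, 1; -1, -1, 0; 0, -1, 0] : Matrix (Fin 3) (Fin 3) ℝ) *
      !![0, -1, 1; 0, 0, -1; 1, 0, -1] = 1 := by
    ext i j
    fin_cases i <;> fin_cases j <;> simp [Matrix.mul_apply, Fin.sum_univ_three]
  have hnm := mul_eq_one_comm.1 hmn
  have ha3 : a ^ 3 = 1 := by rw [pow_three', ha]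
  have hb3 : b ^ 3 = 1 := by rw [pow_three', hb]
  obtain ⟨f, hfx, hfy⟩ := exists_hom_GT ha3 hb3
    (by rw [← hm, ← hn] at hmn; simpa only [pow_two, mul_assoc] using hmn)
    (by rw [← hm, ← hn] at hnm; simpa only [pow_two, mul_assoc] using hnm)
  let α : GT W5 := mk W5 y
  let β : GT W5 := mk W5 x * mk W5 y * mk W5 x
  let g : Fin 2 → GT W5 := ![α * β * (α * β),
    α * α * (β * β) * (α * (β * β)) * (α * β * (α * β)) * (β * (α * α) * (β * α))]
  have hα : f α = mulCopies a b ha3 hb3 := hfy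
  have hβ : f β = swapCopies _ * mulCopies a b ha3 hb3 * swapCopies _ := by simp [β, hfx, hfy]
  have hg₀ : ∀ m, f (g 0) (false, m) = (false, !![1, -s, 1 + s; 0, 1, 0; 0, 0, 1] * m) := by
    intro m
    rw [← hu]
    simp [g, hα, hβ, mul_assoc]
  have hg₁ : ∀ m, f (g 1) (false, m) =
      (false, !![1, 0, 0; -1 - 2 * s, 2, 1; 1 + 2 * s, -1, 0] * m) := by
    intro m
    rw [← hv]
    simp [g, hα, hβ, mul_assoc]
  have hfst : ∀ i z, (f (g i) z).1 = z.1 := by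
    refine Fin.forall_fin_two.2 ⟨fun z => ?_, fun z => ?_⟩ <;>
      simp [g, hα, hβ, fst_mulCopies, fst_swapCopies]
  let p : Bool × Matrix (Fin 3) (Fin 3) ℝ → ℝ := fun z => -s * z.2 1 0 + (1 + s) * z.2 2 0
  let q : Bool × Matrix (Fin 3) (Fin 3) ℝ → ℝ := fun z =>
    (1 + 2 * s) * z.2 0 0 - z.2 1 0 - z.2 2 0
  have hr : 2 < 1 + 2 * s := by nlinarith
  have h₀ : ∀ z, z.1 = false → p (f (g 0) z) = p z ∧ q (f (g 0) z) = q z + (1 + 2 * s) * p z := by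
    rintro ⟨_, m⟩ rfl
    rw [hg₀]
    constructor <;> simp [p, q, Matrix.vecMul, dotProduct, Fin.sum_univ_three] <;> ring
  have h₁ : ∀ z, z.1 = false → p (f (g 1) z) = p z + (1 + 2 * s) * q z ∧ q (f (g 1) z) = q z := by
    rintro ⟨_, m⟩ rfl
    rw [hg₁]
    constructor <;> simp [p, q, Matrix.vecMul, dotProduct, Fin.sum_univ_three] <;> ring
  have hinj : Function.Injective (FreeGroup.lift fun i => f (g i)) := by
    refine injective_lift_of_shears _ (fun z => z.1 = false ∧ (p z ≠ 0 ∨ q z ≠ 0)) p q hr ?_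
      (fun z hz => hz.2) ?_ ?_ (fun z hz => (h₀ z hz.1).1) (fun z hz => (h₀ z hz.1).2)
      (fun z hz => (h₁ z hz.1).1) (fun z hz => (h₁ z hz.1).2)
    · refine Fin.forall_fin_two.2 ⟨fun z => ?_, fun z => ?_⟩ <;> rw [hfst] <;>
        refine and_congr_right fun hz => ?_
      · rw [(h₀ z hz).1, (h₀ z hz).2]
        by_cases hp : p z = 0 <;> simp [hp]
      · rw [(h₁ z hz).1, (h₁ z hz).2]
        by_cases hq : q z = 0 <;> simp [hq]
    · exact ⟨(false, 1), by simp [p, q]; linarith, by simp [p]⟩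
    · refine ⟨(false, !![1, 0, 0; 0, 0, 0; 1 + 2 * s, 0, 0]), ⟨rfl, Or.inl ?_⟩, by simp [q]⟩
      simp [p]
      constructor <;> linarith
  have hginj : Function.Injective (FreeGroup.lift g) := by
    refine Function.Injective.of_comp (f := f) ?_
    rw [← MonoidHom.coe_comp]
    convert hinj
    ext1 i
    simp
  exact ⟨_, ⟨(MonoidHom.ofInjective hginj).symm⟩⟩
end

section
/- Each of the four groups G₈ = ⟨x,y | x² = y³ = ((xy)⁴xy²xy(xy²)³(xy)²xy²xy(xy²)²)² = 1⟩, G₁₂ = ⟨x,y | x² = y³ = ((xy)³(xy²)³xy(xy²)²)² = 1⟩, G₁₆ = ⟨x,y | x² = y³ = ((xy)⁴(xy²)³xy(xy²)³(xy)²xy²xy(xy²)²)² = 1⟩ and G₂₁ = ⟨x,y | x² = y³ = ((xy)⁴(xy²)³xy(xy²)²(xy)³(xy²)²)² = 1⟩ contains a subgroup isomorphic to the free group of rank 2. -/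
/-- The word `(xy)⁴xy²xy(xy²)³(xy)²xy²xy(xy²)²` defining `G₈`. -/
def W8 : F := (x*y)^4 * (x*y^2) * (x*y) * (x*y^2)^3 * (x*y)^2 * (x*y^2) * (x*y) * (x*y^2)^2

/-- The word `(xy)³(xy²)³xy(xy²)²` defining `G₁₂`. -/
def W12 : F := (x*y)^3 * (x*y^2)^3 * (x*y) * (x*y^2)^2

/-- The word `(xy)⁴(xy²)³xy(xy²)³(xy)²xy²xy(xy²)²` defining `G₁₆`. -/
def W16 : F := (x*y)^4 * (x*y^2)^3 * (x*y) * (x*y^2)^3 * (x*y)^2 * (x*y^2) * (x*y) * (x*y^2)^2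

/-- The word `(xy)⁴(xy²)³xy(xy²)²(xy)³(xy²)²` defining `G₂₁`. -/
def W21 : F := (x*y)^4 * (x*y^2)^3 * (x*y) * (x*y^2)^2 * (x*y)^3 * (x*y^2)^2

open Function

section PingPong

variable {α G : Type*}

theorem Equiv.Perm.zpow_apply_of_shear (a : Equiv.Perm α) (p q : α → ℝ) (c : ℝ)
    (hp : ∀ v, p (a v) = p v) (hq : ∀ v, q (a v) = q v + c * p v) (n : ℤ) :
    ∀ v, p ((a ^ n) v) = p v ∧ q ((a ^ n) v) = q v + n * (c * p v) := by
  induction n using Int.induction_on with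
  | zero => simp
  | succ n ih =>
    intro v
    rw [zpow_add_one, Equiv.Perm.mul_apply, (ih _).1, (ih _).2, hp, hq]
    push_cast
    exact ⟨rfl, by ring⟩
  | pred n ih =>
    intro v
    have h1 := hp (a⁻¹ v)
    have h2 := hq (a⁻¹ v)
    rw [show a (a⁻¹ v) = v from a.apply_symm_apply v] at h1 h2
    rw [zpow_sub_one, Equiv.Perm.mul_apply, (ih _).1, (ih _).2, h1, h2]
    push_cast
    exact ⟨rfl, by ring⟩

theorem abs_lt_abs_add_two_mul {p q : ℝ} (h : |q| < |p|) {n : ℤ} (hn : n ≠ 0) :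
    |p| < |q + n * (2 * p)| := by
  have h1 : (1 : ℝ) ≤ |(n : ℝ)| := by exact_mod_cast Int.one_le_abs hn
  have h2 : |(n : ℝ) * (2 * p)| = |(n : ℝ)| * (2 * |p|) := by simp [abs_mul]
  have h3 := abs_sub_abs_le_abs_sub ((n : ℝ) * (2 * p)) (-q)
  rw [abs_neg, sub_neg_eq_add, add_comm _ q, h2] at h3
  nlinarith [abs_nonneg p]

open Monoid Pointwise in
/-- Two permutations acting as opposite elementary shears by `±2` on a pair of real-valued
functions generate a free group of rank two. -/
theorem FreeGroup.injective_lift_of_shears (a b : Equiv.Perm α) (p q : α → ℝ)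
    (hap : ∀ v, p (a v) = p v) (haq : ∀ v, q (a v) = q v + 2 * p v)
    (hbq : ∀ v, q (b v) = q v) (hbp : ∀ v, p (b v) = p v + (-2) * q v)
    (hpq : ∃ v, |p v| < |q v|) (hqp : ∃ v, |q v| < |p v|) :
    Injective (FreeGroup.lift ![a, b]) := by
  have key : FreeGroup.lift ![a, b] =
      (CoprodI.lift fun i => FreeGroup.lift fun _ => ![a, b] i).comp
        (@freeGroupEquivCoprodI (Fin 2)).toMonoidHom := by
    ext i
    simp
  rw [key, MonoidHom.coe_comp]
  refine Injective.comp ?_ (MulEquiv.injective freeGroupEquivCoprodI)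
  let X : Fin 2 → Set α := ![{v | |p v| < |q v|}, {v | |q v| < |p v|}]
  refine CoprodI.lift_injective_of_ping_pong (H := fun _ : Fin 2 => FreeGroup Unit)
    (fun i => FreeGroup.lift fun _ => ![a, b] i) ?_ X ?_ ?_ ?_
  · exact Or.inr ⟨0, (Cardinal.natCast_le_aleph0 (n := 3)).trans (Cardinal.aleph0_le_mk _)⟩
  · intro i
    fin_cases i
    exacts [hpq, hqp]
  · have h : Disjoint (X 0) (X 1) :=
      Set.disjoint_left.2 fun v (h : |p v| < |q v|) h' => lt_asymm h h'
    intro i j hij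
    fin_cases i <;> fin_cases j
    exacts [(hij rfl).elim, h, h.symm, (hij rfl).elim]
  · intro i j hij
    refine FreeGroup.freeGroupUnitEquivInt.forall_congr_left.mpr ?_
    intro n hn
    have hn0 : n ≠ 0 := by
      rintro rfl
      exact hn (by simp [FreeGroup.freeGroupUnitEquivInt])
    change FreeGroup.lift (fun _ => ![a, b] i) (FreeGroup.of () ^ n) • X j ⊆ X i
    rw [map_zpow, FreeGroup.lift_apply_of]
    rintro _ ⟨v, hv, rfl⟩
    fin_cases i <;> fin_cases j
    · exact (hij rfl).elim
    · obtain ⟨h1, h2⟩ := a.zpow_apply_of_shear p q 2 hap haq n v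
      change |p ((a ^ n) v)| < |q ((a ^ n) v)|
      rw [h1, h2]
      exact abs_lt_abs_add_two_mul hv hn0
    · obtain ⟨h1, h2⟩ := b.zpow_apply_of_shear q p (-2) hbq hbp n v
      change |q ((b ^ n) v)| < |p ((b ^ n) v)|
      rw [h1, h2]
      have := abs_lt_abs_add_two_mul hv (neg_ne_zero.2 hn0)
      push_cast at this
      convert this using 2
      ring
    · exact (hij rfl).elim

end PingPong

section SwapRep

variable {V : Type*} (P Q : Equiv.Perm V)

/-- The homomorphism to permutations of `V ⊕ V` sending `x` to the swap and `y` to `(P, Q)`. -/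
def swapRep : F →* Equiv.Perm (V ⊕ V) :=
  FreeGroup.lift ![Equiv.sumComm _ _, Equiv.Perm.sumCongr P Q]

theorem swapRep_x_inl (v : V) : swapRep P Q x (Sum.inl v) = Sum.inr v := by
  simp [swapRep, x]

theorem swapRep_x_inr (v : V) : swapRep P Q x (Sum.inr v) = Sum.inl v := by
  simp [swapRep, x]

theorem swapRep_y_inl (v : V) : swapRep P Q y (Sum.inl v) = Sum.inl (P v) := by
  simp [swapRep, y]

theorem swapRep_y_inr (v : V) : swapRep P Q y (Sum.inr v) = Sum.inr (Q v) := by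
  simp [swapRep, y]

theorem swapRep_y_inv_inl (v : V) : swapRep P Q y⁻¹ (Sum.inl v) = Sum.inl (P⁻¹ v) := by
  simp [swapRep, y]

theorem swapRep_y_inv_inr (v : V) : swapRep P Q y⁻¹ (Sum.inr v) = Sum.inr (Q⁻¹ v) := by
  simp [swapRep, y]

theorem swapRep_x_sq : swapRep P Q x ^ 2 = 1 := by
  ext (v | v) <;> simp [sq, swapRep_x_inl, swapRep_x_inr]

variable {P Q}

theorem swapRep_y_cube (hP : P ^ 3 = 1) (hQ : Q ^ 3 = 1) : swapRep P Q y ^ 3 = 1 := by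
  have : swapRep P Q y = Equiv.Perm.sumCongrHom _ _ (P, Q) := by
    simp [swapRep, y]
  rw [this, ← map_pow, Prod.pow_mk, hP, hQ]
  exact map_one _

theorem swapRep_y_sq (hP : P ^ 3 = 1) (hQ : Q ^ 3 = 1) :
    swapRep P Q (y ^ 2) = swapRep P Q y⁻¹ := by
  rw [map_pow, map_inv]
  exact eq_inv_of_mul_eq_one_left (swapRep_y_cube hP hQ)

theorem swapRep_sq_eq_one {W : F} {A B : Equiv.Perm V}
    (hB : ∀ v, swapRep P Q W (Sum.inl v) = Sum.inr (B v))
    (hA : ∀ v, swapRep P Q W (Sum.inr v) = Sum.inl (A v)) (h : A * B = 1) :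
    swapRep P Q W ^ 2 = 1 := by
  have h' : B * A = 1 := mul_eq_one_comm.1 h
  ext (v | v) : 1
  · rw [sq, Equiv.Perm.mul_apply, hB, hA, ← Equiv.Perm.mul_apply, h]; rfl
  · rw [sq, Equiv.Perm.mul_apply, hA, hB, ← Equiv.Perm.mul_apply, h']; rfl

theorem swapRep_W8_sq (hP : P ^ 3 = 1) (hQ : Q ^ 3 = 1)
    (h : (Q * P * Q * P * Q⁻¹ * P * Q⁻¹ * P⁻¹ * Q⁻¹ * P * Q * P⁻¹ * Q * P⁻¹ * Q⁻¹) *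
      (P * Q * P * Q * P⁻¹ * Q * P⁻¹ * Q⁻¹ * P⁻¹ * Q * P * Q⁻¹ * P * Q⁻¹ * P⁻¹) = 1) :
    swapRep P Q W8 ^ 2 = 1 := by
  refine swapRep_sq_eq_one (fun v => ?_) (fun v => ?_) h <;>
    simp only [W8, sq (x * _), pow_three, pow_succ (x * _) 3, map_mul, swapRep_y_sq hP hQ,
      Equiv.Perm.mul_apply, swapRep_x_inl, swapRep_x_inr, swapRep_y_inl, swapRep_y_inr,
      swapRep_y_inv_inl, swapRep_y_inv_inr]

theorem swapRep_W12_sq (hP : P ^ 3 = 1) (hQ : Q ^ 3 = 1)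
    (h : (Q * P * Q * P⁻¹ * Q⁻¹ * P⁻¹ * Q * P⁻¹ * Q⁻¹) *
      (P * Q * P * Q⁻¹ * P⁻¹ * Q⁻¹ * P * Q⁻¹ * P⁻¹) = 1) :
    swapRep P Q W12 ^ 2 = 1 := by
  refine swapRep_sq_eq_one (fun v => ?_) (fun v => ?_) h <;>
    simp only [W12, sq (x * _), pow_three, map_mul, swapRep_y_sq hP hQ,
      Equiv.Perm.mul_apply, swapRep_x_inl, swapRep_x_inr, swapRep_y_inl, swapRep_y_inr,
      swapRep_y_inv_inl, swapRep_y_inv_inr]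

theorem swapRep_W16_sq (hP : P ^ 3 = 1) (hQ : Q ^ 3 = 1)
    (h : (Q * P * Q * P * Q⁻¹ * P⁻¹ * Q⁻¹ * P * Q⁻¹ * P⁻¹ * Q⁻¹ * P * Q * P⁻¹ * Q * P⁻¹ * Q⁻¹) *
      (P * Q * P * Q * P⁻¹ * Q⁻¹ * P⁻¹ * Q * P⁻¹ * Q⁻¹ * P⁻¹ * Q * P * Q⁻¹ * P * Q⁻¹ * P⁻¹) = 1) :
    swapRep P Q W16 ^ 2 = 1 := by
  refine swapRep_sq_eq_one (fun v => ?_) (fun v => ?_) h <;>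
    simp only [W16, sq (x * _), pow_three, pow_succ (x * _) 3, map_mul, swapRep_y_sq hP hQ,
      Equiv.Perm.mul_apply, swapRep_x_inl, swapRep_x_inr, swapRep_y_inl, swapRep_y_inr,
      swapRep_y_inv_inl, swapRep_y_inv_inr]

theorem swapRep_W21_sq (hP : P ^ 3 = 1) (hQ : Q ^ 3 = 1)
    (h : (Q * P * Q * P * Q⁻¹ * P⁻¹ * Q⁻¹ * P * Q⁻¹ * P⁻¹ * Q * P * Q * P⁻¹ * Q⁻¹) *
      (P * Q * P * Q * P⁻¹ * Q⁻¹ * P⁻¹ * Q * P⁻¹ * Q⁻¹ * P * Q * P * Q⁻¹ * P⁻¹) = 1) :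
    swapRep P Q W21 ^ 2 = 1 := by
  refine swapRep_sq_eq_one (fun v => ?_) (fun v => ?_) h <;>
    simp only [W21, sq (x * _), pow_three, pow_succ (x * _) 3, map_mul, swapRep_y_sq hP hQ,
      Equiv.Perm.mul_apply, swapRep_x_inl, swapRep_x_inr, swapRep_y_inl, swapRep_y_inr,
      swapRep_y_inv_inl, swapRep_y_inv_inr]

/-- First generator of the free subgroup. -/
def shearA : F := (x * y) ^ 8

/-- Second generator of the free subgroup. -/
def shearB : F := y * (x * y) ^ 8 * y⁻¹

theorem swapRep_shearA_inl (v : V) :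
    swapRep P Q shearA (Sum.inl v) = Sum.inl (((Q * P) ^ 4) v) := by
  simp only [shearA, map_mul, pow_succ, pow_zero, one_mul, Equiv.Perm.mul_apply,
    swapRep_x_inl, swapRep_x_inr, swapRep_y_inl, swapRep_y_inr]

theorem swapRep_shearA_inr (v : V) :
    swapRep P Q shearA (Sum.inr v) = Sum.inr (((P * Q) ^ 4) v) := by
  simp only [shearA, map_mul, pow_succ, pow_zero, one_mul, Equiv.Perm.mul_apply,
    swapRep_x_inl, swapRep_x_inr, swapRep_y_inl, swapRep_y_inr]

theorem swapRep_shearB_inl (v : V) :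
    swapRep P Q shearB (Sum.inl v) = Sum.inl ((P * (Q * P) ^ 4 * P⁻¹) v) := by
  change swapRep P Q (y * shearA * y⁻¹) _ = _
  simp only [map_mul, Equiv.Perm.mul_apply, swapRep_y_inv_inl, swapRep_shearA_inl, swapRep_y_inl]

theorem swapRep_shearB_inr (v : V) :
    swapRep P Q shearB (Sum.inr v) = Sum.inr ((Q * (P * Q) ^ 4 * Q⁻¹) v) := by
  change swapRep P Q (y * shearA * y⁻¹) _ = _
  simp only [map_mul, Equiv.Perm.mul_apply, swapRep_y_inv_inr, swapRep_shearA_inr, swapRep_y_inr]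

end SwapRep

section Representation

open Matrix

/-- The ring `ℤ[φ]`, where `φ ^ 2 = φ + 1`. -/
abbrev GoldenInt : Type := QuadraticAlgebra ℤ 1 1

/-- The golden ratio as an element of `ℤ[φ]`. -/
def phi : GoldenInt := ⟨0, 1⟩

/-- The real embedding of `ℤ[φ]`. -/
noncomputable def goldenToReal : GoldenInt →+* ℝ :=
  (QuadraticAlgebra.lift (a := (1 : ℤ)) (b := 1) (A := ℝ)
    ⟨Real.goldenRatio, by rw [← sq, Real.goldenRatio_sq]; simp [add_comm]⟩).toRingHom

theorem goldenToReal_mk (m n : ℤ) :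
    goldenToReal ⟨m, n⟩ = m + n * Real.goldenRatio := by
  simp [goldenToReal]

/-- A matrix with cube `φ`. -/
def matP : GL (Fin 3) GoldenInt where
  val := !![0, 0, phi; 1, 0, 0; 0, 1, 0]
  inv := !![0, 1, 0; 0, 0, 1; phi - 1, 0, 0]
  val_inv := by decide +kernel
  inv_val := by decide +kernel

/-- A matrix with cube `φ⁻¹`. -/
def matQ : GL (Fin 3) GoldenInt where
  val := !![phi - 1, 1 - phi, phi - 1; 0, 0, -1; 2 - phi, phi - 1, 1 - phi]
  inv := phi • !![phi - 1, 1 - phi, phi - 1; 0, 0, -1; 2 - phi, phi - 1, 1 - phi] ^ 2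
  val_inv := by decide +kernel
  inv_val := by decide +kernel

/-- The action of `GL₃(ℝ)` on `ℝ³` as a homomorphism to permutations. -/
noncomputable def vecPerm : GL (Fin 3) ℝ →* Equiv.Perm (Fin 3 → ℝ) :=
  (MulAction.toPermHom (LinearMap.GeneralLinearGroup ℝ (Fin 3 → ℝ)) (Fin 3 → ℝ)).comp
    Matrix.GeneralLinearGroup.toLin.toMonoidHom

/-- The action of `GL₃(ℤ[φ]) × ℝˣ` on `ℝ³`, the second factor acting by scalars. -/
noncomputable def scaledAct : GL (Fin 3) GoldenInt × ℝˣ →* Equiv.Perm (Fin 3 → ℝ) :=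
  vecPerm.comp ((Matrix.GeneralLinearGroup.map goldenToReal).noncommCoprod
    (Matrix.GeneralLinearGroup.scalar (Fin 3)) fun M t => by
      ext i j
      simp [Matrix.GeneralLinearGroup.scalar, mul_comm])

theorem scaledAct_apply (M : GL (Fin 3) GoldenInt) (t : ℝˣ) (v : Fin 3 → ℝ) :
    scaledAct (M, t) v =
      (M : Matrix (Fin 3) (Fin 3) GoldenInt).map goldenToReal *ᵥ ((t : ℝ) • v) := by
  change (_ * _) *ᵥ v = _
  rw [← mulVec_mulVec]
  congr 1
  ext i
  simp [Matrix.GeneralLinearGroup.scalar]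

theorem scaledAct_eq_one {M : GL (Fin 3) GoldenInt} {t : ℝˣ} {c : GoldenInt}
    (hM : (M : Matrix (Fin 3) (Fin 3) GoldenInt) = diagonal fun _ => c)
    (hc : goldenToReal c * t = 1) : scaledAct (M, t) = 1 := by
  ext v i
  rw [scaledAct_apply, hM, diagonal_map (map_zero _), mulVec_diagonal]
  simp [← mul_assoc, hc]

/-- The real cube root of `φ⁻¹`. -/
noncomputable def cubeRoot : ℝˣ :=
  Units.mk0 (Real.goldenRatio⁻¹ ^ ((3 : ℕ) : ℝ)⁻¹)
    (Real.rpow_pos_of_pos (inv_pos.2 Real.goldenRatio_pos) _).ne'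

theorem cubeRoot_pow : (cubeRoot : ℝ) ^ 3 = Real.goldenRatio⁻¹ :=
  Real.rpow_inv_natCast_pow (inv_pos.2 Real.goldenRatio_pos).le (by norm_num)

/-- An order-three transformation of `ℝ³`. -/
noncomputable def permP : Equiv.Perm (Fin 3 → ℝ) := scaledAct (matP, cubeRoot)

/-- An order-three transformation of `ℝ³`. -/
noncomputable def permQ : Equiv.Perm (Fin 3 → ℝ) := scaledAct (matQ, cubeRoot⁻¹)

theorem permP_pow : permP ^ 3 = 1 := by
  rw [permP, ← map_pow, Prod.pow_mk]
  refine scaledAct_eq_one (c := phi) (by decide +kernel) ?_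
  rw [phi, goldenToReal_mk, Units.val_pow_eq_pow_val, cubeRoot_pow,
    Int.cast_zero, zero_add, Int.cast_one, one_mul, mul_inv_cancel₀ Real.goldenRatio_ne_zero]

theorem permQ_pow : permQ ^ 3 = 1 := by
  rw [permQ, ← map_pow, Prod.pow_mk]
  refine scaledAct_eq_one (c := phi - 1) (by decide +kernel) ?_
  rw [map_sub, map_one, phi, goldenToReal_mk, Units.val_pow_eq_pow_val, Units.val_inv_eq_inv_val,
    inv_pow, cubeRoot_pow, inv_inv]
  push_cast
  linear_combination Real.goldenRatio_sq

theorem swapRep_permP_permQ_W8_sq : swapRep permP permQ W8 ^ 2 = 1 := by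
  apply swapRep_W8_sq permP_pow permQ_pow
  simp only [permP, permQ, ← map_mul, ← map_inv, Prod.mk_mul_mk, Prod.inv_mk]
  exact scaledAct_eq_one (c := 1) (by decide +kernel)
    (by rw [map_one, one_mul, Units.val_eq_one]; group)

theorem swapRep_permP_permQ_W12_sq : swapRep permP permQ W12 ^ 2 = 1 := by
  apply swapRep_W12_sq permP_pow permQ_pow
  simp only [permP, permQ, ← map_mul, ← map_inv, Prod.mk_mul_mk, Prod.inv_mk]
  exact scaledAct_eq_one (c := 1) (by decide +kernel)
    (by rw [map_one, one_mul, Units.val_eq_one]; group)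

theorem swapRep_permP_permQ_W16_sq : swapRep permP permQ W16 ^ 2 = 1 := by
  apply swapRep_W16_sq permP_pow permQ_pow
  simp only [permP, permQ, ← map_mul, ← map_inv, Prod.mk_mul_mk, Prod.inv_mk]
  exact scaledAct_eq_one (c := 1) (by decide +kernel)
    (by rw [map_one, one_mul, Units.val_eq_one]; group)

theorem swapRep_permP_permQ_W21_sq : swapRep permP permQ W21 ^ 2 = 1 := by
  apply swapRep_W21_sq permP_pow permQ_pow
  simp only [permP, permQ, ← map_mul, ← map_inv, Prod.mk_mul_mk, Prod.inv_mk]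
  exact scaledAct_eq_one (c := 1) (by decide +kernel)
    (by rw [map_one, one_mul, Units.val_eq_one]; group)

theorem permQ_mul_permP_pow_four_apply (v : Fin 3 → ℝ) :
    ((permQ * permP) ^ 4) v = ![v 0 - 2 * Real.goldenRatio * v 1, v 1,
      v 2 + 2 * (Real.goldenRatio - 1) * v 1] := by
  have h : ((matQ * matP) ^ 4 : GL (Fin 3) GoldenInt).val =
      !![⟨1, 0⟩, ⟨0, -2⟩, ⟨0, 0⟩; ⟨0, 0⟩, ⟨1, 0⟩, ⟨0, 0⟩; ⟨0, 0⟩, ⟨-2, 2⟩, ⟨1, 0⟩] := by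
    decide +kernel
  rw [permP, permQ, ← map_mul, ← map_pow, Prod.mk_mul_mk, inv_mul_cancel, Prod.pow_mk, one_pow,
    scaledAct_apply, h]
  ext i
  fin_cases i <;> simp [Matrix.mulVec, dotProduct, Fin.sum_univ_three, goldenToReal_mk] <;> ring

theorem permP_conj_pow_four_apply (v : Fin 3 → ℝ) :
    (permP * (permQ * permP) ^ 4 * permP⁻¹) v =
      ![v 0 + 2 * v 2, v 1 - 2 * Real.goldenRatio * v 2, v 2] := by
  have h : (matP * (matQ * matP) ^ 4 * matP⁻¹ : GL (Fin 3) GoldenInt).val =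
      !![⟨1, 0⟩, ⟨0, 0⟩, ⟨2, 0⟩; ⟨0, 0⟩, ⟨1, 0⟩, ⟨0, -2⟩; ⟨0, 0⟩, ⟨0, 0⟩, ⟨1, 0⟩] := by
    decide +kernel
  rw [permP, permQ, ← map_mul, Prod.mk_mul_mk, inv_mul_cancel, ← map_pow, Prod.pow_mk, one_pow,
    ← map_inv, Prod.inv_mk, ← map_mul, Prod.mk_mul_mk, ← map_mul, Prod.mk_mul_mk, mul_one,
    mul_inv_cancel, scaledAct_apply, h]
  ext i
  fin_cases i <;> simp [Matrix.mulVec, dotProduct, Fin.sum_univ_three, goldenToReal_mk]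
  ring

theorem injective_lift_swapRep_shears :
    Injective (FreeGroup.lift ![swapRep permP permQ shearA, swapRep permP permQ shearB]) := by
  refine FreeGroup.injective_lift_of_shears _ _
    (Sum.elim (fun v : Fin 3 → ℝ => v 1) 0)
    (Sum.elim (fun v : Fin 3 → ℝ => Real.goldenRatio * v 2) 0)
    ?_ ?_ ?_ ?_ ⟨Sum.inl ![0, 0, 1], ?_⟩ ⟨Sum.inl ![0, 1, 0], ?_⟩
  · rintro (v | v)
    · simp [swapRep_shearA_inl, permQ_mul_permP_pow_four_apply, -Equiv.Perm.coe_mul]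
    · simp [swapRep_shearA_inr, -Equiv.Perm.coe_mul]
  · rintro (v | v)
    · simp only [swapRep_shearA_inl, permQ_mul_permP_pow_four_apply, Sum.elim_inl]
      simp
      linear_combination 2 * v 1 * Real.goldenRatio_sq
    · simp [swapRep_shearA_inr]
  · rintro (v | v)
    · simp only [swapRep_shearB_inl, permP_conj_pow_four_apply, Sum.elim_inl]
      simp
    · simp [swapRep_shearB_inr]
  · rintro (v | v)
    · simp only [swapRep_shearB_inl, permP_conj_pow_four_apply, Sum.elim_inl]
      simp
      ring
    · simp [swapRep_shearB_inr]
  · simpa using Real.goldenRatio_ne_zero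
  · simp

end Representation

theorem exists_subgroup_mulEquiv_freeGroup {W : F} (hW : swapRep permP permQ W ^ 2 = 1) :
    ∃ H : Subgroup (GT W), Nonempty (H ≃* FreeGroup (Fin 2)) := by
  have h : ∀ r ∈ rels W,
      FreeGroup.lift (fun i => swapRep permP permQ (FreeGroup.of i)) r = 1 := by
    have h' : FreeGroup.lift (fun i => swapRep permP permQ (FreeGroup.of i)) =
        swapRep permP permQ := by ext1; simp
    rw [h']
    rintro r (rfl | rfl | rfl)
    · rw [map_pow, swapRep_x_sq]
    · rw [map_pow, swapRep_y_cube permP_pow permQ_pow]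
    · rw [map_pow, hW]
  let ρ : GT W →* Equiv.Perm ((Fin 3 → ℝ) ⊕ (Fin 3 → ℝ)) := PresentedGroup.toGroup h
  have hρ : ρ.comp (mk W) = swapRep permP permQ := by
    exact FreeGroup.ext_hom _ _ fun i => PresentedGroup.toGroup.of h
  let ψ : F →* GT W := FreeGroup.lift ![mk W shearA, mk W shearB]
  have hψ : Injective ψ := by
    have h : ρ.comp ψ =
        FreeGroup.lift ![swapRep permP permQ shearA, swapRep permP permQ shearB] := by
      ext1 i
      fin_cases i <;> simp [ψ, ← hρ]
    refine Injective.of_comp (f := ρ) ?_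
    rw [← MonoidHom.coe_comp, h]
    exact injective_lift_swapRep_shears
  exact ⟨ψ.range, ⟨(MonoidHom.ofInjective hψ).symm⟩⟩

theorem stmt_9 :
    (∃ H : Subgroup (GT W8), Nonempty (H ≃* FreeGroup (Fin 2))) ∧
    (∃ H : Subgroup (GT W12), Nonempty (H ≃* FreeGroup (Fin 2))) ∧
    (∃ H : Subgroup (GT W16), Nonempty (H ≃* FreeGroup (Fin 2))) ∧
    (∃ H : Subgroup (GT W21), Nonempty (H ≃* FreeGroup (Fin 2))) :=
  ⟨exists_subgroup_mulEquiv_freeGroup swapRep_permP_permQ_W8_sq,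
    exists_subgroup_mulEquiv_freeGroup swapRep_permP_permQ_W12_sq,
    exists_subgroup_mulEquiv_freeGroup swapRep_permP_permQ_W16_sq,
    exists_subgroup_mulEquiv_freeGroup swapRep_permP_permQ_W21_sq⟩
end

section
/- In the group G₅ = ⟨x,y | x² = y³ = ((xy)³xy²xy(xy²)²)² = 1⟩, the following elements are trivial: ((xy)⁴xy²xy(xy²)³(xy)²xy²xy(xy²)²)², ((xy)³(xy²)³xy(xy²)²)², ((xy)⁴(xy²)³xy(xy²)³(xy)²xy²xy(xy²)²)² and ((xy)⁴(xy²)³xy(xy²)²(xy)³(xy²)²)². Consequently G₅ is a homomorphic image of each of the groups G₈, G₁₂, G₁₆, G₂₁ obtained by imposing x² = y³ = 1 together with the corresponding relator. -/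
theorem conj_eq_one {G : Type*} [Group G] {r : G} (hr : r = 1) (g : G) : g * r * g⁻¹ = 1 := by
  simp [hr]

/-- Rewriting rules that bring words in `x` and `y` to normal form in `ℤ/2 * ℤ/3`. -/
theorem cancel_gens {G : Type*} [Group G] {x y : G} (hx : x ^ 2 = 1) (hy : y ^ 3 = 1) :
    x * x = 1 ∧ (∀ g, x * (x * g) = g) ∧ y * (y * y) = 1 ∧ (∀ g, y * (y * (y * g)) = g) ∧
      x⁻¹ = x ∧ y⁻¹ = y * y := by
  have hxx : x * x = 1 := by rw [← pow_two, hx]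
  have hyy : y * (y * y) = 1 := by rw [← hy, pow_three]
  refine ⟨hxx, fun g => ?_, hyy, fun g => ?_, inv_eq_of_mul_eq_one_right hxx,
    inv_eq_of_mul_eq_one_right hyy⟩
  · rw [← mul_assoc, hxx, one_mul]
  · rw [← mul_assoc y y g, ← mul_assoc, hyy, one_mul]

/-! Each square below equals, in `ℤ/2 * ℤ/3`, a product of conjugates of trivial elements. -/

theorem W12_sq_eq_one {G : Type*} [Group G] {x y : G} (hx : x ^ 2 = 1) (hy : y ^ 3 = 1)
    (h : ((x*y)^3 * (x*y^2) * (x*y) * (x*y^2)^2) ^ 2 = 1) :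
    ((x*y)^3 * (x*y^2)^3 * (x*y) * (x*y^2)^2) ^ 2 = 1 := by
  obtain ⟨-, hxx', hyy, hyy', hxi, hyi⟩ := cancel_gens hx hy
  have key := congrArg₂ (· * ·) (conj_eq_one h 1)
    (conj_eq_one h (y * (x*y) * (x*y^2) * (x*y) * (x*y^2)^3))
  simp only [pow_succ, pow_zero, one_mul, mul_one, mul_inv_rev, inv_one, mul_assoc, hxi, hyi,
    hxx', hyy, hyy'] at key ⊢
  exact key

theorem W8_sq_eq_one {G : Type*} [Group G] {x y : G} (hx : x ^ 2 = 1) (hy : y ^ 3 = 1)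
    (h : ((x*y)^3 * (x*y^2) * (x*y) * (x*y^2)^2) ^ 2 = 1) :
    ((x*y)^4 * (x*y^2) * (x*y) * (x*y^2)^3 * (x*y)^2 * (x*y^2) * (x*y) *
    (x*y^2)^2) ^ 2 = 1 := by
  obtain ⟨hxx, hxx', hyy, hyy', hxi, hyi⟩ := cancel_gens hx hy
  have key := congrArg₂ (· * ·) (conj_eq_one (inv_eq_one.2 h) ((x*y)^2 * x))
    (conj_eq_one (inv_eq_one.2 h) (x * y^2 * x))
  simp only [pow_succ, pow_zero, one_mul, mul_one, mul_inv_rev, mul_assoc, hxi, hyi,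
    hxx, hxx', hyy, hyy'] at key ⊢
  exact key

theorem W16_sq_eq_one {G : Type*} [Group G] {x y : G} (hx : x ^ 2 = 1) (hy : y ^ 3 = 1)
    (h : ((x*y)^3 * (x*y^2) * (x*y) * (x*y^2)^2) ^ 2 = 1) :
    ((x*y)^4 * (x*y^2)^3 * (x*y) * (x*y^2)^3 * (x*y)^2 * (x*y^2) * (x*y) *
    (x*y^2)^2) ^ 2 = 1 := by
  obtain ⟨hxx, hxx', hyy, hyy', hxi, hyi⟩ := cancel_gens hx hy
  have key := congrArg₂ (· * ·) (congrArg₂ (· * ·)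
    (conj_eq_one (inv_eq_one.2 h) (x * y^2 * x))
    (conj_eq_one (inv_eq_one.2 h) (y * (x*y) * (x*y^2) * (x*y) * (x*y^2)^2 * (x*y)^3 * (x*y^2) *
      (x*y) * (x*y^2)^3 * (x*y)^3 * (x*y^2) * (x*y) * (x*y^2))))
    (conj_eq_one h (y * (x*y) * (x*y^2) * (x*y) * (x*y^2)^2 * (x*y)^3 * (x*y^2) * (x*y) *
      (x*y^2)^3))
  simp only [pow_succ, pow_zero, one_mul, mul_one, mul_inv_rev, mul_assoc, hxi, hyi,
    hxx, hxx', hyy, hyy'] at key ⊢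
  exact key

theorem W21_sq_eq_one {G : Type*} [Group G] {x y : G} (hx : x ^ 2 = 1) (hy : y ^ 3 = 1)
    (h : ((x*y)^3 * (x*y^2) * (x*y) * (x*y^2)^2) ^ 2 = 1) :
    ((x*y)^4 * (x*y^2)^3 * (x*y) * (x*y^2)^2 * (x*y)^3 * (x*y^2)^2) ^ 2 =
    1 := by
  obtain ⟨hxx, hxx', hyy, hyy', hxi, hyi⟩ := cancel_gens hx hy
  have h12 := W12_sq_eq_one hx hy h
  have key := congrArg₂ (· * ·) (conj_eq_one h12 (x*y))
    (conj_eq_one h12 ((x*y^2) * (x*y) * (x*y^2)^2))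
  simp only [pow_succ, pow_zero, one_mul, mul_one, mul_inv_rev, mul_assoc, hxi, hyi,
    hxx, hxx', hyy, hyy'] at key ⊢
  exact key

theorem mk_eq_one_of_mem_rels {W r : F} (hr : r ∈ rels W) : mk W r = 1 :=
  PresentedGroup.one_of_mem hr

/-- If `V ^ 2` is trivial in `GT W`, then `GT W` is a quotient of `GT V`. -/
theorem exists_surjective_of_sq_eq_one {V W : F} (hV : mk W (V ^ 2) = 1) :
    ∃ f : GT V →* GT W, Function.Surjective f := by
  have hker : Subgroup.normalClosure (rels V) ≤ (mk W).ker := by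
    refine Subgroup.normalClosure_le_normal ?_
    rintro r (rfl | rfl | rfl)
    · exact mk_eq_one_of_mem_rels (by simp [rels])
    · exact mk_eq_one_of_mem_rels (by simp [rels])
    · exact hV
  exact ⟨QuotientGroup.lift _ (mk W) fun r hr => hker hr,
    QuotientGroup.lift_surjective_of_surjective _ _ (PresentedGroup.mk_surjective _) _⟩

theorem stmt_10 :
    (mk W5 (W8 ^ 2) = 1 ∧ mk W5 (W12 ^ 2) = 1 ∧
     mk W5 (W16 ^ 2) = 1 ∧ mk W5 (W21 ^ 2) = 1) ∧
    ((∃ f : GT W8 →* GT W5, Function.Surjective f) ∧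
     (∃ f : GT W12 →* GT W5, Function.Surjective f) ∧
     (∃ f : GT W16 →* GT W5, Function.Surjective f) ∧
     (∃ f : GT W21 →* GT W5, Function.Surjective f)) := by
  have hx : mk W5 x ^ 2 = 1 := by
    rw [← map_pow]; exact mk_eq_one_of_mem_rels (by simp [rels])
  have hy : mk W5 y ^ 3 = 1 := by
    rw [← map_pow]; exact mk_eq_one_of_mem_rels (by simp [rels])
  have h5 : ((mk W5 x * mk W5 y)^3 * (mk W5 x * mk W5 y^2) * (mk W5 x * mk W5 y) *
      (mk W5 x * mk W5 y^2)^2) ^ 2 = 1 := by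
    simp only [← map_mul, ← map_pow]
    exact mk_eq_one_of_mem_rels (by simp [rels, W5])
  have h8 : mk W5 (W8 ^ 2) = 1 := by
    simpa only [W8, map_mul, map_pow] using W8_sq_eq_one hx hy h5
  have h12 : mk W5 (W12 ^ 2) = 1 := by
    simpa only [W12, map_mul, map_pow] using W12_sq_eq_one hx hy h5
  have h16 : mk W5 (W16 ^ 2) = 1 := by
    simpa only [W16, map_mul, map_pow] using W16_sq_eq_one hx hy h5
  have h21 : mk W5 (W21 ^ 2) = 1 := by
    simpa only [W21, map_mul, map_pow] using W21_sq_eq_one hx hy h5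
  exact ⟨⟨h8, h12, h16, h21⟩, exists_surjective_of_sq_eq_one h8,
    exists_surjective_of_sq_eq_one h12, exists_surjective_of_sq_eq_one h16,
    exists_surjective_of_sq_eq_one h21⟩
end

section
/- The group G₃ = ⟨x,y | x² = y³ = ((xy)³xy²xy(xy²)²xyxy²)² = 1⟩ is large: it has a subgroup of finite index that admits a surjective homomorphism onto the free group of rank 2. -/
/-- The word `(xy)³xy²xy(xy²)²xyxy²` defining `G₃`. -/
def W3 : F := (x*y)^3 * (x*y^2) * (x*y) * (x*y^2)^2 * (x*y) * (x*y^2)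

open SemidirectProduct in
/-- A homomorphism to a permutational wreath product `K ≀ Perm α` restricts to a homomorphism to
`K` on the preimage of the stabilizer of a point, which has finite index when `α` is finite. -/
theorem exists_finiteIndex_hom_of_wreath {G K α : Type*} [Group G] [Group K] [Finite α]
    (φ : G →* (α → K) ⋊[mulAutArrow] Equiv.Perm α) (a : α) :
    ∃ H : Subgroup G, H.FiniteIndex ∧ ∃ f : H →* K,
      ∀ g, (φ g).right a = a → ∃ h : H, f h = (φ g).left a := by
  let H : Subgroup G :=
    (MulAction.stabilizer (Equiv.Perm α) a).comap (rightHom.comp φ)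
  have fixes (h : H) : (φ h).right a = a := h.2
  refine ⟨H, ⟨by rw [Subgroup.index_comap]; exact Subgroup.FiniteIndex.index_ne_zero⟩, ⟨⟨fun h => (φ h).left a, by simp⟩, fun g h => ?_⟩,
    fun g hg => ⟨⟨g, hg⟩, rfl⟩⟩
  have : (φ g).right⁻¹ a = a := by rw [Equiv.Perm.inv_eq_iff_eq, fixes]
  change (φ (g * h)).left a = _
  rw [map_mul, mul_left, Pi.mul_apply]
  exact congrArg (fun b => (φ g).left a * (φ h).left b) this

/-- The wreath product of the free group of rank two with the permutations of 60 points. -/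
abbrev FreeWreath : Type :=
  (Fin 60 → FreeGroup (Fin 2)) ⋊[mulAutArrow] Equiv.Perm (Fin 60)

/-- The involution by which `x` permutes the 60 points. -/
def permX : Equiv.Perm (Fin 60) :=
  Function.Involutive.toPerm ![0, 1, 6, 7, 8, 9, 2, 3, 4, 5, 18, 19, 20, 21, 22, 23, 24, 25, 10, 11,
    12, 13, 14, 15, 16, 17, 36, 37, 38, 39, 32, 33, 30, 31, 40, 41, 26, 27, 28, 29,
    34, 35, 52, 53, 47, 46, 45, 44, 54, 55, 56, 57, 42, 43, 48, 49, 50, 51, 58, 59] (by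
    unfold Function.Involutive; decide)

/-- The permutation of order three by which `y` permutes the 60 points. -/
def permY : Equiv.Perm (Fin 60) where
  toFun := ![4, 5, 0, 1, 2, 3, 12, 13, 16, 17, 6, 7, 10, 11, 8, 9, 14, 15, 26, 27,
    30, 31, 34, 35, 19, 18, 25, 24, 20, 21, 28, 29, 22, 23, 32, 33, 44, 45, 48, 49,
    52, 53, 36, 37, 42, 43, 38, 39, 46, 47, 40, 41, 50, 51, 56, 57, 58, 59, 54, 55]
  invFun := ![2, 3, 4, 5, 0, 1, 10, 11, 14, 15, 12, 13, 6, 7, 16, 17, 8, 9, 25, 24,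
    28, 29, 32, 33, 27, 26, 18, 19, 30, 31, 20, 21, 34, 35, 22, 23, 42, 43, 46, 47,
    50, 51, 44, 45, 36, 37, 48, 49, 38, 39, 52, 53, 40, 41, 58, 59, 54, 55, 56, 57]
  left_inv := by unfold Function.LeftInverse; decide
  right_inv := by unfold Function.RightInverse Function.LeftInverse; decide

/-- The image of `x` in the wreath product. -/
def wreathX : FreeWreath :=
  ⟨fun i => if i = 31 then FreeGroup.of 1 else if i = 33 then (FreeGroup.of 1)⁻¹ else 1, permX⟩

/-- The image of `y` in the wreath product. -/
def wreathY : FreeWreath :=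
  ⟨fun i => if i = 28 then FreeGroup.of 0 else if i = 30 then (FreeGroup.of 0)⁻¹ else 1, permY⟩

theorem wreath_eq_one_of_forall {g : FreeWreath} (hl : ∀ i, g.left i = 1)
    (hr : ∀ i, g.right i = i) : g = 1 :=
  SemidirectProduct.ext (funext hl) (Equiv.ext hr)

theorem wreathX_sq : wreathX ^ 2 = 1 := by
  rw [pow_two]
  exact wreath_eq_one_of_forall (by decide +kernel) (by decide +kernel)

theorem wreathY_cube : wreathY ^ 3 = 1 := by
  rw [pow_three]
  exact wreath_eq_one_of_forall (by decide +kernel) (by decide +kernel)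

theorem wreath_W3_sq :
    ((wreathX * wreathY) ^ 3 * (wreathX * wreathY ^ 2) * (wreathX * wreathY) *
      (wreathX * wreathY ^ 2) ^ 2 * (wreathX * wreathY) * (wreathX * wreathY ^ 2)) ^ 2 = 1 := by
  simp only [pow_two, pow_three]
  exact wreath_eq_one_of_forall (by decide +kernel) (by decide +kernel)

/-- The images of the two generators of the free group. -/
def wreathGen : Fin 2 → FreeWreath := ![wreathX, wreathY]

/-- The homomorphism from `G₃` to the wreath product. -/
def toWreath : GT W3 →* FreeWreath :=
  PresentedGroup.toGroup (f := wreathGen) <| by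
    rintro r (rfl | rfl | rfl)
    · simpa [x, wreathGen] using wreathX_sq
    · simpa [y, wreathGen] using wreathY_cube
    · simpa [W3, x, y, wreathGen] using wreath_W3_sq

/-- A word fixing the base point with label the first free generator. -/
def loopWord₀ : F := y * x * y * x * y⁻¹ * x * y * x * y⁻¹ * x * y⁻¹ * x

/-- A word fixing the base point with label the second free generator. -/
def loopWord₁ : F := x * y⁻¹ * x * y⁻¹ * x * y * x * y⁻¹ * x * y * x * y

theorem lift_loopWord₀ :
    (FreeGroup.lift wreathGen loopWord₀).right 26 = 26 ∧
      (FreeGroup.lift wreathGen loopWord₀).left 26 = FreeGroup.of 0 := by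
  decide +kernel

theorem lift_loopWord₁ :
    (FreeGroup.lift wreathGen loopWord₁).right 26 = 26 ∧
      (FreeGroup.lift wreathGen loopWord₁).left 26 = FreeGroup.of 1 := by
  decide +kernel

theorem stmt_11 :
    ∃ H : Subgroup (GT W3), H.FiniteIndex ∧
      ∃ f : H →* FreeGroup (Fin 2), Function.Surjective f := by
  obtain ⟨H, hH, f, hf⟩ := exists_finiteIndex_hom_of_wreath toWreath 26
  refine ⟨H, hH, f, ?_⟩
  rw [← MonoidHom.range_eq_top, eq_top_iff, ← FreeGroup.closure_range_of, Subgroup.closure_le]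
  rintro _ ⟨i, rfl⟩
  fin_cases i
  · obtain ⟨h, hh⟩ := hf (mk W3 loopWord₀) lift_loopWord₀.1
    exact ⟨h, hh.trans lift_loopWord₀.2⟩
  · obtain ⟨h, hh⟩ := hf (mk W3 loopWord₁) lift_loopWord₁.1
    exact ⟨h, hh.trans lift_loopWord₁.2⟩
end

section
/- The group G₇ = ⟨x,y | x² = y³ = ((xy)⁴(xy²)²xyxy²xy(xy²)²)² = 1⟩ is large: it has a subgroup of finite index that admits a surjective homomorphism onto the free group of rank 2. -/
/-- The word `(xy)⁴(xy²)²xyxy²xy(xy²)²` defining `G₇`. -/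
def W7 : F := (x*y)^4 * (x*y^2)^2 * (x*y) * (x*y^2) * (x*y) * (x*y^2)^2

open Equiv

/-- Permutations of `ι` with voltages in `A`: the unrestricted wreath product of `A` by
`Perm ι`. -/
abbrev VoltagePerm (ι A : Type*) [Group A] : Type _ :=
  (ι → A) ⋊[mulAutArrow] Perm ι

/-- The voltage accumulated at a point `i`, as a homomorphism on the preimage of the stabilizer
of `i` under an action by permutations with voltages. -/
def voltageHom {G ι A : Type*} [Group G] [Group A] (φ : G →* VoltagePerm ι A) (i : ι) :
    (MulAction.stabilizer (Perm ι) i).comap (SemidirectProduct.rightHom.comp φ) →* A where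
  toFun g := (φ g).left i
  map_one' := by simp
  map_mul' := by
    rintro ⟨g, hg⟩ ⟨h, hh⟩
    have hi : (φ g).right⁻¹ • i = i := inv_smul_eq_iff.2 (MulAction.mem_stabilizer_iff.1 hg).symm
    simp only [MulMemClass.mk_mul_mk, map_mul, SemidirectProduct.mul_left, Pi.mul_apply]
    congr 1
    exact congrArg (φ h).left hi

/-- A group acting by permutations of a finite set with voltages in `FreeGroup α` has a
finite-index subgroup mapping onto `FreeGroup α` as soon as each free generator is the voltage of
an element fixing a given base point. -/
theorem exists_finiteIndex_surjective_freeGroup {G ι α : Type*} [Group G] [Finite ι]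
    (φ : G →* VoltagePerm ι (FreeGroup α)) (i : ι)
    (hφ : ∀ a, ∃ g, (φ g).right i = i ∧ (φ g).left i = FreeGroup.of a) :
    ∃ H : Subgroup G, H.FiniteIndex ∧ ∃ f : H →* FreeGroup α, Function.Surjective f := by
  refine ⟨(MulAction.stabilizer (Perm ι) i).comap (SemidirectProduct.rightHom.comp φ),
    ⟨?_⟩, voltageHom φ i, ?_⟩
  · rw [Subgroup.index_comap]
    exact Subgroup.FiniteIndex.index_ne_zero
  · rw [← MonoidHom.range_eq_top, eq_top_iff, ← FreeGroup.closure_range_of, Subgroup.closure_le]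
    rintro _ ⟨a, rfl⟩
    obtain ⟨g, hg, ha⟩ := hφ a
    exact ⟨⟨g, hg⟩, ha⟩

/-- The involution by which `x` acts on the thirty cosets of a subgroup of `GT W7`. -/
def xPerm : Perm (Fin 30) :=
  let σ : Fin 30 → Fin 30 :=
    ![15, 3, 6, 1, 9, 12, 2, 13, 10, 4, 8, 14, 5, 7, 11,
      0, 18, 21, 16, 24, 27, 17, 28, 25, 19, 23, 29, 20, 22, 26]
  ⟨σ, σ, by decide, by decide⟩

/-- The permutation of order three by which `y` acts on the thirty cosets. -/
def yPerm : Perm (Fin 30) :=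
  ⟨![2, 0, 1, 5, 3, 4, 8, 6, 7, 11, 9, 10, 14, 12, 13,
      17, 15, 16, 20, 18, 19, 23, 21, 22, 26, 24, 25, 29, 27, 28],
    ![1, 2, 0, 4, 5, 3, 7, 8, 6, 10, 11, 9, 13, 14, 12,
      16, 17, 15, 19, 20, 18, 22, 23, 21, 25, 26, 24, 28, 29, 27],
    by decide, by decide⟩

/-- The voltages of `x`: only the two edges `11 — 14` and `26 — 29` carry nontrivial ones. -/
def xVoltage (i : Fin 30) : F :=
  if i = 11 then x else if i = 14 then x⁻¹ else if i = 26 then y else if i = 29 then y⁻¹ else 1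

/-- The images of the generators of `GT W7` as permutations with voltages. -/
def genImage : Fin 2 → VoltagePerm (Fin 30) F := ![⟨xVoltage, xPerm⟩, ⟨1, yPerm⟩]

theorem lift_genImage_eq_one : ∀ r ∈ rels W7, FreeGroup.lift genImage r = 1 := by
  rintro r (rfl | rfl | rfl) <;> refine SemidirectProduct.ext ?_ ?_ <;> decide +kernel

theorem stmt_12 :
    ∃ H : Subgroup (GT W7), H.FiniteIndex ∧
      ∃ f : H →* FreeGroup (Fin 2), Function.Surjective f := by
  refine exists_finiteIndex_surjective_freeGroup
    (PresentedGroup.toGroup lift_genImage_eq_one) 0 fun a ↦ ?_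
  fin_cases a
  · refine ⟨mk W7 (y * x * y * x * y⁻¹ * x * y * x * y * x * y⁻¹), ?_⟩
    decide +kernel
  · refine ⟨mk W7 (x * y * x * y * x * y⁻¹ * x * y * x * y * x * y⁻¹ * x), ?_⟩
    decide +kernel
end
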